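/- Let Ω ⊂ ℝ² be a bounded open simply connected set and let w be twice continuously differentiable on an open neighborhood of the closure of Ω with Δw + e^w > 0 on the closure of Ω and ∫_Ω e^w dy ≤ 8π. Let ω ⊂ Ω be a nonempty open set whose first Dirichlet eigenvalue of −Δ − e^w is nonpositive, in the sense that for every ε > 0 there exists a smooth function φ : ℝ² → ℝ, compactly supported in ω, with ∫ φ² dy = 1 and ∫ |∇φ|² dy − ∫ φ² e^w dy ≤ ε. Then ∫_ω e^w dy > 4π. -/

import Mathlib

open Real MeasureTheory

noncomputable section

/-- Euclidean Laplacian on ℝ² via the second iterated derivative. -/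
def lap (w : ℝ × ℝ → ℝ) (y : ℝ × ℝ) : ℝ :=
  iteratedFDeriv ℝ 2 w y ![(1, 0), (1, 0)] + iteratedFDeriv ℝ 2 w y ![(0, 1), (0, 1)]

/-- The unit sphere S² ⊂ ℝ³ (vectors encoded as functions `Fin 3 → ℝ`). -/
def sphere3 : Set (Fin 3 → ℝ) := {x | x 0 ^ 2 + x 1 ^ 2 + x 2 ^ 2 = 1}

/-- Inverse stereographic projection from the north pole. -/
def stereoN (y : ℝ × ℝ) : Fin 3 → ℝ :=
  ![2 * y.1 / (1 + y.1 ^ 2 + y.2 ^ 2), 2 * y.2 / (1 + y.1 ^ 2 + y.2 ^ 2),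
    (y.1 ^ 2 + y.2 ^ 2 - 1) / (1 + y.1 ^ 2 + y.2 ^ 2)]

/-- South-pole parametrization of the sphere. -/
def stereoS (y : ℝ × ℝ) : Fin 3 → ℝ :=
  ![2 * y.1 / (1 + y.1 ^ 2 + y.2 ^ 2), 2 * y.2 / (1 + y.1 ^ 2 + y.2 ^ 2),
    (1 - y.1 ^ 2 - y.2 ^ 2) / (1 + y.1 ^ 2 + y.2 ^ 2)]

/-- `u` is a solution of the mean field equation `Δu = lam (1 - e^u)` on `S²`,
expressed in the two stereographic charts. -/
def IsMFSolution (lam : ℝ) (u : (Fin 3 → ℝ) → ℝ) : Prop :=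
  ContinuousOn u sphere3 ∧
  ContDiff ℝ 2 (fun y => u (stereoN y)) ∧
  ContDiff ℝ 2 (fun y => u (stereoS y)) ∧
  (∀ y : ℝ × ℝ, lap (fun z => u (stereoN z)) y =
    4 * lam * (1 - Real.exp (u (stereoN y))) / (1 + y.1 ^ 2 + y.2 ^ 2) ^ 2) ∧
  (∀ y : ℝ × ℝ, lap (fun z => u (stereoS z)) y =
    4 * lam * (1 - Real.exp (u (stereoS y))) / (1 + y.1 ^ 2 + y.2 ^ 2) ^ 2)

/-- `u` is axially symmetric on `S²`: constant on the level sets of `⟨·, e⟩`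
for some unit vector `e`. -/
def AxiallySymmetric (u : (Fin 3 → ℝ) → ℝ) : Prop :=
  ∃ e : Fin 3 → ℝ, e 0 ^ 2 + e 1 ^ 2 + e 2 ^ 2 = 1 ∧
    ∀ x ∈ sphere3, ∀ x' ∈ sphere3,
      x 0 * e 0 + x 1 * e 1 + x 2 * e 2 = x' 0 * e 0 + x' 1 * e 1 + x' 2 * e 2 →
      u x = u x'

/-- Surface integral over `S²`, written in the north-pole stereographic chart. -/
def sphereIntegral (f : (Fin 3 → ℝ) → ℝ) : ℝ :=
  ∫ y : ℝ × ℝ, f (stereoN y) * (4 / (1 + y.1 ^ 2 + y.2 ^ 2) ^ 2)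

section PlanarProof

open scoped ContDiff Manifold

/-- local integrability of the Cauchy kernel -/
theorem aux_locInt_inv (x : ℂ) : LocallyIntegrable (fun z : ℂ => ‖z - x‖⁻¹) := by
  have h0 : LocallyIntegrable (fun z : ℂ => ‖z‖⁻¹) := by
    refine locallyIntegrable_of_norm_le_rpow (C := 1) (α := 1) (by simp) ?_ ?_ ?_
    · simp
    · filter_upwards with z
      rw [one_mul, Real.rpow_neg (norm_nonneg _), Real.rpow_one]
      simp
    · exact (measurable_norm.inv).aestronglyMeasurable
  have := h0
  rw [MeasureTheory.locallyIntegrable_iff] at h0 ⊢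
  intro K hK
  have h1 := h0 ((fun z => z - x) '' K) (hK.image (by fun_prop))
  have mp : MeasurePreserving (fun z : ℂ => z - x) volume volume :=
    measurePreserving_sub_right volume x
  have he : MeasurableEmbedding (fun z : ℂ => z - x) := (MeasurableEquiv.subRight x).measurableEmbedding
  have := (mp.integrableOn_image he (f := fun z : ℂ => ‖z‖⁻¹) (s := K)).1 h1
  exact this

theorem aux_integrable_kernel {g : ℂ → ℝ} (hg : Continuous g) (hc : HasCompactSupport g) (x : ℂ) :
    Integrable (fun z : ℂ => g z * ‖z - x‖⁻¹) :=
  (aux_locInt_inv x).integrable_smul_left_of_hasCompactSupport hg hc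

theorem radial_pompeiu {ψ : ℂ → ℝ} (hψ : ContDiff ℝ 1 ψ) (hc : HasCompactSupport ψ) (x : ℂ) :
    Integrable (fun z : ℂ => fderiv ℝ ψ z ((starRingEnd ℂ (z - x))⁻¹)) ∧
    ∫ z : ℂ, fderiv ℝ ψ z ((starRingEnd ℂ (z - x))⁻¹) = - (2 * π * ψ x) := by
  have hcont : Continuous (fun z => ‖fderiv ℝ ψ z‖) := (hψ.continuous_fderiv (by simp)).norm
  have hcs : HasCompactSupport (fun z => ‖fderiv ℝ ψ z‖) := (hc.fderiv (𝕜 := ℝ)).norm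
  have hmeas : ∀ x : ℂ, Measurable (fun z : ℂ => fderiv ℝ ψ z ((starRingEnd ℂ (z - x))⁻¹)) := by
    intro x
    have h1 : Measurable (fun z : ℂ => ((starRingEnd ℂ (z - x))⁻¹)) := by
      have : Continuous (fun z : ℂ => (starRingEnd ℂ (z - x))) := by fun_prop
      exact this.measurable.inv
    have h2 : Measurable (fun z => fderiv ℝ ψ z) := (hψ.continuous_fderiv (by simp)).measurable
    have h3 : Continuous (fun p : (ℂ →L[ℝ] ℝ) × ℂ => p.1 p.2) := by fun_prop
    exact h3.measurable.comp (h2.prodMk h1)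
  have h_intg : Integrable (fun z : ℂ => fderiv ℝ ψ z ((starRingEnd ℂ (z - x))⁻¹)) := by
    refine (aux_integrable_kernel hcont hcs x).mono' (hmeas x).aestronglyMeasurable ?_
    filter_upwards with z
    refine ((fderiv ℝ ψ z).le_opNorm _).trans (le_of_eq ?_)
    rw [norm_inv, Complex.norm_conj]
  refine ⟨h_intg, ?_⟩
  have h1 : ∫ z : ℂ, fderiv ℝ ψ z ((starRingEnd ℂ (z - x))⁻¹)
      = ∫ z : ℂ, fderiv ℝ ψ (z + x) ((starRingEnd ℂ z)⁻¹) := by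
    rw [← integral_add_right_eq_self _ x]
    simp
  rw [h1, ← Complex.integral_comp_polarCoord_symm]
  set e : ℝ → ℂ := fun θ => (↑(cos θ) + ↑(sin θ) * Complex.I) with he
  have hene : ∀ θ, Complex.normSq (e θ) = 1 := by
    intro θ
    have := Complex.normSq_add_mul_I (cos θ) (sin θ)
    simp only [he]; rw [this]; simp
  have hkey : ∀ p ∈ polarCoord.target, p.1 • (fderiv ℝ ψ (Complex.polarCoord.symm p + x)
      ((starRingEnd ℂ (Complex.polarCoord.symm p))⁻¹))
      = deriv (fun r : ℝ => ψ (r * e p.2 + x)) p.1 := by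
    rintro ⟨r, θ⟩ hp
    simp only [polarCoord_target, Set.mem_prod, Set.mem_Ioi] at hp
    have hr := hp.1
    have hd : HasDerivAt (fun r : ℝ => ψ (r * e θ + x)) (fderiv ℝ ψ (r * e θ + x) (e θ)) r := by
      have ha : HasDerivAt (fun r : ℝ => (r : ℂ) * e θ + x) (e θ) r := by
        have := ((Complex.ofRealCLM.hasDerivAt (x := r)).mul_const (e θ)).add_const x
        simpa using this
      have hb := ((hψ.differentiable (by simp)) (r * e θ + x)).hasFDerivAt
      exact hb.comp_hasDerivAt r ha
    simp only [hd.deriv, Complex.polarCoord_symm_apply]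
    rw [show (↑(cos θ) + ↑(sin θ) * Complex.I : ℂ) = e θ from rfl]
    have h2 : (starRingEnd ℂ ((r : ℂ) * e θ))⁻¹ = r⁻¹ • e θ := by
      rw [map_mul, Complex.conj_ofReal, mul_inv, Complex.inv_def (starRingEnd ℂ (e θ))]
      rw [Complex.normSq_conj, hene]; simp
    rw [h2, map_smul, smul_smul, mul_inv_cancel₀ hr.ne', one_smul]
  rw [setIntegral_congr_fun polarCoord.open_target.measurableSet hkey]
  have hI : IntegrableOn (fun p : ℝ × ℝ => deriv (fun r : ℝ => ψ (r * e p.2 + x)) p.1)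
      polarCoord.target := by
    refine (integrableOn_congr_fun hkey polarCoord.open_target.measurableSet).1 ?_
    have h3 : Integrable (fun z : ℂ => fderiv ℝ ψ (z + x) ((starRingEnd ℂ z)⁻¹)) := by
      have := h_intg.comp_add_right x
      simpa using this
    have h4 := h3.2
    refine ⟨?_, ?_⟩
    · apply Measurable.aestronglyMeasurable
      have h5 : Measurable (fun z : ℂ => fderiv ℝ ψ (z + x) ((starRingEnd ℂ z)⁻¹)) := by
        have := (hmeas x).comp (measurable_add_const x)
        simpa [Function.comp_def] using this
      have h6 : Measurable (fun p => (Complex.polarCoord.symm p)) := by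
        have : (fun p : ℝ × ℝ => (Complex.polarCoord.symm p)) = fun p : ℝ × ℝ => (p.1 : ℂ) * (↑(cos p.2) + ↑(sin p.2) * Complex.I) := by
          funext p; exact Complex.polarCoord_symm_apply p
        rw [this]
        exact Continuous.measurable (by fun_prop)
      exact measurable_fst.smul (h5.comp h6)
    · rw [HasFiniteIntegral] at h4 ⊢
      rw [← Complex.lintegral_comp_polarCoord_symm] at h4
      refine lt_of_le_of_lt (le_of_eq ?_) h4
      refine setLIntegral_congr_fun polarCoord.open_target.measurableSet ?_
      intro p hp
      simp only [polarCoord_target, Set.mem_prod, Set.mem_Ioi] at hp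
      simp only [smul_eq_mul]
      rw [enorm_mul]
      congr 1
      exact Real.enorm_of_nonneg hp.1.le
  rw [polarCoord_target] at hI ⊢
  rw [Measure.volume_eq_prod] at hI ⊢
  rw [← Measure.prod_restrict] 
  rw [IntegrableOn, ← Measure.prod_restrict] at hI
  rw [integral_prod_symm _ hI]
  have hin : ∀ θ : ℝ, ∫ r in Set.Ioi (0:ℝ), deriv (fun r : ℝ => ψ (r * e θ + x)) r = - ψ x := by
    intro θ
    have hne : e θ ≠ 0 := by
      intro h; have := hene θ; rw [h] at this; simp at this
    rw [HasCompactSupport.integral_Ioi_deriv_eq]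
    · simp
    · refine hψ.comp ?_
      exact ((Complex.ofRealCLM.contDiff).mul contDiff_const).add contDiff_const
    · have hemb : Topology.IsClosedEmbedding (fun r : ℝ => (r : ℂ) * e θ + x) := by
        have h1 := Complex.isometry_ofReal.isClosedEmbedding
        have h2 : Topology.IsClosedEmbedding (fun z : ℂ => z * e θ + x) :=
          ((Homeomorph.mulRight₀ (e θ) hne).trans (Homeomorph.addRight x)).isClosedEmbedding
        exact h2.comp h1
      exact hc.comp_isClosedEmbedding hemb
  simp only [hin]
  rw [integral_const]
  simp
  ring_nf
  rw [max_eq_left (by positivity)]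
  simp

theorem aux_cos_sq_half : ∫ θ in (-(π/2))..(π/2), cos θ ^ 2 = π / 2 := by
  rw [integral_cos_sq]
  simp

theorem aux_inner_bathtub (a c : ℝ) (hc : 0 < c) :
    ∫⁻ r in Set.Ioi (0:ℝ), ENNReal.ofReal (a - c * r) ≤ ENNReal.ofReal ((max a 0) ^ 2 / (2 * c)) := by
  rcases le_or_gt a 0 with ha | ha
  · rw [setLIntegral_congr_fun (g := fun _ => 0) measurableSet_Ioi]
    · simp
    · intro r hr
      apply ENNReal.ofReal_of_nonpos
      have : 0 < c * r := mul_pos hc hr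
      linarith
  · rw [max_eq_left ha.le]
    have h1 : ∫⁻ r in Set.Ioi (0:ℝ), ENNReal.ofReal (a - c * r)
        ≤ ∫⁻ r in Set.Ioc (0:ℝ) (a / c), ENNReal.ofReal (a - c * r) := by
      have hu : Set.Ioi (0:ℝ) = Set.Ioc 0 (a/c) ∪ Set.Ioi (a/c) := by
        rw [Set.Ioc_union_Ioi_eq_Ioi (by positivity)]
      rw [hu]
      refine (lintegral_union_le _ _ _).trans ?_
      rw [setLIntegral_congr_fun (g := fun _ => 0) measurableSet_Ioi (s := Set.Ioi (a/c))]
      · simp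
      · intro r hr
        apply ENNReal.ofReal_of_nonpos
        have : a < r * c := (div_lt_iff₀ hc).1 hr
        linarith
    refine h1.trans (le_of_eq ?_)
    rw [← ofReal_integral_eq_lintegral_ofReal]
    · rw [← intervalIntegral.integral_of_le (by positivity)]
      congr 1
      rw [intervalIntegral.integral_sub (by simp) (Continuous.intervalIntegrable (by fun_prop) _ _), intervalIntegral.integral_const_mul, integral_id]
      simp
      field_simp
      ring
    · exact (Continuous.integrableOn_Ioc (by fun_prop))
    · refine (ae_restrict_iff' measurableSet_Ioc).2 (Filter.Eventually.of_forall ?_)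
      intro r hr
      have := (le_div_iff₀ hc).1 hr.2
      simp only [Pi.zero_apply]
      linarith

theorem aux_bathtub (c : ℝ) (hc : 0 < c) :
    ∫⁻ z : ℂ, ENNReal.ofReal ((z⁻¹).re - c) ≤ ENNReal.ofReal (π / (4 * c)) := by
  rw [← Complex.lintegral_comp_polarCoord_symm]
  have h1 : ∀ p ∈ polarCoord.target, ENNReal.ofReal p.1 •
      ENNReal.ofReal (((Complex.polarCoord.symm p)⁻¹).re - c) = ENNReal.ofReal (cos p.2 - c * p.1) := by
    rintro ⟨r, θ⟩ hp
    simp only [polarCoord_target, Set.mem_prod, Set.mem_Ioi] at hp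
    have hr := hp.1
    simp only [Complex.polarCoord_symm_apply, smul_eq_mul]
    rw [← ENNReal.ofReal_mul hr.le]
    congr 1
    have h2 : (((r : ℂ) * (↑(cos θ) + ↑(sin θ) * Complex.I))⁻¹).re = cos θ / r := by
      rw [mul_inv, ← Complex.ofReal_inv, Complex.re_ofReal_mul, Complex.inv_re, Complex.normSq_add_mul_I]
      simp only [Complex.add_re, Complex.ofReal_re, Complex.mul_re, Complex.I_re, Complex.I_im,
        Complex.ofReal_im, cos_sq_add_sin_sq]
      field_simp
      ring
    rw [h2]
    field_simp
  rw [setLIntegral_congr_fun polarCoord.open_target.measurableSet h1, polarCoord_target,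
    Measure.volume_eq_prod, ← Measure.prod_restrict, lintegral_prod_symm _ (by fun_prop)]
  have h2 : ∫⁻ θ in Set.Ioo (-π) π, ∫⁻ r in Set.Ioi (0:ℝ), ENNReal.ofReal (cos θ - c * r)
      ≤ ∫⁻ θ in Set.Ioo (-π) π, (Set.Ioc (-(π/2)) (π/2)).indicator
        (fun θ => ENNReal.ofReal (cos θ ^ 2 / (2 * c))) θ := by
    refine setLIntegral_mono' measurableSet_Ioo ?_
    intro θ hθ
    refine (aux_inner_bathtub _ _ hc).trans ?_
    by_cases hm : θ ∈ Set.Ioc (-(π/2)) (π/2)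
    · rw [Set.indicator_of_mem hm]
      rw [max_eq_left (cos_nonneg_of_mem_Icc ⟨hm.1.le, hm.2⟩)]
    · rw [Set.indicator_of_notMem hm]
      have hcos : cos θ ≤ 0 := by
        simp only [Set.mem_Ioc, not_and_or, not_lt, not_le] at hm
        rcases hm with hm | hm
        · rw [← cos_neg]
          exact cos_nonpos_of_pi_div_two_le_of_le (by linarith) (by linarith [hθ.1, pi_pos])
        · exact cos_nonpos_of_pi_div_two_le_of_le (by linarith) (by linarith [hθ.2, pi_pos])
      rw [max_eq_right hcos]
      simp
  refine h2.trans ((setLIntegral_le_lintegral _ _).trans ?_)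
  rw [lintegral_indicator measurableSet_Ioc, ← ofReal_integral_eq_lintegral_ofReal]
  · rw [← intervalIntegral.integral_of_le (by linarith [pi_pos]), intervalIntegral.integral_div,
      aux_cos_sq_half]
    apply le_of_eq
    congr 1
    field_simp
    ring
  · exact (Continuous.integrableOn_Ioc (by fun_prop))
  · refine Filter.Eventually.of_forall ?_
    intro r
    simp only [Pi.zero_apply]
    positivity

theorem integrableOn_kernel {E : Set ℂ} (hfin : volume E ≠ ⊤) (x : ℂ) :
    IntegrableOn (fun z : ℂ => ‖z - x‖⁻¹) E := by
  have h1 : IntegrableOn (fun z : ℂ => ‖z - x‖⁻¹) (Metric.closedBall x 1) :=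
    (aux_locInt_inv x).integrableOn_isCompact (isCompact_closedBall x 1)
  have hm : Measurable (fun z : ℂ => ‖z - x‖⁻¹) := (measurable_norm.comp (measurable_sub_const x)).inv
  have h2 : IntegrableOn (fun z : ℂ => ‖z - x‖⁻¹) (E \ Metric.closedBall x 1) := by
    refine Measure.integrableOn_of_bounded (M := 1) ?_ hm.aestronglyMeasurable ?_
    · exact ne_top_of_le_ne_top hfin (measure_mono Set.sdiff_subset)
    · refine (ae_restrict_iff (measurableSet_le hm.norm measurable_const)).2 (Filter.Eventually.of_forall ?_)
      intro z hz
      have : 1 < ‖z - x‖ := by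
        have := hz.2
        simpa [dist_eq_norm] using this
      rw [norm_inv, norm_norm]
      exact inv_le_one_of_one_le₀ this.le
  refine (h1.union h2).mono_set ?_
  intro z hz
  by_cases h : z ∈ Metric.closedBall x 1
  · exact Or.inl h
  · exact Or.inr ⟨hz, h⟩

theorem bathtub_bound {E : Set ℂ} (hE : MeasurableSet E) (hfin : volume E ≠ ⊤) (x e : ℂ)
    (he : ‖e‖ = 1) :
    ∫ z in E, (e * (z - x)⁻¹).re ≤ √(π * (volume E).toReal) := by
  rcases eq_or_ne (volume E) 0 with h0 | h0
  · rw [setIntegral_measure_zero _ h0]; positivity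
  have hpos : 0 < (volume E).toReal := ENNReal.toReal_pos h0 hfin
  set A := (volume E).toReal with hA
  set c := √(π / A) / 2 with hc
  have hcpos : 0 < c := by positivity
  have hm : Measurable (fun z : ℂ => (e * (z - x)⁻¹).re) := 
    Complex.measurable_re.comp (((measurable_sub_const x).inv).const_mul e)
  have h_intg : IntegrableOn (fun z : ℂ => (e * (z - x)⁻¹).re) E := by
    refine (integrableOn_kernel hfin x).mono' hm.aestronglyMeasurable ?_
    filter_upwards with z
    refine (Complex.abs_re_le_norm _).trans ?_
    rw [norm_mul, he, one_mul, norm_inv]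
  have h1 : ∫⁻ z : ℂ, ENNReal.ofReal ((e * (z - x)⁻¹).re - c) ≤ ENNReal.ofReal (π / (4 * c)) := by
    refine le_trans (le_of_eq ?_) (aux_bathtub c hcpos)
    let R := rotation (⟨e, by simp [Submonoid.unitSphere, he]⟩ : Circle)
    have hR : ∀ z, R z = e * z := by
      intro z
      rfl
    have hene : e ≠ 0 := by intro h; rw [h] at he; simp at he
    have hmp : MeasurePreserving R volume volume := R.measurePreserving
    rw [← lintegral_add_right_eq_self _ x, ← hmp.lintegral_comp_emb R.toMeasurableEquiv.measurableEmbedding]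
    congr 1
    funext z
    congr 3
    rw [hR, add_sub_cancel_right, mul_inv, ← mul_assoc, mul_inv_cancel₀ hene, one_mul]
  have hposint : IntegrableOn (fun z : ℂ => max ((e * (z - x)⁻¹).re - c) 0) E := by
    have : IntegrableOn (fun z : ℂ => (e * (z - x)⁻¹).re - c) E :=
      h_intg.sub (integrableOn_const hfin)
    exact this.pos_part
  have h2 : ∫ z in E, max ((e * (z - x)⁻¹).re - c) 0 ≤ π / (4 * c) := by
    rw [integral_eq_lintegral_of_nonneg_ae (f := fun z : ℂ => max ((e * (z - x)⁻¹).re - c) 0)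
      (Filter.Eventually.of_forall fun z => le_max_right _ (0:ℝ)) hposint.1]
    refine ENNReal.toReal_le_of_le_ofReal (by positivity) ?_
    refine le_trans ?_ h1
    refine (setLIntegral_le_lintegral _ _).trans (lintegral_mono ?_)
    intro z
    simp
  have h3 : ∫ z in E, (e * (z - x)⁻¹).re ≤ ∫ z in E, (c + max ((e * (z - x)⁻¹).re - c) 0) := by
    refine integral_mono h_intg ((integrableOn_const hfin).add hposint) ?_
    intro z
    have := le_max_left ((e * (z - x)⁻¹).re - c) 0
    simp only
    linarith
  rw [integral_add (μ := volume.restrict E) (f := fun _ => c) (integrableOn_const hfin) hposint,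
    setIntegral_const] at h3
  have h4 : c * A + π / (4 * c) = √(π * A) := by
    have hs : √(π * A) = √(π/A) * A := by
      rw [show π * A = (π / A) * A^2 by field_simp, Real.sqrt_mul (by positivity), Real.sqrt_sq hpos.le]
    have hsq : √(π/A) ^ 2 = π / A := Real.sq_sqrt (by positivity)
    have hsp : 0 < √(π/A) := by positivity
    have hp : π = √(π/A)^2 * A := by rw [hsq]; field_simp
    rw [hs, hc]
    generalize hq : √(π/A) = q at *
    rw [hp]
    field_simp
    ring
  have hA' : volume.real E = A := rfl
  rw [hA', smul_eq_mul] at h3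
  linarith

/-- the field generated by a set -/
def setField (E : Set ℂ) (x : ℂ) : ℂ := ∫ z in E, (starRingEnd ℂ (z - x))⁻¹

theorem aux_conj_kernel_integrableOn {E : Set ℂ} (hfin : volume E ≠ ⊤) (x : ℂ) :
    IntegrableOn (fun z : ℂ => (starRingEnd ℂ (z - x))⁻¹) E := by
  have hm : Measurable (fun z : ℂ => (starRingEnd ℂ (z - x))⁻¹) := by
    have : Continuous (fun z : ℂ => (starRingEnd ℂ (z - x))) := by fun_prop
    exact this.measurable.inv
  refine (integrableOn_kernel hfin x).mono' hm.aestronglyMeasurable ?_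
  filter_upwards with z
  rw [norm_inv, Complex.norm_conj]

theorem setField_norm_le {E : Set ℂ} (hE : MeasurableSet E) (hfin : volume E ≠ ⊤) (x : ℂ) :
    ‖setField E x‖ ≤ √(π * (volume E).toReal) := by
  rcases eq_or_ne (setField E x) 0 with h0 | h0
  · rw [h0, norm_zero]; positivity
  set F := setField E x with hF
  set e : ℂ := F / ‖F‖ with he
  have hn : (‖F‖ : ℂ) ≠ 0 := by simpa using h0
  have hne : ‖e‖ = 1 := by rw [he, norm_div]; simp [h0]
  have h1 := bathtub_bound hE hfin x e hne
  refine le_trans (le_of_eq ?_) h1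
  have h2 : starRingEnd ℂ e * F = ‖F‖ := by
    rw [he, map_div₀, Complex.conj_ofReal, div_mul_eq_mul_div, Complex.conj_mul']
    field_simp
  have h3 : (starRingEnd ℂ e * F).re = ‖F‖ := by rw [h2]; simp
  rw [← h3, hF, setField, ← integral_const_mul]
  have h4 := aux_conj_kernel_integrableOn hfin x
  have h5 : ∀ z : ℂ, (e * (z - x)⁻¹).re = (starRingEnd ℂ e * (starRingEnd ℂ (z - x))⁻¹).re := by
    intro z
    rw [← Complex.conj_re (e * (z - x)⁻¹), map_mul, map_inv₀]
  simp only [h5]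
  have h6 : IntegrableOn (fun z => starRingEnd ℂ e * (starRingEnd ℂ (z - x))⁻¹) E := h4.const_mul _
  exact (Complex.reCLM.integral_comp_comm h6).symm

theorem aux_kernel_unif {g : ℂ → ℝ} (hg : Continuous g) (hc : HasCompactSupport g) (h0 : ∀ z, 0 ≤ g z) :
    ∃ C : ℝ, ∀ x, ∫ z : ℂ, g z * ‖z - x‖⁻¹ ≤ C := by
  obtain ⟨M, hM⟩ := hg.bounded_above_of_compact_support hc
  have hM0 : 0 ≤ M := (norm_nonneg _).trans (hM 0)
  refine ⟨M * (∫ z in Metric.closedBall (0:ℂ) 1, ‖z‖⁻¹) + ∫ z, g z, fun x => ?_⟩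
  have hB : IntegrableOn (fun z : ℂ => ‖z - x‖⁻¹) (Metric.closedBall x 1) :=
    (aux_locInt_inv x).integrableOn_isCompact (isCompact_closedBall x 1)
  have hBi : Integrable ((Metric.closedBall x 1).indicator (fun z : ℂ => ‖z - x‖⁻¹)) :=
    hB.integrable_indicator Metric.isClosed_closedBall.measurableSet
  have hgi : Integrable g := hg.integrable_of_hasCompactSupport hc
  have h1 : ∫ z : ℂ, g z * ‖z - x‖⁻¹ ≤
      ∫ z : ℂ, (M * (Metric.closedBall x 1).indicator (fun z : ℂ => ‖z - x‖⁻¹) z + g z) := by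
    refine integral_mono (aux_integrable_kernel hg hc x) ((hBi.const_mul M).add hgi) ?_
    intro z
    by_cases hz : z ∈ Metric.closedBall x 1
    · simp only [Set.indicator_of_mem hz]
      have : g z ≤ M := (le_abs_self _).trans (hM z)
      have h2 : g z * ‖z - x‖⁻¹ ≤ M * ‖z - x‖⁻¹ := mul_le_mul_of_nonneg_right this (by positivity)
      linarith [h0 z]
    · simp only [Set.indicator_of_notMem hz]
      have : 1 < ‖z - x‖ := by simpa [dist_eq_norm] using hz
      have h2 : ‖z - x‖⁻¹ ≤ 1 := inv_le_one_of_one_le₀ this.le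
      have := mul_le_mul_of_nonneg_left h2 (h0 z)
      linarith
  refine h1.trans (le_of_eq ?_)
  rw [integral_add (hBi.const_mul M) hgi, integral_const_mul]
  congr 2
  rw [← integral_indicator Metric.isClosed_closedBall.measurableSet,
    ← integral_add_right_eq_self _ x]
  congr 1
  funext z
  by_cases hz : z ∈ Metric.closedBall (0:ℂ) 1
  · rw [Set.indicator_of_mem hz, Set.indicator_of_mem (by simpa using hz)]; simp
  · rw [Set.indicator_of_notMem hz, Set.indicator_of_notMem (by simpa using hz)]

theorem aux_meas_kernel2 : Measurable (fun p : ℂ × ℂ => (starRingEnd ℂ (p.2 - p.1))⁻¹) := by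
  have : Continuous (fun p : ℂ × ℂ => (starRingEnd ℂ (p.2 - p.1))) := by fun_prop
  exact this.measurable.inv

/-- Pompeiu formula integrated against a finite measure. -/
theorem pompeiu_measure {ψ : ℂ → ℝ} (hψ : ContDiff ℝ 1 ψ) (hc : HasCompactSupport ψ)
    (ν : Measure ℂ) [IsFiniteMeasure ν] :
    (∀ᵐ z : ℂ, fderiv ℝ ψ z ≠ 0 → Integrable (fun x => (starRingEnd ℂ (z - x))⁻¹) ν) ∧
    Integrable (fun z => fderiv ℝ ψ z (∫ x, (starRingEnd ℂ (z - x))⁻¹ ∂ν)) ∧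
    ∫ x, ψ x ∂ν = - (1 / (2 * π)) * ∫ z, fderiv ℝ ψ z (∫ x, (starRingEnd ℂ (z - x))⁻¹ ∂ν) := by
  have hcont : Continuous (fun z => ‖fderiv ℝ ψ z‖) := (hψ.continuous_fderiv (by simp)).norm
  have hcs : HasCompactSupport (fun z => ‖fderiv ℝ ψ z‖) := (hc.fderiv (𝕜 := ℝ)).norm
  obtain ⟨C, hC⟩ := aux_kernel_unif hcont hcs (fun z => norm_nonneg _)
  -- kernel with norm
  have hk : Integrable (fun p : ℂ × ℂ => ‖fderiv ℝ ψ p.2‖ • (starRingEnd ℂ (p.2 - p.1))⁻¹)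
      (ν.prod volume) := by
    have hm : AEStronglyMeasurable
        (fun p : ℂ × ℂ => ‖fderiv ℝ ψ p.2‖ • (starRingEnd ℂ (p.2 - p.1))⁻¹) (ν.prod volume) :=
      ((hcont.measurable.comp measurable_snd).smul aux_meas_kernel2).aestronglyMeasurable
    rw [integrable_prod_iff hm]
    have hn : ∀ x z : ℂ, ‖‖fderiv ℝ ψ z‖ • (starRingEnd ℂ (z - x))⁻¹‖ = ‖fderiv ℝ ψ z‖ * ‖z - x‖⁻¹ := by
      intro x z
      rw [norm_smul, norm_norm, norm_inv, Complex.norm_conj]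
    constructor
    · filter_upwards with x
      refine (aux_integrable_kernel hcont hcs x).mono' ?_ ?_
      · exact ((hcont.measurable.comp measurable_snd).smul aux_meas_kernel2).comp
          measurable_prodMk_left |>.aestronglyMeasurable
      · filter_upwards with z
        rw [hn]
    · refine Integrable.of_bound
        hm.norm.integral_prod_right' C ?_
      filter_upwards with x
      simp only [hn]
      rw [Real.norm_of_nonneg (integral_nonneg fun z => by positivity)]
      exact hC x
  have hswap : ∀ᵐ z : ℂ, Integrable (fun x => ‖fderiv ℝ ψ z‖ • (starRingEnd ℂ (z - x))⁻¹) ν := by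
    have := hk.swap.prod_right_ae
    exact this
  have hae : ∀ᵐ z : ℂ, fderiv ℝ ψ z ≠ 0 → Integrable (fun x => (starRingEnd ℂ (z - x))⁻¹) ν := by
    filter_upwards [hswap] with z hz hne
    have := hz.smul (‖fderiv ℝ ψ z‖⁻¹)
    refine this.congr (Filter.Eventually.of_forall fun x => ?_)
    simp only [Pi.smul_apply, smul_smul]
    rw [inv_mul_cancel₀ (norm_ne_zero_iff.2 hne), one_smul]
  have hk2 : Integrable (fun p : ℂ × ℂ => fderiv ℝ ψ p.2 ((starRingEnd ℂ (p.2 - p.1))⁻¹))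
      (ν.prod volume) := by
    refine hk.norm.mono' ?_ ?_
    · have h2 : Measurable (fun z => fderiv ℝ ψ z) := (hψ.continuous_fderiv (by simp)).measurable
      have h3 : Continuous (fun p : (ℂ →L[ℝ] ℝ) × ℂ => p.1 p.2) := by fun_prop
      exact (h3.measurable.comp ((h2.comp measurable_snd).prodMk aux_meas_kernel2)).aestronglyMeasurable
    · filter_upwards with p
      refine ((fderiv ℝ ψ p.2).le_opNorm _).trans (le_of_eq ?_)
      rw [norm_smul, norm_norm]
  have hin : ∀ᵐ z : ℂ, ∫ x, fderiv ℝ ψ z ((starRingEnd ℂ (z - x))⁻¹) ∂ν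
      = fderiv ℝ ψ z (∫ x, (starRingEnd ℂ (z - x))⁻¹ ∂ν) := by
    filter_upwards [hae] with z hz
    by_cases h : fderiv ℝ ψ z = 0
    · simp [h]
    · exact ContinuousLinearMap.integral_comp_comm _ (hz h)
  refine ⟨hae, ?_, ?_⟩
  · exact hk2.integral_prod_right.congr hin
  · rw [← integral_congr_ae hin]
    have := integral_integral_swap (f := fun x z => fderiv ℝ ψ z ((starRingEnd ℂ (z - x))⁻¹)) hk2
    rw [← this]
    simp only [fun x => (radial_pompeiu hψ hc x).2]
    rw [integral_neg, integral_const_mul]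
    field_simp

theorem field_formula {ψ : ℂ → ℝ} (hψ : ContDiff ℝ 1 ψ) (hc : HasCompactSupport ψ)
    {E : Set ℂ} (hfin : volume E ≠ ⊤) :
    Integrable (fun z => fderiv ℝ ψ z (setField E z)) ∧ 
    ∫ x in E, ψ x = (1 / (2 * π)) * ∫ z, fderiv ℝ ψ z (setField E z) := by
  have : IsFiniteMeasure (volume.restrict E) := ⟨by simpa using hfin.lt_top⟩
  obtain ⟨-, h2, h3⟩ := pompeiu_measure hψ hc (volume.restrict E)
  have h4 : ∀ z, ∫ x in E, (starRingEnd ℂ (z - x))⁻¹ = - setField E z := by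
    intro z
    rw [setField, ← integral_neg]
    congr 1
    funext x
    rw [← inv_neg, ← map_neg, neg_sub]
  simp only [h4, map_neg] at h2 h3
  refine ⟨by simpa using h2.neg, ?_⟩
  rw [h3, integral_neg]
  ring

def mulL (a : ℂ) : ℂ →L[ℝ] ℂ := ContinuousLinearMap.mul ℝ ℂ a

theorem mulL_apply (a b : ℂ) : mulL a b = a * b := rfl

theorem mulL_det (a : ℂ) : (mulL a).det = ‖a‖ ^ 2 := by
  rw [← Complex.normSq_eq_norm_sq, ← Algebra.norm_complex_apply]
  rfl

theorem hasFDerivAt_mulL {f : ℂ → ℂ} {a z : ℂ} (h : HasDerivAt f a z) : HasFDerivAt f (mulL a) z := by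
  have := h.hasFDerivAt.restrictScalars ℝ
  refine this.congr_fderiv ?_
  apply ContinuousLinearMap.ext
  intro b
  simp [mulL_apply, mul_comm]

theorem FI_local {f : ℂ → ℂ} (hf : Differentiable ℂ f) (hf' : ∀ z, deriv f z ≠ 0)
    (e : OpenPartialHomeomorph ℂ ℂ) (he : ⇑e = f) {ξ : ℂ → ℝ} (hξ : ContDiff ℝ 1 ξ)
    (hc : HasCompactSupport ξ) (hs : tsupport ξ ⊆ e.source) {E : Set ℂ} (hEm : MeasurableSet E)
    (hfin : volume E ≠ ⊤) (hE : ∀ y, ξ y ≠ 0 → f y ∈ E) :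
    Integrable (fun y => fderiv ℝ ξ y (setField E (f y) / deriv f y) * ‖deriv f y‖ ^ 2) ∧
    ∫ y, ξ y * ‖deriv f y‖ ^ 2 =
      (1 / (2 * π)) * ∫ y, fderiv ℝ ξ y (setField E (f y) / deriv f y) * ‖deriv f y‖ ^ 2 := by
  classical
  set Ψ : ℂ → ℝ := e.target.indicator (fun z => ξ (e.symm z)) with hΨ
  have hK : IsCompact (f '' tsupport ξ) := hc.isCompact.image hf.continuous
  have hzero : ∀ z, z ∉ f '' tsupport ξ → Ψ z = 0 := by
    intro z hz
    by_cases ht : z ∈ e.target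
    · rw [hΨ, Set.indicator_of_mem ht]
      by_contra h
      apply hz
      refine ⟨e.symm z, subset_tsupport _ h, ?_⟩
      rw [← he, e.right_inv ht]
    · rw [hΨ, Set.indicator_of_notMem ht]
  have hcΨ : HasCompactSupport Ψ := HasCompactSupport.intro hK hzero
  have hd : ∀ z, HasDerivAt f (deriv f z) z := fun z => (hf z).hasDerivAt
  have hCf : ContDiff ℂ 1 f := hf.contDiff
  have hcd : ContDiff ℝ 1 Ψ := by
    rw [contDiff_iff_contDiffAt]
    intro z
    by_cases ht : z ∈ e.target
    · have h1 : ContDiffAt ℂ 1 e.symm z := by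
        refine e.contDiffAt_symm_deriv (hf' (e.symm z)) ht ?_ ?_
        · rw [he]; exact hd _
        · rw [he]; exact hCf.contDiffAt
      have h2 : ContDiffAt ℝ 1 (fun z => ξ (e.symm z)) z := 
        hξ.contDiffAt.comp z (h1.restrict_scalars ℝ)
      refine h2.congr_of_eventuallyEq ?_
      filter_upwards [e.open_target.mem_nhds ht] with y hy
      rw [hΨ, Set.indicator_of_mem hy]
    · have hz : z ∉ f '' tsupport ξ := by
        rintro ⟨y, hy, rfl⟩
        apply ht
        rw [← he]
        exact e.map_source (hs hy)
      refine (contDiffAt_const (c := (0:ℝ))).congr_of_eventuallyEq ?_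
      filter_upwards [hK.isClosed.isOpen_compl.mem_nhds hz] with y hy
      exact hzero y hy
  have hinv : ∀ y ∈ e.source, Ψ (f y) = ξ y := by
    intro y hy
    have h1 : f y ∈ e.target := by rw [← he]; exact e.map_source hy
    rw [hΨ, Set.indicator_of_mem h1, ← he, e.left_inv hy]
  obtain ⟨i1, i2⟩ := field_formula hcd hcΨ hfin
  have himg : f '' e.source = e.target := by rw [← he]; exact e.image_source_eq_target
  have hinj : Set.InjOn f e.source := by rw [← he]; exact e.injOn
  have hmeas := e.open_source.measurableSet
  have hwd : ∀ x ∈ e.source, HasFDerivWithinAt f (mulL (deriv f x)) e.source x :=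
    fun x _ => (hasFDerivAt_mulL (hd x)).hasFDerivWithinAt
  -- derivative identity
  have hder : ∀ y ∈ e.source, fderiv ℝ Ψ (f y) (setField E (f y))
      = fderiv ℝ ξ y (setField E (f y) / deriv f y) := by
    intro y hy
    have h1 : HasFDerivAt (fun y => Ψ (f y)) ((fderiv ℝ Ψ (f y)).comp (mulL (deriv f y))) y :=
      ((hcd.differentiable (by simp)) (f y)).hasFDerivAt.comp y (hasFDerivAt_mulL (hd y))
    have h2 : HasFDerivAt ξ ((fderiv ℝ Ψ (f y)).comp (mulL (deriv f y))) y := by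
      refine h1.congr_of_eventuallyEq ?_
      filter_upwards [e.open_source.mem_nhds hy] with x hx
      exact (hinv x hx).symm
    rw [h2.fderiv]
    simp only [ContinuousLinearMap.comp_apply, mulL_apply]
    rw [mul_div_cancel₀ _ (hf' y)]
  have hfd0 : ∀ y, y ∉ e.source → fderiv ℝ ξ y = 0 := by
    intro y hy
    have : y ∉ tsupport ξ := fun h => hy (hs h)
    exact fderiv_of_notMem_tsupport (𝕜 := ℝ) this
  have hξ0 : ∀ y, y ∉ e.source → ξ y = 0 := fun y hy => image_eq_zero_of_notMem_tsupport fun h => hy (hs h)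
  have hΨ0 : ∀ z, z ∉ e.target → Ψ z = 0 := fun z hz => Set.indicator_of_notMem hz _
  have hfΨ0 : ∀ z, z ∉ e.target → fderiv ℝ Ψ z = 0 := by
    intro z hz
    apply fderiv_of_notMem_tsupport (𝕜 := ℝ)
    intro h
    apply hz
    have h2 : tsupport Ψ ⊆ f '' tsupport ξ := closure_minimal
      (fun z hz => by by_contra h; exact hz (hzero z h)) hK.isClosed
    obtain ⟨y, hy, rfl⟩ := h2 h
    rw [← he]; exact e.map_source (hs hy)
  -- change of variables for the gradient term
  have c1 : ∀ y ∈ e.source, |(mulL (deriv f y)).det| • fderiv ℝ Ψ (f y) (setField E (f y))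
      = fderiv ℝ ξ y (setField E (f y) / deriv f y) * ‖deriv f y‖ ^ 2 := by
    intro y hy
    rw [hder y hy, mulL_det, abs_of_nonneg (by positivity), smul_eq_mul, mul_comm]
  have j1 : ∫ z, fderiv ℝ Ψ z (setField E z)
      = ∫ y, fderiv ℝ ξ y (setField E (f y) / deriv f y) * ‖deriv f y‖ ^ 2 := by
    rw [← setIntegral_eq_integral_of_forall_compl_eq_zero (s := e.target)
      (fun z hz => by rw [hfΨ0 z hz]; simp), ← himg,
      integral_image_eq_integral_abs_det_fderiv_smul volume hmeas hwd hinj,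
      setIntegral_congr_fun hmeas c1]
    exact setIntegral_eq_integral_of_forall_compl_eq_zero (fun y hy => by rw [hfd0 y hy]; simp)
  have j2 : ∫ x in E, Ψ x = ∫ y, ξ y * ‖deriv f y‖ ^ 2 := by
    have hsub : ∀ z, z ∉ E → Ψ z = 0 := by
      intro z hz
      by_cases ht : z ∈ e.target
      · rw [hΨ, Set.indicator_of_mem ht]
        by_contra h
        apply hz
        have := hE _ h
        rwa [← he, e.right_inv ht] at this
      · exact hΨ0 z ht
    rw [setIntegral_eq_integral_of_forall_compl_eq_zero hsub,
      ← setIntegral_eq_integral_of_forall_compl_eq_zero hΨ0, ← himg,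
      integral_image_eq_integral_abs_det_fderiv_smul volume hmeas hwd hinj]
    rw [setIntegral_congr_fun hmeas (g := fun y => ξ y * ‖deriv f y‖ ^ 2)]
    · exact setIntegral_eq_integral_of_forall_compl_eq_zero (fun y hy => by rw [hξ0 y hy]; simp)
    · intro y hy
      simp only
      rw [hinv y hy, mulL_det, abs_of_nonneg (by positivity), smul_eq_mul, mul_comm]
  refine ⟨?_, by rw [← j2, i2, j1]⟩
  have h3 : IntegrableOn (fun z => fderiv ℝ Ψ z (setField E z)) (f '' e.source) := i1.integrableOn
  rw [integrableOn_image_iff_integrableOn_abs_det_fderiv_smul volume hmeas hwd hinj] at h3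
  have h4 := (integrableOn_congr_fun c1 hmeas).1 h3
  rw [← integrable_indicator_iff hmeas] at h4
  refine h4.congr (Filter.Eventually.of_forall fun y => ?_)
  by_cases hy : y ∈ e.source
  · rw [Set.indicator_of_mem hy]
  · simp [Set.indicator_of_notMem hy, hfd0 y hy]

/-- finite partition of a compactly supported function subordinate to a cover -/
theorem exists_finite_partition {η : ℂ → ℝ} (hη : ContDiff ℝ 1 η) (hc : HasCompactSupport η)
    (U : ℂ → Set ℂ) (hU : ∀ x, IsOpen (U x)) (hx : ∀ x, x ∈ U x) :
    ∃ (t : Finset ℂ) (ξ : t → ℂ → ℝ), (∀ i, ContDiff ℝ 1 (ξ i)) ∧ (∀ i, HasCompactSupport (ξ i)) ∧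
      (∀ i, tsupport (ξ i) ⊆ U i) ∧ (∀ i y, ξ i y ≠ 0 → η y ≠ 0) ∧ (∀ y, η y = ∑ i, ξ i y) := by
  obtain ⟨t, -, ht⟩ := hc.isCompact.elim_finite_subcover_image (b := Set.univ) (c := U)
    (fun i _ => hU i) (fun x _ => by simpa using ⟨x, hx x⟩)
  obtain ⟨htf, ht2⟩ := ht
  lift t to Finset ℂ using htf
  obtain ⟨ρ, hρ⟩ := SmoothPartitionOfUnity.exists_isSubordinate 𝓘(ℝ, ℂ) (isClosed_tsupport η)
    (fun i : t => U i) (fun i => hU i) (by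
      intro y hy
      obtain ⟨i, hi, hy2⟩ := Set.mem_iUnion₂.1 (ht2 hy)
      exact Set.mem_iUnion.2 ⟨⟨i, hi⟩, hy2⟩)
  refine ⟨t, fun i y => ρ i y * η y, ?_, ?_, ?_, ?_, ?_⟩
  · intro i
    have h1 : ContDiff ℝ ∞ (ρ i) := contMDiff_iff_contDiff.1 (ρ i).contMDiff
    exact (h1.of_le (by simp)).mul hη
  · intro i
    exact hc.mul_left
  · intro i
    exact (tsupport_mul_subset_left).trans (hρ i)
  · intro i y h
    exact right_ne_zero_of_mul h
  · intro y
    by_cases hy : y ∈ tsupport η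
    · have := ρ.sum_eq_one hy
      rw [finsum_eq_sum_of_fintype] at this
      rw [← Finset.sum_mul, this, one_mul]
    · have : η y = 0 := image_eq_zero_of_notMem_tsupport hy
      simp [this]

theorem flat_isoperimetric {f : ℂ → ℂ} (hf : Differentiable ℂ f) (hf' : ∀ z, deriv f z ≠ 0)
    {η : ℂ → ℝ} (hη : ContDiff ℝ 1 η) (hc : HasCompactSupport η) :
    2 * √π * ∫ y, η y * ‖deriv f y‖ ^ 2 ≤
      √(∫ y in {y | η y ≠ 0}, ‖deriv f y‖ ^ 2) * ∫ y, ‖fderiv ℝ η y‖ * ‖deriv f y‖ := by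
  have hd : ∀ z, HasDerivAt f (deriv f z) z := fun z => (hf z).hasDerivAt
  have hCf : ContDiff ℂ 1 f := hf.contDiff
  have hdc : Continuous (deriv f) := hCf.continuous_deriv (by simp)
  -- local homeomorphisms
  have hloc : ∀ x : ℂ, ∃ e : OpenPartialHomeomorph ℂ ℂ, ⇑e = f ∧ x ∈ e.source := by
    intro x
    have h1 : HasFDerivAt f ((ContinuousLinearEquiv.unitsEquivAut ℂ (Units.mk0 _ (hf' x)) :
        ℂ ≃L[ℂ] ℂ) : ℂ →L[ℂ] ℂ) x := by
      exact (hd x).hasFDerivAt_equiv (hf' x)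
    exact ⟨hCf.contDiffAt.toOpenPartialHomeomorph f h1 (by simp),
      ContDiffAt.toOpenPartialHomeomorph_coe _ _ _, ContDiffAt.mem_toOpenPartialHomeomorph_source _ _ _⟩
  choose e he hex using hloc
  set S : Set ℂ := {y | η y ≠ 0} with hS
  have hSo : IsOpen S := isOpen_ne_fun hη.continuous continuous_const
  have hSfin : volume S ≠ ⊤ := by
    refine ne_top_of_le_ne_top hc.isCompact.measure_ne_top (measure_mono (subset_tsupport η))
  have hSi : IntegrableOn (fun y => ‖deriv f y‖ ^ 2) S := by
    have : IntegrableOn (fun y => ‖deriv f y‖ ^ 2) (tsupport η) :=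
      ContinuousOn.integrableOn_compact hc.isCompact (by fun_prop)
    exact this.mono_set (subset_tsupport η)
  set E : Set ℂ := f '' S with hE
  have hEo : IsOpen E := by
    rw [isOpen_iff_mem_nhds]
    rintro _ ⟨y, hy, rfl⟩
    have h1 : Filter.map f (nhds y) = nhds (f y) := by
      have := (e y).map_nhds_eq (hex y)
      rwa [he] at this
    rw [← h1]
    exact Filter.image_mem_map (hSo.mem_nhds hy)
  have hvol : volume E ≤ ENNReal.ofReal (∫ y in S, ‖deriv f y‖ ^ 2) := by
    have h1 := addHaar_image_le_lintegral_abs_det_fderiv (volume : Measure ℂ) hSo.measurableSet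
      (f := f) (f' := fun x => mulL (deriv f x))
      (fun x _ => (hasFDerivAt_mulL (hd x)).hasFDerivWithinAt)
    refine h1.trans (le_of_eq ?_)
    rw [ofReal_integral_eq_lintegral_ofReal hSi (Filter.Eventually.of_forall fun y => by positivity)]
    congr 1
    funext y
    rw [mulL_det, abs_of_nonneg (by positivity)]
  have hEfin : volume E ≠ ⊤ := ne_top_of_le_ne_top ENNReal.ofReal_ne_top hvol
  obtain ⟨t, ξ, h1, h2, h3, h4, h5⟩ := exists_finite_partition hη hc (fun x => (e x).source)
    (fun x => (e x).open_source) hex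
  have hl := fun i : t => FI_local hf hf' (e i) (he i) (h1 i) (h2 i) (h3 i) hEo.measurableSet hEfin
    (fun y hy => ⟨y, h4 i y hy, rfl⟩)
  have hηeq : η = fun y => ∑ i, ξ i y := funext h5
  have h_intg : ∀ i, Integrable (fun y => ξ i y * ‖deriv f y‖ ^ 2) := fun i =>
    Continuous.integrable_of_hasCompactSupport ((h1 i).continuous.mul (by fun_prop)) (h2 i).mul_right
  have s1 : ∫ y, η y * ‖deriv f y‖ ^ 2 = ∑ i, ∫ y, ξ i y * ‖deriv f y‖ ^ 2 := by
    rw [← integral_finsetSum _ (fun i _ => h_intg i)]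
    congr 1
    funext y
    rw [h5 y, Finset.sum_mul]
  have hfd : ∀ y, fderiv ℝ η y = ∑ i, fderiv ℝ (ξ i) y := by
    intro y
    rw [hηeq]
    exact fderiv_fun_sum (fun i _ => (h1 i).differentiable (by simp) y)
  have s2 : ∫ y, fderiv ℝ η y (setField E (f y) / deriv f y) * ‖deriv f y‖ ^ 2
      = ∑ i, ∫ y, fderiv ℝ (ξ i) y (setField E (f y) / deriv f y) * ‖deriv f y‖ ^ 2 := by
    rw [← integral_finsetSum _ (fun i _ => (hl i).1)]
    congr 1
    funext y
    rw [hfd y, sum_apply, Finset.sum_mul]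
  have s3 : ∫ y, η y * ‖deriv f y‖ ^ 2
      = (1 / (2 * π)) * ∫ y, fderiv ℝ η y (setField E (f y) / deriv f y) * ‖deriv f y‖ ^ 2 := by
    rw [s1, s2, Finset.mul_sum]
    exact Finset.sum_congr rfl fun i _ => (hl i).2
  set A := ∫ y in S, ‖deriv f y‖ ^ 2 with hA
  have hA0 : 0 ≤ A := integral_nonneg fun y => by positivity
  have hEA : (volume E).toReal ≤ A := ENNReal.toReal_le_of_le_ofReal hA0 hvol
  have hnc : Continuous (fun y => ‖fderiv ℝ η y‖ * ‖deriv f y‖) :=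
    (hη.continuous_fderiv (by simp)).norm.mul hdc.norm
  have hncs : HasCompactSupport (fun y => ‖fderiv ℝ η y‖ * ‖deriv f y‖) :=
    ((hc.fderiv (𝕜 := ℝ)).norm).mul_right
  have s4 : ∫ y, fderiv ℝ η y (setField E (f y) / deriv f y) * ‖deriv f y‖ ^ 2 
      ≤ √(π * A) * ∫ y, ‖fderiv ℝ η y‖ * ‖deriv f y‖ := by
    rw [← integral_const_mul]
    have hli : Integrable (fun y => fderiv ℝ η y (setField E (f y) / deriv f y) * ‖deriv f y‖ ^ 2) := by
      have := integrable_finsetSum Finset.univ (fun i _ => (hl i).1)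
      refine this.congr (Filter.Eventually.of_forall fun y => ?_)
      simp only
      rw [hfd y, sum_apply, Finset.sum_mul]
    refine integral_mono hli ((hnc.integrable_of_hasCompactSupport hncs).const_mul _) ?_
    intro y
    have hp : 0 < ‖deriv f y‖ := norm_pos_iff.2 (hf' y)
    have q1 : fderiv ℝ η y (setField E (f y) / deriv f y) ≤
        ‖fderiv ℝ η y‖ * (‖setField E (f y)‖ / ‖deriv f y‖) := by
      rw [← norm_div]
      exact (le_abs_self _).trans ((fderiv ℝ η y).le_opNorm _)
    have q2 : ‖setField E (f y)‖ ≤ √(π * A) :=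
      (setField_norm_le hEo.measurableSet hEfin _).trans
        (Real.sqrt_le_sqrt (mul_le_mul_of_nonneg_left hEA pi_pos.le))
    calc fderiv ℝ η y (setField E (f y) / deriv f y) * ‖deriv f y‖ ^ 2
        ≤ ‖fderiv ℝ η y‖ * (‖setField E (f y)‖ / ‖deriv f y‖) * ‖deriv f y‖ ^ 2 := by gcongr
      _ = ‖setField E (f y)‖ * (‖fderiv ℝ η y‖ * ‖deriv f y‖) := by field_simp
      _ ≤ √(π * A) * (‖fderiv ℝ η y‖ * ‖deriv f y‖) := by gcongr
  have hpi : √(π * A) = √π * √A := Real.sqrt_mul pi_pos.le _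
  rw [s3]
  have hpp : √π * √π = π := Real.mul_self_sqrt pi_pos.le
  set I := ∫ y, fderiv ℝ η y (setField E (f y) / deriv f y) * ‖deriv f y‖ ^ 2
  set N := ∫ y, ‖fderiv ℝ η y‖ * ‖deriv f y‖
  rw [hpi] at s4
  have hsp : 0 < √π := Real.sqrt_pos.2 pi_pos
  have : 2 * √π * (1 / (2 * π) * I) = I / √π := by
    rw [eq_div_iff hsp.ne']
    calc 2 * √π * (1 / (2 * π) * I) * √π = (√π * √π) * (1 / π) * I := by ring
      _ = I := by rw [hpp]; field_simp
  rw [this, div_le_iff₀ hsp]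
  linarith

theorem clm_norm_sq (L : ℂ →L[ℝ] ℝ) : ‖L‖ ^ 2 = (L 1) ^ 2 + (L Complex.I) ^ 2 := by
  have hL : ∀ z : ℂ, L z = z.re * L 1 + z.im * L Complex.I := by
    intro z
    conv_lhs => rw [← Complex.re_add_im z]
    have : (z.re : ℂ) + z.im * Complex.I = z.re • (1:ℂ) + z.im • Complex.I := by
      simp
    rw [this, map_add, map_smul, map_smul, smul_eq_mul, smul_eq_mul]
  set a := L 1
  set b := L Complex.I
  apply le_antisymm
  · have h1 : ‖L‖ ≤ √(a ^ 2 + b ^ 2) := by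
      refine L.opNorm_le_bound (Real.sqrt_nonneg _) fun z => ?_
      rw [hL z, Real.norm_eq_abs]
      apply abs_le_of_sq_le_sq ?_ ?_
      · rw [mul_pow, Real.sq_sqrt (by positivity), ← Complex.normSq_eq_norm_sq, Complex.normSq_apply]
        nlinarith [sq_nonneg (z.re * b - z.im * a)]
      · positivity
    calc ‖L‖ ^ 2 ≤ √(a ^ 2 + b ^ 2) ^ 2 := by gcongr
      _ = _ := Real.sq_sqrt (by positivity)
  · by_cases h0 : a ^ 2 + b ^ 2 = 0
    · rw [h0]; positivity
    have hp : 0 < a ^ 2 + b ^ 2 := lt_of_le_of_ne (by positivity) (Ne.symm h0)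
    have h1 := L.le_opNorm ⟨a, b⟩
    rw [hL] at h1
    simp only [Real.norm_eq_abs] at h1
    have h2 : ‖(⟨a, b⟩ : ℂ)‖ ^ 2 = a ^ 2 + b ^ 2 := by
      rw [← Complex.normSq_eq_norm_sq, Complex.normSq_apply]; ring
    have h3 : (a * a + b * b) ^ 2 ≤ (‖L‖ * ‖(⟨a, b⟩ : ℂ)‖) ^ 2 := by
      rw [← sq_abs]; gcongr
    rw [mul_pow, h2] at h3
    have : (a ^ 2 + b ^ 2) * (a ^ 2 + b ^ 2) ≤ ‖L‖ ^ 2 * (a ^ 2 + b ^ 2) := by nlinarith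
    exact le_of_mul_le_mul_right this hp

theorem integral_fderiv_zero {F : ℂ → ℝ} (hF : ContDiff ℝ 1 F) (hc : HasCompactSupport F) (e : ℂ) :
    ∫ z, fderiv ℝ F z e = 0 := by
  have h1 : Continuous (fun z => fderiv ℝ F z e) := (hF.continuous_fderiv (by simp)).clm_apply continuous_const
  have h2 : HasCompactSupport (fun z => fderiv ℝ F z e) := hc.fderiv_apply (𝕜 := ℝ) e
  have := integral_mul_fderiv_eq_neg_fderiv_mul_of_integrable (μ := (volume : Measure ℂ))
    (f := fun _ : ℂ => (1:ℝ)) (g := F) (v := e) (by simp) (by simpa using h1.integrable_of_hasCompactSupport h2)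
    (by simpa using hF.continuous.integrable_of_hasCompactSupport hc) (by fun_prop)
    (fun x _ => hF.differentiable (by simp) x)
  simpa using this

theorem integral_fderiv_mul_local {η g : ℂ → ℝ} {V : Set ℂ} (hV : IsOpen V) (hη : ContDiff ℝ 1 η)
    (hc : HasCompactSupport η) (hs : tsupport η ⊆ V) (hg : ContDiffOn ℝ 1 g V) (e : ℂ) :
    Integrable (fun z => fderiv ℝ η z e * g z) ∧ Integrable (fun z => η z * fderiv ℝ g z e) ∧
    ∫ z, fderiv ℝ η z e * g z = - ∫ z, η z * fderiv ℝ g z e := by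
  have key : ∀ z ∈ V, HasFDerivAt (fun z => η z * g z) (η z • fderiv ℝ g z + g z • fderiv ℝ η z) z := by
    intro z hz
    exact (hη.differentiable (by simp) z).hasFDerivAt.mul
      (((hg.contDiffAt (hV.mem_nhds hz)).differentiableAt (by simp)).hasFDerivAt)
  have cz : ∀ {F : ℂ → ℝ}, ContinuousOn F V → (∀ z ∉ tsupport η, F z = 0) → Continuous F := by
    intro F h1 h2
    rw [continuous_iff_continuousAt]
    intro z
    by_cases hz : z ∈ tsupport η
    · exact h1.continuousAt (hV.mem_nhds (hs hz))
    · refine (continuousAt_const (y := (0:ℝ))).congr ?_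
      filter_upwards [(isClosed_tsupport η).isOpen_compl.mem_nhds hz] with y hy
      exact (h2 y hy).symm
  have i1 : Integrable (fun z => fderiv ℝ η z e * g z) := by
    refine Continuous.integrable_of_hasCompactSupport (cz ?_ ?_) (hc.fderiv_apply (𝕜 := ℝ) e).mul_right
    · exact ((hη.continuous_fderiv (by simp)).clm_apply continuous_const).continuousOn.mul hg.continuousOn
    · intro z hz
      rw [fderiv_of_notMem_tsupport (𝕜 := ℝ) hz]; simp
  have i2 : Integrable (fun z => η z * fderiv ℝ g z e) := by
    refine Continuous.integrable_of_hasCompactSupport (cz ?_ ?_) hc.mul_right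
    · exact hη.continuous.continuousOn.mul
        ((hg.continuousOn_fderiv_of_isOpen hV (by simp)).clm_apply continuousOn_const)
    · intro z hz
      rw [image_eq_zero_of_notMem_tsupport hz]; simp
  refine ⟨i1, i2, ?_⟩
  have hF : ContDiff ℝ 1 (fun z => η z * g z) := by
    rw [contDiff_iff_contDiffAt]
    intro z
    by_cases hz : z ∈ tsupport η
    · exact hη.contDiffAt.mul (hg.contDiffAt (hV.mem_nhds (hs hz)))
    · refine (contDiffAt_const (c := (0:ℝ))).congr_of_eventuallyEq ?_
      filter_upwards [(isClosed_tsupport η).isOpen_compl.mem_nhds hz] with y hy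
      rw [image_eq_zero_of_notMem_tsupport hy, zero_mul]
  have h0 := integral_fderiv_zero hF hc.mul_right e
  have : ∀ z, fderiv ℝ (fun z => η z * g z) z e = fderiv ℝ η z e * g z + η z * fderiv ℝ g z e := by
    intro z
    by_cases hz : z ∈ tsupport η
    · rw [(key z (hs hz)).fderiv]; simp; ring
    · have h2 : z ∉ tsupport (fun z => η z * g z) := fun h => hz (tsupport_mul_subset_left h)
      rw [fderiv_of_notMem_tsupport (𝕜 := ℝ) h2, fderiv_of_notMem_tsupport (𝕜 := ℝ) hz,
        image_eq_zero_of_notMem_tsupport hz]; simp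
  simp_rw [this] at h0
  rw [integral_add i1 i2] at h0
  linarith

open Laplacian in
theorem laplacian_eq' {v : ℂ → ℝ} {V : Set ℂ} (hV : IsOpen V) (hv : ContDiffOn ℝ 2 v V) {z : ℂ} (hz : z ∈ V) :
    Δ v z = fderiv ℝ (fun y => fderiv ℝ v y 1) z 1 
      + fderiv ℝ (fun y => fderiv ℝ v y Complex.I) z Complex.I := by
  have hd : DifferentiableAt ℝ (fderiv ℝ v) z :=
    ((hv.contDiffAt (hV.mem_nhds hz)).fderiv_right (m := 1) (by norm_num)).differentiableAt (by simp)
  have : ∀ e : ℂ, fderiv ℝ (fun y => fderiv ℝ v y e) z e = fderiv ℝ (fderiv ℝ v) z e e := by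
    intro e
    rw [fderiv_clm_apply hd (differentiableAt_const _)]
    simp
  rw [InnerProductSpace.laplacian_eq_iteratedFDeriv_complexPlane, this, this]
  simp [iteratedFDeriv_two_apply]

open Laplacian in
theorem green {η v : ℂ → ℝ} {V : Set ℂ} (hV : IsOpen V) (hη : ContDiff ℝ 1 η)
    (hc : HasCompactSupport η) (hs : tsupport η ⊆ V) (hv : ContDiffOn ℝ 2 v V) :
    Integrable (fun z => fderiv ℝ η z 1 * fderiv ℝ v z 1
      + fderiv ℝ η z Complex.I * fderiv ℝ v z Complex.I) ∧ Integrable (fun z => η z * Δ v z) ∧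
    ∫ z, (fderiv ℝ η z 1 * fderiv ℝ v z 1 + fderiv ℝ η z Complex.I * fderiv ℝ v z Complex.I)
      = - ∫ z, η z * Δ v z := by
  have hg : ∀ e : ℂ, ContDiffOn ℝ 1 (fun y => fderiv ℝ v y e) V := fun e =>
    (hv.fderiv_of_isOpen hV (by norm_num)).clm_apply contDiffOn_const
  obtain ⟨a1, a2, a3⟩ := integral_fderiv_mul_local hV hη hc hs (hg 1) 1
  obtain ⟨b1, b2, b3⟩ := integral_fderiv_mul_local hV hη hc hs (hg Complex.I) Complex.I
  have e : (fun z => η z * Δ v z) = fun z => η z * fderiv ℝ (fun y => fderiv ℝ v y 1) z 1 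
      + η z * fderiv ℝ (fun y => fderiv ℝ v y Complex.I) z Complex.I := by
    funext z
    by_cases hz : z ∈ tsupport η
    · rw [laplacian_eq' hV hv (hs hz)]; ring
    · rw [image_eq_zero_of_notMem_tsupport hz]; simp
  refine ⟨a1.add b1, ?_, ?_⟩
  · rw [e]; exact a2.add b2
  · rw [e, integral_add a1 b1, integral_add a2 b2, a3, b3]; ring

/-- trapezoidal ramp -/
theorem exists_ramp {κ : ℝ} (hκ : 0 < κ) (t : ℝ) {ε : ℝ} (hε : 0 < ε) :
    ∃ β : ℝ → ℝ, ContDiff ℝ 1 β ∧ (∀ s ≤ t, β s = 0) ∧ (∀ s, t + ε ≤ s → β s = β (t + ε)) ∧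
      (∀ s, 0 ≤ β s ∧ β s ≤ 1) ∧ (1 - κ ≤ β (t + ε)) ∧ (∀ s, 0 ≤ deriv β s ∧ deriv β s ≤ 1 / ε) ∧
      (∀ s, s ∉ Set.Ioo t (t + ε) → deriv β s = 0) := by
  set δ := min (κ * ε) ε / 2 with hδ
  have hδ0 : 0 < δ := by positivity
  have hδ1 : 2 * δ ≤ κ * ε := by have := min_le_left (κ * ε) ε; rw [hδ]; linarith
  have hδ2 : 2 * δ ≤ ε := by have := min_le_right (κ * ε) ε; rw [hδ]; linarith
  set g : ℝ → ℝ := fun s => max 0 (min 1 (min ((s - t) / δ) ((t + ε - s) / δ))) / ε with hg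
  have hgc : Continuous g := by rw [hg]; fun_prop
  have hg0 : ∀ s, 0 ≤ g s := fun s => by simp only [hg]; positivity
  have hg1 : ∀ s, g s ≤ 1 / ε := fun s => by
    simp only [hg]; gcongr; exact max_le zero_le_one (min_le_left _ _)
  have hgz : ∀ s, s ∉ Set.Ioo t (t + ε) → g s = 0 := by
    intro s hs
    simp only [Set.mem_Ioo, not_and_or, not_lt] at hs
    have : min 1 (min ((s - t) / δ) ((t + ε - s) / δ)) ≤ 0 := by
      refine (min_le_right _ _).trans ?_
      rcases hs with h | h
      · exact (min_le_left _ _).trans (div_nonpos_of_nonpos_of_nonneg (by linarith) hδ0.le)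
      · exact (min_le_right _ _).trans (div_nonpos_of_nonpos_of_nonneg (by linarith) hδ0.le)
    simp only [hg]
    rw [max_eq_left this, zero_div]
  have hgi : ∀ a b, IntervalIntegrable g volume a b := fun a b => hgc.intervalIntegrable a b
  set β : ℝ → ℝ := fun s => ∫ x in t..s, g x with hβ
  have hd : ∀ s, HasDerivAt β (g s) s := fun s => 
    intervalIntegral.integral_hasDerivAt_right (hgi _ _) (hgc.stronglyMeasurableAtFilter _ _) hgc.continuousAt
  have hde : deriv β = g := funext fun s => (hd s).deriv
  have hC : ContDiff ℝ 1 β := by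
    rw [contDiff_one_iff_deriv]
    exact ⟨fun s => (hd s).differentiableAt, by rw [hde]; exact hgc⟩
  have hmono : Monotone β := monotone_of_deriv_nonneg (fun s => (hd s).differentiableAt)
    (fun s => by rw [hde]; exact hg0 s)
  have hle : ∀ s ≤ t, β s = 0 := by
    intro s hs
    simp only [hβ]
    rw [intervalIntegral.integral_symm, neg_eq_zero]
    apply intervalIntegral.integral_zero_ae
    refine Filter.Eventually.of_forall fun x hx => hgz x ?_
    rw [Set.uIoc_of_le hs] at hx
    exact fun h => absurd h.1 (not_lt.2 hx.2)
  have hge : ∀ s, t + ε ≤ s → β s = β (t + ε) := by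
    intro s hs
    have : β s = β (t + ε) + ∫ x in (t+ε)..s, g x := by
      simp only [hβ]; rw [intervalIntegral.integral_add_adjacent_intervals (hgi _ _) (hgi _ _)]
    rw [this, add_eq_left]
    apply intervalIntegral.integral_zero_ae
    refine Filter.Eventually.of_forall fun x hx => hgz x ?_
    rw [Set.uIoc_of_le hs] at hx
    exact fun h => absurd h.2 (not_lt.2 hx.1.le)
  have htop : β (t + ε) ≤ 1 := by
    have : β (t + ε) ≤ ∫ x in t..(t+ε), 1 / ε := 
      intervalIntegral.integral_mono_on (by linarith) (hgi _ _) (by simp) (fun x _ => hg1 x)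
    refine this.trans (le_of_eq ?_)
    simp; field_simp
  have hb : ∀ s, 0 ≤ β s ∧ β s ≤ 1 := by
    intro s
    constructor
    · rcases le_total s t with h | h
      · rw [hle s h]
      · rw [← hle t le_rfl]; exact hmono h
    · rcases le_total s (t + ε) with h | h
      · exact (hmono h).trans htop
      · rw [hge s h]; exact htop
  refine ⟨β, hC, hle, hge, hb, ?_, fun s => by rw [hde]; exact ⟨hg0 s, hg1 s⟩, fun s hs => by rw [hde]; exact hgz s hs⟩
  have h1 : ∫ x in (t+δ)..(t+ε-δ), g x = ∫ x in (t+δ)..(t+ε-δ), 1 / ε := by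
    apply intervalIntegral.integral_congr
    intro x hx
    rw [Set.uIcc_of_le (by linarith)] at hx
    have e1 : 1 ≤ (x - t) / δ := by rw [le_div_iff₀ hδ0]; linarith [hx.1]
    have e2 : 1 ≤ (t + ε - x) / δ := by rw [le_div_iff₀ hδ0]; linarith [hx.2]
    simp only [hg]
    rw [min_eq_left (le_min e1 e2), max_eq_right zero_le_one]
  have h2 : β (t + ε - δ) - β (t + δ) = ∫ x in (t+δ)..(t+ε-δ), g x := by
    simp only [hβ]; rw [intervalIntegral.integral_interval_sub_left (hgi _ _) (hgi _ _)]
  have h3 := hmono (show t + ε - δ ≤ t + ε by linarith)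
  have h4 := (hb (t + δ)).1
  have h5 : ∫ x in (t+δ)..(t+ε-δ), 1 / ε = 1 - 2 * δ / ε := by
    simp; field_simp; ring
  have h6 : 2 * δ / ε ≤ κ := by rw [div_le_iff₀ hε]; exact hδ1
  linarith [h2, h1, h3, h4, h5, h6]

theorem cauchy_schwarz_int {α : Type*} [MeasurableSpace α] {μ : Measure α} {f g : α → ℝ}
    (hf : AEStronglyMeasurable f μ) (hg : AEStronglyMeasurable g μ)
    (hf2 : Integrable (fun x => f x ^ 2) μ) (hg2 : Integrable (fun x => g x ^ 2) μ) :
    Integrable (fun x => f x * g x) μ ∧ (∫ x, f x * g x ∂μ) ^ 2 ≤ (∫ x, f x ^ 2 ∂μ) * ∫ x, g x ^ 2 ∂μ := by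
  have hi : Integrable (fun x => f x * g x) μ := by
    refine (hf2.add hg2).mono' (hf.mul hg) (Filter.Eventually.of_forall fun x => ?_)
    rw [Real.norm_eq_abs, abs_mul]
    simp only [Pi.add_apply]
    nlinarith [sq_nonneg (|f x| - |g x|), sq_abs (f x), sq_abs (g x), abs_nonneg (f x), abs_nonneg (g x)]
  refine ⟨hi, ?_⟩
  have key : ∀ s : ℝ, 0 ≤ (∫ x, g x ^ 2 ∂μ) * (s * s) + (2 * ∫ x, f x * g x ∂μ) * s + ∫ x, f x ^ 2 ∂μ := by
    intro s
    have h : 0 ≤ ∫ x, (f x + s * g x) ^ 2 ∂μ := integral_nonneg fun x => sq_nonneg _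
    have e : ∀ x, (f x + s * g x) ^ 2 = f x ^ 2 + ((2 * s) * (f x * g x) + (s * s) * g x ^ 2) := fun x => by ring
    simp_rw [e] at h
    have hj : Integrable (fun x => (2 * s) * (f x * g x) + (s * s) * g x ^ 2) μ :=
      (hi.const_mul _).add (hg2.const_mul _)
    rw [integral_add hf2 hj, integral_add (hi.const_mul _) (hg2.const_mul _),
      integral_const_mul, integral_const_mul] at h
    linarith
  have := discrim_le_zero key
  rw [discrim] at this
  nlinarith

/-- cutting off `b ∘ v` at the boundary of `G` -/
theorem cut_zero {G : Set ℂ} {v : ℂ → ℝ} {t : ℝ} {b : ℝ → ℝ} (hb : ∀ s ≤ t, b s = 0) (y : ℂ)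
    (hy : y ∉ closure G ∩ v ⁻¹' Set.Ici t) : G.indicator (fun z => b (v z)) y = 0 := by
  by_cases h : y ∈ G
  · rw [Set.indicator_of_mem h]
    apply hb
    by_contra h2
    exact hy ⟨subset_closure h, (not_le.1 h2).le⟩
  · exact Set.indicator_of_notMem h _

theorem cut_contDiff {G U : Set ℂ} (hG : IsOpen G) (hU : IsOpen U) (hGU : closure G ⊆ U) {v : ℂ → ℝ} {n : ℕ∞ω}
    (hv : ContDiffOn ℝ n v U) {t : ℝ} (hfr : ∀ y ∈ closure G, t ≤ v y → y ∈ G)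
    {b : ℝ → ℝ} (hbc : ContDiff ℝ n b) (hb : ∀ s ≤ t, b s = 0) :
    ContDiff ℝ n (G.indicator (fun z => b (v z))) := by
  have hK : IsClosed (closure G ∩ v ⁻¹' Set.Ici t) :=
    (hv.continuousOn.mono hGU).preimage_isClosed_of_isClosed isClosed_closure isClosed_Ici
  rw [contDiff_iff_contDiffAt]
  intro y
  by_cases h : y ∈ G
  · have h1 : ContDiffAt ℝ n (fun z => b (v z)) y :=
      hbc.contDiffAt.comp y (hv.contDiffAt (hU.mem_nhds (hGU (subset_closure h))))
    refine h1.congr_of_eventuallyEq ?_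
    filter_upwards [hG.mem_nhds h] with z hz
    exact Set.indicator_of_mem hz _
  · refine (contDiffAt_const (c := (0:ℝ))).congr_of_eventuallyEq ?_
    have : y ∉ closure G ∩ v ⁻¹' Set.Ici t := fun h2 => h (hfr y h2.1 h2.2)
    filter_upwards [hK.isOpen_compl.mem_nhds this] with z hz
    exact cut_zero hb z hz

open Laplacian in
theorem bol_step {G U : Set ℂ} (hG : IsOpen G) (hbd : Bornology.IsBounded G) (hU : IsOpen U)
    (hGU : closure G ⊆ U) {w h : ℂ → ℝ} (hw : ContDiffOn ℝ 2 w U)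
    (hsup : ∀ y ∈ G, 0 ≤ Δ w y + exp (w y)) {f : ℂ → ℂ} (hf : Differentiable ℂ f)
    (hf' : ∀ z, deriv f z ≠ 0) (hh : ContDiff ℝ 2 h) (hfh : ∀ y, ‖deriv f y‖ ^ 2 = exp (h y))
    (hharm : ∀ y, Δ h y = 0) {t ε : ℝ} (hε : 0 < ε)
    (hfr : ∀ y ∈ closure G, t ≤ w y - h y → y ∈ G) :
    4 * π * ε * (∫ y in {y ∈ G | t + ε < w y - h y}, exp (h y)) ^ 2 ≤
      (∫ y in {y ∈ G | t < w y - h y}, exp (h y)) * (∫ y in {y ∈ G | t < w y - h y}, exp (w y)) *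
        ((∫ y in {y ∈ G | t < w y - h y}, exp (h y)) - ∫ y in {y ∈ G | t + ε < w y - h y}, exp (h y)) := by
  set v : ℂ → ℝ := fun y => w y - h y with hvdef
  have hv : ContDiffOn ℝ 2 v U := hw.sub hh.contDiffOn
  have hvG : ContinuousOn v G := hv.continuousOn.mono (subset_closure.trans hGU)
  have hSo : ∀ s, IsOpen {y ∈ G | s < v y} := fun s => hvG.isOpen_inter_preimage hG isOpen_Ioi
  have hcomp : IsCompact (closure G) := hbd.isCompact_closure
  have hKc : IsCompact (closure G ∩ v ⁻¹' Set.Ici t) :=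
    hcomp.of_isClosed_subset ((hv.continuousOn.mono hGU).preimage_isClosed_of_isClosed
      isClosed_closure isClosed_Ici) Set.inter_subset_left
  have hKG : closure G ∩ v ⁻¹' Set.Ici t ⊆ G := fun y hy => hfr y hy.1 hy.2
  have ieh : ∀ S ⊆ G, IntegrableOn (fun y => exp (h y)) S := fun S hS =>
    (ContinuousOn.integrableOn_compact hcomp (hh.continuous.rexp).continuousOn).mono_set (hS.trans subset_closure)
  have iew : ∀ S ⊆ G, IntegrableOn (fun y => exp (w y)) S := fun S hS =>
    (ContinuousOn.integrableOn_compact hcomp (hw.continuousOn.mono hGU).rexp).mono_set (hS.trans subset_closure)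
  set S : ℝ → Set ℂ := fun s => {y ∈ G | s < v y} with hS
  have hSG : ∀ s, S s ⊆ G := fun s => Set.sep_subset _ _
  change 4 * π * ε * (∫ y in S (t + ε), exp (h y)) ^ 2 ≤ (∫ y in S t, exp (h y)) * (∫ y in S t, exp (w y)) *
        ((∫ y in S t, exp (h y)) - ∫ y in S (t + ε), exp (h y))
  set a0 := ∫ y in S t, exp (h y) with ha0
  set a1 := ∫ y in S (t + ε), exp (h y) with ha1
  set m0 := ∫ y in S t, exp (w y) with hm0
  have ha0n : 0 ≤ a0 := integral_nonneg fun y => (exp_pos _).le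
  have ha1n : 0 ≤ a1 := integral_nonneg fun y => (exp_pos _).le
  have hm0n : 0 ≤ m0 := integral_nonneg fun y => (exp_pos _).le
  have hdc : Continuous (deriv f) := (hf.contDiff : ContDiff ℂ 1 f).continuous_deriv (by simp)
  have main : ∀ κ : ℝ, 0 < κ → κ < 1 → 4 * π * ((1 - κ) * a1) ^ 2 ≤ a0 * (m0 * ((1 / ε) * (a0 - a1))) := by
    intro κ hκ hκ1
    obtain ⟨β, b1, b2, b3, b4, b5, b6, b7⟩ := exists_ramp hκ t hε
    have b7' : ∀ s ≤ t, deriv β s = 0 := fun s hs => b7 s fun h => absurd h.1 (not_lt.2 hs)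
    set η : ℂ → ℝ := G.indicator (fun z => β (v z)) with hη
    set γ : ℂ → ℝ := G.indicator (fun z => deriv β (v z)) with hγ
    have hη1 : ContDiff ℝ 1 η := cut_contDiff hG hU hGU (hv.of_le (by norm_num)) hfr b1 b2
    have hγ0 : Continuous γ := (cut_contDiff (n := 0) hG hU hGU (hv.of_le (by norm_num)) hfr 
      (contDiff_zero.2 (b1.continuous_deriv (by simp))) b7').continuous
    have hηc : HasCompactSupport η := HasCompactSupport.intro hKc (fun y hy => cut_zero b2 y hy)
    have hγc : HasCompactSupport γ := HasCompactSupport.intro hKc (fun y hy => cut_zero b7' y hy)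
    have hηs : tsupport η ⊆ G := (closure_minimal (fun z hz => by
      by_contra h; exact hz (cut_zero b2 z h)) hKc.isClosed).trans hKG
    have hγn : ∀ y, 0 ≤ γ y := fun y => Set.indicator_nonneg (fun z _ => (b6 _).1) y
    have hηn : ∀ y, 0 ≤ η y := fun y => Set.indicator_nonneg (fun z _ => (b4 _).1) y
    -- derivative
    have hder : ∀ y, fderiv ℝ η y = γ y • fderiv ℝ v y := by
      intro y
      by_cases hy : y ∈ G
      · have e1 : HasFDerivAt v (fderiv ℝ v y) y :=
          ((hv.contDiffAt (hU.mem_nhds (hGU (subset_closure hy)))).differentiableAt (by simp)).hasFDerivAt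
        have e2 : HasDerivAt β (deriv β (v y)) (v y) := (b1.differentiable (by simp) _).hasDerivAt
        have e3 := e2.comp_hasFDerivAt y e1
        have e4 : HasFDerivAt η (deriv β (v y) • fderiv ℝ v y) y := by
          refine e3.congr_of_eventuallyEq ?_
          filter_upwards [hG.mem_nhds hy] with z hz
          exact Set.indicator_of_mem hz _
        rw [e4.fderiv, hγ, Set.indicator_of_mem hy]
      · rw [fderiv_of_notMem_tsupport (𝕜 := ℝ) (fun h => hy (hηs h)), hγ, Set.indicator_of_notMem hy, zero_smul]
    have FI := flat_isoperimetric hf hf' hη1 hηc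
    obtain ⟨g1, g2, g3⟩ := green hG hη1 hηc hηs (hv.mono (subset_closure.trans hGU))
    have hP : ∀ z, fderiv ℝ η z 1 * fderiv ℝ v z 1 + fderiv ℝ η z Complex.I * fderiv ℝ v z Complex.I
        = γ z * ‖fderiv ℝ v z‖ ^ 2 := by
      intro z
      rw [hder z, clm_norm_sq]
      simp; ring
    simp_rw [hP] at g1 g3
    -- lower bound of the left side
    have l1 : (1 - κ) * a1 ≤ ∫ y, η y * ‖deriv f y‖ ^ 2 := by
      rw [ha1, ← integral_const_mul, ← integral_indicator (hSo _).measurableSet]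
      apply integral_mono
      · exact IntegrableOn.integrable_indicator ((ieh _ (hSG _)).const_mul _) (hSo _).measurableSet
      · exact Continuous.integrable_of_hasCompactSupport (hη1.continuous.mul (by fun_prop)) hηc.mul_right
      · intro y
        simp only
        by_cases hy : y ∈ S (t + ε)
        · rw [Set.indicator_of_mem hy, hη, Set.indicator_of_mem hy.1, hfh, b3 _ hy.2.le]
          gcongr
        · rw [Set.indicator_of_notMem hy]
          exact mul_nonneg (hηn y) (by positivity)
    have hsupp : {y | η y ≠ 0} ⊆ S t := by
      intro y hy
      have hyG : y ∈ G := by by_contra h; exact hy (Set.indicator_of_notMem h _)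
      refine ⟨hyG, ?_⟩
      by_contra h2
      apply hy
      rw [hη, Set.indicator_of_mem hyG]
      exact b2 _ (not_lt.1 h2)
    have l2 : ∫ y in {y | η y ≠ 0}, ‖deriv f y‖ ^ 2 ≤ a0 := by
      simp_rw [hfh]
      exact setIntegral_mono_set (ieh _ (hSG _)) (Filter.Eventually.of_forall fun y => (exp_pos _).le)
        (Filter.Eventually.of_forall hsupp)
    -- Cauchy-Schwarz
    have hQc : Continuous (fun y => γ y * ‖deriv f y‖ ^ 2) := hγ0.mul (by fun_prop)
    have hQi : Integrable (fun y => γ y * ‖deriv f y‖ ^ 2) :=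
      hQc.integrable_of_hasCompactSupport hγc.mul_right
    have hsP : ∀ z, √(γ z * ‖fderiv ℝ v z‖ ^ 2) ^ 2 = γ z * ‖fderiv ℝ v z‖ ^ 2 := fun z =>
      Real.sq_sqrt (mul_nonneg (hγn z) (by positivity))
    have hsQ : ∀ z, √(γ z * ‖deriv f z‖ ^ 2) ^ 2 = γ z * ‖deriv f z‖ ^ 2 := fun z =>
      Real.sq_sqrt (mul_nonneg (hγn z) (by positivity))
    have CS := (cauchy_schwarz_int (f := fun z => √(γ z * ‖fderiv ℝ v z‖ ^ 2)) 
      (g := fun z => √(γ z * ‖deriv f z‖ ^ 2)) (μ := volume)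
      (Real.continuous_sqrt.comp_aestronglyMeasurable g1.1)
      (Real.continuous_sqrt.comp_aestronglyMeasurable hQi.1)
      (by simp_rw [hsP]; exact g1) (by simp_rw [hsQ]; exact hQi)).2
    simp_rw [hsP, hsQ] at CS
    have hprod : ∀ z, √(γ z * ‖fderiv ℝ v z‖ ^ 2) * √(γ z * ‖deriv f z‖ ^ 2) = ‖fderiv ℝ η z‖ * ‖deriv f z‖ := by
      intro z
      rw [hder z, norm_smul, Real.norm_of_nonneg (hγn z), Real.sqrt_mul (hγn z), Real.sqrt_mul (hγn z),
        Real.sqrt_sq (norm_nonneg _), Real.sqrt_sq (norm_nonneg _)]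
      have := Real.mul_self_sqrt (hγn z)
      linear_combination (‖fderiv ℝ v z‖ * ‖deriv f z‖) * this
    simp_rw [hprod] at CS
    -- bound of P
    have l3 : ∫ z, γ z * ‖fderiv ℝ v z‖ ^ 2 ≤ m0 := by
      rw [g3, ← integral_neg, hm0, ← integral_indicator (hSo _).measurableSet]
      apply integral_mono g2.neg ((iew _ (hSG _)).integrable_indicator (hSo _).measurableSet)
      intro y
      simp only [Pi.neg_apply]
      by_cases hy : y ∈ S t
      · rw [Set.indicator_of_mem hy]
        have e1 : Δ v y = Δ w y := by
          have := (hw.contDiffAt (hU.mem_nhds (hGU (subset_closure hy.1)))).laplacian_sub (hh.contDiffAt (x := y))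
          rw [hharm y, sub_zero] at this
          exact this
        rw [e1]
        have e2 := hsup y hy.1
        have e3 := hηn y
        have e4 : η y ≤ 1 := by rw [hη, Set.indicator_of_mem hy.1]; exact (b4 _).2
        nlinarith [exp_pos (w y)]
      · have : η y = 0 := by by_contra h; exact hy (hsupp h)
        rw [this, Set.indicator_of_notMem hy]; simp
    -- bound of Q
    have l4 : ∫ z, γ z * ‖deriv f z‖ ^ 2 ≤ (1 / ε) * (a0 - a1) := by
      have hsub : S (t + ε) ⊆ S t := fun y hy => ⟨hy.1, by linarith [hy.2]⟩
      have hd : a0 - a1 = ∫ y in S t \ S (t + ε), exp (h y) := by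
        rw [setIntegral_sdiff (hSo _).measurableSet (ieh _ (hSG _)) hsub]
      have hmd : MeasurableSet (S t \ S (t + ε)) := (hSo _).measurableSet.diff (hSo _).measurableSet
      have hid : IntegrableOn (fun y => exp (h y)) (S t \ S (t+ε)) := ieh _ (Set.sdiff_subset.trans (hSG _))
      rw [hd, ← integral_const_mul, ← integral_indicator hmd]
      apply integral_mono hQi (IntegrableOn.integrable_indicator (hid.const_mul _) hmd)
      intro y
      simp only
      by_cases hy : y ∈ S t \ S (t + ε)
      · rw [Set.indicator_of_mem hy, hfh]
        gcongr
        rw [hγ, Set.indicator_of_mem hy.1.1]; exact (b6 _).2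
      · rw [Set.indicator_of_notMem hy]
        have : γ y = 0 := by
          by_cases hyG : y ∈ G
          · rw [hγ, Set.indicator_of_mem hyG]
            apply b7
            intro h
            exact hy ⟨⟨hyG, h.1⟩, fun h2 => absurd h2.2 (not_lt.2 h.2.le)⟩
          · exact Set.indicator_of_notMem hyG _
        rw [this, zero_mul]
    set L := ∫ y, ‖fderiv ℝ η y‖ * ‖deriv f y‖ with hL
    have hLn : 0 ≤ L := integral_nonneg fun y => by positivity
    have hQ0 : 0 ≤ ∫ z, γ z * ‖deriv f z‖ ^ 2 := integral_nonneg fun y => mul_nonneg (hγn y) (by positivity)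
    have k1 : L ^ 2 ≤ m0 * ((1 / ε) * (a0 - a1)) := CS.trans (mul_le_mul l3 l4 hQ0 hm0n)
    have k2 : 2 * √π * ((1 - κ) * a1) ≤ √a0 * L := by
      refine (mul_le_mul_of_nonneg_left l1 (by positivity)).trans (FI.trans ?_)
      gcongr
    have k3 : (2 * √π * ((1 - κ) * a1)) ^ 2 ≤ (√a0 * L) ^ 2 := by
      have : 0 ≤ 1 - κ := by linarith
      gcongr
    rw [mul_pow (2 * √π), mul_pow 2, mul_pow (√a0), Real.sq_sqrt pi_pos.le, Real.sq_sqrt ha0n] at k3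
    calc 4 * π * ((1 - κ) * a1) ^ 2 = 2 ^ 2 * π * ((1 - κ) * a1) ^ 2 := by ring
      _ ≤ _ := k3
      _ ≤ _ := by gcongr
  have lim : 4 * π * ((1 - 0) * a1) ^ 2 ≤ a0 * (m0 * ((1 / ε) * (a0 - a1))) := by
    have hc : Filter.Tendsto (fun κ : ℝ => 4 * π * ((1 - κ) * a1) ^ 2) (nhdsWithin 0 (Set.Ioi 0))
        (nhds (4 * π * ((1 - 0) * a1) ^ 2)) := by
      apply tendsto_nhdsWithin_of_tendsto_nhds
      apply Continuous.tendsto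
      fun_prop
    refine le_of_tendsto hc ?_
    filter_upwards [Ioo_mem_nhdsGT (show (0:ℝ) < 1 by norm_num)] with κ hκ
    exact main κ hκ.1 hκ.2
  rw [sub_zero, one_mul] at lim
  calc 4 * π * ε * a1 ^ 2 = ε * (4 * π * a1 ^ 2) := by ring
    _ ≤ ε * (a0 * (m0 * ((1 / ε) * (a0 - a1)))) := by gcongr
    _ = _ := by field_simp

theorem monotone_integral_le {F g : ℝ → ℝ} (hF : Monotone F) {a b : ℝ} (hab : a ≤ b)
    (hg : IntervalIntegrable g volume a b)
    (h : ∀ t ∈ Set.Ioo a b, ∀ F', HasDerivAt F F' t → g t ≤ F') :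
    ∫ t in a..b, g t ≤ F b - F a := by
  have h1 := (hF.monotoneOn (Set.uIcc a b)).intervalIntegral_deriv_mem_uIcc
  rw [Set.uIcc_of_le (sub_nonneg.2 (hF hab))] at h1
  refine le_trans ?_ h1.2
  apply intervalIntegral.integral_mono_ae_restrict hab hg (hF.monotoneOn _).intervalIntegrable_deriv
  have h2 : ∀ᵐ t, DifferentiableAt ℝ F t := hF.ae_differentiableAt
  have h3 : ∀ᵐ t : ℝ, t ≠ a := by simp [ae_iff]
  have h4 : ∀ᵐ t : ℝ, t ≠ b := by simp [ae_iff]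
  rw [Filter.EventuallyLE, ae_restrict_iff' measurableSet_Icc]
  filter_upwards [h2, h3, h4] with t ht ha hb hm
  exact h t ⟨lt_of_le_of_ne hm.1 (Ne.symm ha), lt_of_le_of_ne hm.2 hb⟩ _ ht.hasDerivAt

open Laplacian in
theorem inner_bol {G U : Set ℂ} (hG : IsOpen G) (hbd : Bornology.IsBounded G) (hU : IsOpen U)
    (hGU : closure G ⊆ U) {w h : ℂ → ℝ} (hw : ContDiffOn ℝ 2 w U)
    (hsup : ∀ y ∈ G, 0 ≤ Δ w y + exp (w y)) {f : ℂ → ℂ} (hf : Differentiable ℂ f)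
    (hf' : ∀ z, deriv f z ≠ 0) (hh : ContDiff ℝ 2 h) (hfh : ∀ y, ‖deriv f y‖ ^ 2 = exp (h y))
    (hharm : ∀ y, Δ h y = 0) (hfr : ∀ y ∈ frontier G, w y ≤ h y) :
    (∫ y in G, exp (w y)) - (∫ y in G, exp (w y)) ^ 2 / (8 * π) ≤ ∫ y in G, exp (h y) := by
  set v : ℂ → ℝ := fun y => w y - h y with hvdef
  have hv : ContDiffOn ℝ 2 v U := hw.sub hh.contDiffOn
  have hvG : ContinuousOn v G := hv.continuousOn.mono (subset_closure.trans hGU)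
  have hcomp : IsCompact (closure G) := hbd.isCompact_closure
  have ieh : ∀ S ⊆ G, IntegrableOn (fun y => exp (h y)) S := fun S hS =>
    (ContinuousOn.integrableOn_compact hcomp (hh.continuous.rexp).continuousOn).mono_set (hS.trans subset_closure)
  have iew : ∀ S ⊆ G, IntegrableOn (fun y => exp (w y)) S := fun S hS =>
    (ContinuousOn.integrableOn_compact hcomp (hw.continuousOn.mono hGU).rexp).mono_set (hS.trans subset_closure)
  set S : ℝ → Set ℂ := fun s => {y ∈ G | s < v y} with hS
  have hSo : ∀ s, IsOpen (S s) := fun s => hvG.isOpen_inter_preimage hG isOpen_Ioi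
  have hSm : ∀ s, MeasurableSet (S s) := fun s => (hSo s).measurableSet
  have hSG : ∀ s, S s ⊆ G := fun s => Set.sep_subset _ _
  have hSanti : ∀ s s', s ≤ s' → S s' ⊆ S s := fun s s' h y hy => ⟨hy.1, lt_of_le_of_lt h hy.2⟩
  set a : ℝ → ℝ := fun s => ∫ y in S s, exp (h y) with ha
  set m : ℝ → ℝ := fun s => ∫ y in S s, exp (w y) with hm
  have han : ∀ s, 0 ≤ a s := fun s => integral_nonneg fun y => (exp_pos _).le
  have hmn : ∀ s, 0 ≤ m s := fun s => integral_nonneg fun y => (exp_pos _).le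
  have haanti : Antitone a := fun s s' h => setIntegral_mono_set (ieh _ (hSG _)) 
    (Filter.Eventually.of_forall fun y => (exp_pos _).le) (Filter.Eventually.of_forall (hSanti s s' h))
  have hmanti : Antitone m := fun s s' h => setIntegral_mono_set (iew _ (hSG _)) 
    (Filter.Eventually.of_forall fun y => (exp_pos _).le) (Filter.Eventually.of_forall (hSanti s s' h))
  have hfr' : ∀ t : ℝ, 0 < t → ∀ y ∈ closure G, t ≤ w y - h y → y ∈ G := by
    intro t ht y hy hty
    by_contra hyG
    have : y ∈ frontier G := by rw [hG.frontier_eq]; exact ⟨hy, hyG⟩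
    linarith [hfr y this]
  have hwv : ∀ y, exp (w y) = exp (v y) * exp (h y) := fun y => by
    rw [← Real.exp_add, hvdef]; simp
  -- Δm ≥ e^t Δa
  have hdm : ∀ t ε : ℝ, 0 ≤ ε → exp t * (a t - a (t + ε)) ≤ m t - m (t + ε) := by
    intro t ε hε
    have hsub := hSanti t (t + ε) (by linarith)
    have e1 : a t - a (t + ε) = ∫ y in S t \ S (t + ε), exp (h y) :=
      (setIntegral_sdiff (hSm _) (ieh _ (hSG _)) hsub).symm
    have e2 : m t - m (t + ε) = ∫ y in S t \ S (t + ε), exp (w y) :=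
      (setIntegral_sdiff (hSm _) (iew _ (hSG _)) hsub).symm
    rw [e1, e2, ← integral_const_mul]
    apply setIntegral_mono_on ((ieh _ (Set.sdiff_subset.trans (hSG _))).const_mul _) 
      (iew _ (Set.sdiff_subset.trans (hSG _))) ((hSm _).diff (hSm _))
    intro y hy
    rw [hwv]
    gcongr
    exact hy.1.2.le
  -- derivative inequality
  have hder : ∀ t : ℝ, 0 < t → ∀ m', HasDerivAt m m' t → 4 * π * exp t * a t ≤ m t * (-m') := by
    intro t ht m' hm'
    have hm'0 : m' ≤ 0 := by
      rw [← hm'.deriv]; exact hmanti.deriv_nonpos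
    rcases (han t).eq_or_lt with h0 | h0
    · rw [← h0, mul_zero]; exact mul_nonneg (hmn t) (by linarith)
    have hstep : ∀ ε : ℝ, 0 < ε → 4 * π * exp t * a (t + ε) ^ 2 ≤ a t * (m t * -(ε⁻¹ * (m (t + ε) - m t))) := by
      intro ε hε
      have s1 := bol_step hG hbd hU hGU hw hsup hf hf' hh hfh hharm hε (hfr' t ht)
      change 4 * π * ε * a (t + ε) ^ 2 ≤ a t * m t * (a t - a (t + ε)) at s1
      have s2 := hdm t ε hε.le
      have s3 : 4 * π * ε * a (t + ε) ^ 2 * exp t ≤ a t * m t * (m t - m (t + ε)) := by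
        calc _ ≤ a t * m t * (a t - a (t + ε)) * exp t := by gcongr
          _ = a t * m t * (exp t * (a t - a (t + ε))) := by ring
          _ ≤ _ := by have := han t; have := hmn t; gcongr
      have s4 := mul_le_mul_of_nonneg_left s3 (inv_pos.2 hε).le
      calc 4 * π * exp t * a (t + ε) ^ 2 = ε⁻¹ * (4 * π * ε * a (t + ε) ^ 2 * exp t) := by field_simp
        _ ≤ _ := s4
        _ = _ := by ring
    set e : ℕ → ℝ := fun n => 1 / ((n:ℝ) + 1) with he
    have he0 : Filter.Tendsto e Filter.atTop (nhds 0) := tendsto_one_div_add_atTop_nhds_zero_nat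
    have hepos : ∀ n, 0 < e n := fun n => by simp only [he]; positivity
    have heanti : Antitone e := fun n k hnk => by simp only [he]; gcongr
    have l1 : Filter.Tendsto (fun n => a (t + e n)) Filter.atTop (nhds (a t)) := by
      have hU' : (⋃ n, S (t + e n)) = S t := by
        apply Set.Subset.antisymm
        · exact Set.iUnion_subset fun n => hSanti _ _ (by linarith [hepos n])
        · intro y hy
          have : 0 < v y - t := by linarith [hy.2]
          obtain ⟨n, hn⟩ := ((tendsto_order.1 he0).2 _ this).exists
          exact Set.mem_iUnion.2 ⟨n, hy.1, by linarith⟩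
      have := tendsto_setIntegral_of_monotone (f := fun y => exp (h y)) (μ := volume) (fun n => hSm (t + e n))
        (fun n k hnk => hSanti _ _ (by linarith [heanti hnk])) (by rw [hU']; exact ieh _ (hSG _))
      rwa [hU'] at this
    have l2 : Filter.Tendsto (fun n => (e n)⁻¹ * (m (t + e n) - m t)) Filter.atTop (nhds m') := by
      have h1 := hasDerivAt_iff_tendsto_slope_zero.1 hm'
      exact h1.comp (tendsto_nhdsWithin_iff.2 ⟨he0, Filter.Eventually.of_forall fun n => (hepos n).ne'⟩)
    have l3 : 4 * π * exp t * a t ^ 2 ≤ a t * (m t * -m') :=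
      le_of_tendsto_of_tendsto' ((l1.pow 2).const_mul _) ((l2.neg.const_mul _).const_mul _)
        (fun n => hstep (e n) (hepos n))
    have : a t * (4 * π * exp t * a t) ≤ a t * (m t * -m') := by linarith [l3]
    exact le_of_mul_le_mul_left this h0
  -- boundedness of v
  obtain ⟨T, hT⟩ : ∃ T, ∀ y ∈ G, v y ≤ T := by
    obtain ⟨T, hT⟩ := (hcomp.image_of_continuousOn (hv.continuousOn.mono hGU)).bddAbove
    exact ⟨T, fun y hy => hT ⟨y, subset_closure hy, rfl⟩⟩
  -- main estimate
  have key : ∀ t : ℝ, 0 < t → m t - exp t * a t ≤ m t ^ 2 / (8 * π) := by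
    intro t ht
    set T' := max T t with hT'
    have htT : t ≤ T' := le_max_right _ _
    have k1 : ∫ s in t..T', 8 * π * (exp s * a s) ≤ (-(m T') ^ 2) - (-(m t) ^ 2) := by
      refine monotone_integral_le (F := fun s => -(m s) ^ 2) ?_ htT ?_ ?_
      · intro s s' hss
        have := hmanti hss
        have h2 := hmn s'
        simp only
        nlinarith [hmn s]
      · apply IntervalIntegrable.const_mul
        exact haanti.intervalIntegrable.continuousOn_mul (by fun_prop)
      · intro s hs F' hF'
        -- m itself is differentiable where m^2 is, or m s = 0
        rcases (hmn s).eq_or_lt with h0 | h0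
        · have ha0 : a s = 0 := by
            have e0 : ∫ y in S s, exp (w y) = 0 := h0.symm
            rw [setIntegral_eq_zero_iff_of_nonneg_ae (Filter.Eventually.of_forall fun y => (exp_pos _).le) (iew _ (hSG _))] at e0
            have : volume.restrict (S s) = 0 := by
              rw [← ae_eq_bot]
              by_contra hne
              have : (ae (volume.restrict (S s))).NeBot := ⟨hne⟩
              obtain ⟨y, hy⟩ := e0.exists
              exact (exp_pos _).ne' hy
            simp only [ha, this, integral_zero_measure]
          rw [ha0]
          have : Monotone fun s => -(m s) ^ 2 := by
            intro s s' hss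
            have := hmanti hss
            have h2 := hmn s'
            simp only
            nlinarith [hmn s]
          rw [← hF'.deriv]
          simpa using this.deriv_nonneg
        · have e1 : HasDerivAt (fun s => √((m s) ^ 2)) (-F' / (2 * √((m s) ^ 2))) s := by
            have h5 : HasDerivAt (fun s => (m s) ^ 2) (-F') s := by
              refine hF'.neg.congr_of_eventuallyEq (Filter.Eventually.of_forall fun x => ?_)
              simp
            exact h5.sqrt (by positivity)
          have e2 : (fun s => √((m s) ^ 2)) = m := funext fun s => Real.sqrt_sq (hmn s)
          rw [e2, Real.sqrt_sq (hmn s)] at e1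
          have e3 := hder s (ht.trans hs.1) _ e1
          have e4 : m s * -(-F' / (2 * m s)) = F' / 2 := by field_simp
          rw [e4] at e3
          linarith
    -- Fubini
    have k2 : ∫ s in t..T', exp s * a s = m t - exp t * a t := by
      set vv : ℂ → ℝ := G.indicator v with hvv
      have hvvm : Measurable vv := by
        classical
        rw [hvv, ← Set.piecewise_eq_indicator]
        exact hvG.measurable_piecewise continuousOn_const hG.measurableSet
      have e1 : ∀ s, exp s * a s = ∫ y in G, (if s < vv y then exp s * exp (h y) else 0) := by
        intro s
        simp only [ha]
        rw [← integral_const_mul, ← integral_indicator (hSm s), ← integral_indicator hG.measurableSet]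
        congr 1
        funext y
        by_cases hy : y ∈ G
        · rw [Set.indicator_of_mem hy, hvv, Set.indicator_of_mem hy]
          by_cases h2 : s < v y
          · rw [Set.indicator_of_mem (show y ∈ S s from ⟨hy, h2⟩), if_pos h2]
          · rw [Set.indicator_of_notMem (fun h : y ∈ S s => h2 h.2), if_neg h2]
        · rw [Set.indicator_of_notMem hy, Set.indicator_of_notMem (fun h => hy (hSG s h))]
      have hGfin : IsFiniteMeasure (volume.restrict G) :=
        ⟨by rw [Measure.restrict_apply_univ]; exact hbd.measure_lt_top⟩
      have h_intg : Integrable (Function.uncurry fun (s : ℝ) (y : ℂ) => if s < vv y then exp s * exp (h y) else 0)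
          ((volume.restrict (Set.Ioc t T')).prod (volume.restrict G)) := by
        obtain ⟨C, hC⟩ := (hcomp.image_of_continuousOn (hh.continuous.rexp).continuousOn).bddAbove
        have hms : Measurable (Function.uncurry fun (s : ℝ) (y : ℂ) => if s < vv y then exp s * exp (h y) else 0) := by
          apply Measurable.ite
          · exact measurableSet_lt measurable_fst (hvvm.comp measurable_snd)
          · have := hh.continuous.measurable
            fun_prop
          · fun_prop
        refine Integrable.of_bound hms.aestronglyMeasurable (exp T' * C) ?_
        rw [Measure.prod_restrict, ae_restrict_iff' (measurableSet_Ioc.prod hG.measurableSet)]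
        refine Filter.Eventually.of_forall fun p hp => ?_
        have hC1 : exp (h p.2) ≤ C := hC ⟨p.2, subset_closure hp.2, rfl⟩
        have hC2 : exp p.1 ≤ exp T' := exp_le_exp.2 hp.1.2
        simp only [Function.uncurry]
        split_ifs
        · rw [Real.norm_of_nonneg (by positivity)]
          gcongr
        · simp only [norm_zero]
          exact mul_nonneg (exp_pos _).le ((exp_pos _).le.trans hC1)
      rw [intervalIntegral.integral_of_le htT, integral_congr_ae (Filter.Eventually.of_forall e1)]
      rw [integral_integral_swap h_intg]
      have e2 : ∀ y ∈ G, ∫ s in Set.Ioc t T', (if s < vv y then exp s * exp (h y) else 0)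
          = (S t).indicator (fun y => exp (w y) - exp t * exp (h y)) y := by
        intro y hy
        have hvy : vv y = v y := Set.indicator_of_mem hy _
        have hvT : v y ≤ T' := (hT y hy).trans (le_max_left _ _)
        have : ∀ s, (if s < vv y then exp s * exp (h y) else 0) = (Set.Iio (v y)).indicator (fun s => exp s * exp (h y)) s := by
          intro s; rw [hvy]; rfl
        simp_rw [this]
        rw [setIntegral_indicator measurableSet_Iio]
        by_cases h2 : t < v y
        · rw [Set.indicator_of_mem (show y ∈ S t from ⟨hy, h2⟩)]
          have e3 : Set.Ioc t T' ∩ Set.Iio (v y) = Set.Ioo t (v y) := by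
            ext s; simp only [Set.mem_inter_iff, Set.mem_Ioc, Set.mem_Iio, Set.mem_Ioo]
            constructor
            · rintro ⟨⟨h1, h3⟩, h4⟩; exact ⟨h1, h4⟩
            · rintro ⟨h1, h4⟩; exact ⟨⟨h1, by linarith⟩, h4⟩
          rw [e3, ← integral_Ioc_eq_integral_Ioo, ← intervalIntegral.integral_of_le h2.le,
            intervalIntegral.integral_mul_const, integral_exp, hwv]
          ring
        · rw [Set.indicator_of_notMem (fun h : y ∈ S t => h2 h.2)]
          have e3 : Set.Ioc t T' ∩ Set.Iio (v y) = ∅ := by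
            ext s; simp only [Set.mem_inter_iff, Set.mem_Ioc, Set.mem_Iio, Set.mem_empty_iff_false, iff_false]
            rintro ⟨⟨h1, h3⟩, h4⟩; exact h2 (h1.trans h4)
          rw [e3]; simp
      rw [setIntegral_congr_fun hG.measurableSet e2, setIntegral_indicator (hSm t),
        Set.inter_eq_right.2 (hSG t), integral_sub (iew _ (hSG _)) ((ieh _ (hSG _)).const_mul _), integral_const_mul]
    rw [intervalIntegral.integral_const_mul, k2] at k1
    rw [le_div_iff₀ (by positivity)]
    nlinarith [sq_nonneg (m T')]
  -- conclusion
  set mG := ∫ y in G, exp (w y) with hmG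
  set aG := ∫ y in G, exp (h y) with haG
  have fin : ∀ t : ℝ, 0 < t → mG - mG ^ 2 / (8 * π) ≤ exp t * aG := by
    intro t ht
    have e1 : mG - m t = ∫ y in G \ S t, exp (w y) := (setIntegral_sdiff (hSm _) (iew _ le_rfl) (hSG t)).symm
    have e2 : aG - a t = ∫ y in G \ S t, exp (h y) := (setIntegral_sdiff (hSm _) (ieh _ le_rfl) (hSG t)).symm
    have e3 : mG - m t ≤ exp t * (aG - a t) := by
      rw [e1, e2, ← integral_const_mul]
      apply setIntegral_mono_on (iew _ Set.sdiff_subset) ((ieh _ Set.sdiff_subset).const_mul _) 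
        (hG.measurableSet.diff (hSm _))
      intro y hy
      rw [hwv]
      gcongr
      by_contra h2
      exact hy.2 ⟨hy.1, not_le.1 h2⟩
    have e4 : m t ≤ mG := setIntegral_mono_set (iew _ le_rfl) 
      (Filter.Eventually.of_forall fun y => (exp_pos _).le) (Filter.Eventually.of_forall (hSG t))
    have e5 : m t ^ 2 / (8 * π) ≤ mG ^ 2 / (8 * π) := by
      have := hmn t
      gcongr
    have := key t ht
    linarith
  have hc : Filter.Tendsto (fun t : ℝ => exp t * aG) (nhdsWithin 0 (Set.Ioi 0)) (nhds (exp 0 * aG)) := by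
    apply tendsto_nhdsWithin_of_tendsto_nhds
    apply Continuous.tendsto
    fun_prop
  rw [Real.exp_zero, one_mul] at hc
  refine ge_of_tendsto hc ?_
  filter_upwards [self_mem_nhdsWithin] with t ht
  exact fin t ht

theorem hb_ext {E : Type*} [AddCommGroup E] [Module ℝ E] (D : Submodule ℝ E) (l : E →ₗ[ℝ] ℝ)
    (N : E → ℝ) (Nh : ∀ c : ℝ, 0 < c → ∀ x, N (c • x) = c * N x)
    (Na : ∀ x y, N (x + y) ≤ N x + N y) (hD : ∀ x ∈ D, l x ≤ N x) :
    ∃ L : E →ₗ[ℝ] ℝ, (∀ x ∈ D, L x = l x) ∧ ∀ x, L x ≤ N x := by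
  obtain ⟨g, hg1, hg2⟩ := exists_extension_of_le_sublinear
    (⟨D, l.comp D.subtype⟩ : E →ₗ.[ℝ] ℝ) N Nh Na (fun x => hD x.1 x.2)
  exact ⟨g, fun x hx => hg1 ⟨x, hx⟩, hg2⟩

theorem rmk_ext {K : Set ℂ} (hK : IsCompact K) (L : C(K, ℝ) →ₗ[ℝ] ℝ)
    (hL : ∀ f : C(K, ℝ), 0 ≤ f → 0 ≤ L f) :
    ∃ ν : Measure ℂ, IsFiniteMeasure ν ∧ ν Kᶜ = 0 ∧
      ∀ f : C(ℂ, ℝ), ∫ x, f x ∂ν = L (f.restrict K) := by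
  have : CompactSpace K := isCompact_iff_compactSpace.mp hK
  let Λ : CompactlySupportedContinuousMap K ℝ →ₚ[ℝ] ℝ := PositiveLinearMap.mk₀
    ({ toFun := fun f => L (f : C(K, ℝ))
       map_add' := fun f g => L.map_add _ _
       map_smul' := fun c f => L.map_smul c (f : C(K, ℝ)) } ) (fun f hf => hL _ hf)
  refine ⟨(RealRMK.rieszMeasure Λ).map Subtype.val, inferInstance, ?_, fun f => ?_⟩
  · rw [Measure.map_apply (by fun_prop) hK.measurableSet.compl]
    simp
  · rw [integral_map (φ := Subtype.val) (by fun_prop) (by fun_prop)]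
    exact RealRMK.integral_rieszMeasure Λ
      (CompactlySupportedContinuousMap.continuousMapEquiv (f.restrict K))

theorem pos_norm_nonneg {X : Type*} [TopologicalSpace X] [CompactSpace X] (f : C(X, ℝ)) (x : X) :
    f x ≤ ‖f ⊔ 0‖ := by
  have := (f ⊔ 0).norm_coe_le_norm x
  rw [Real.norm_eq_abs] at this
  have h2 := le_abs_self ((f ⊔ 0) x)
  have h3 : f x ≤ (f ⊔ 0) x := by simp
  linarith

theorem pos_norm_le {X : Type*} [TopologicalSpace X] [CompactSpace X] (f : C(X, ℝ)) (c : ℝ)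
    (hc : 0 ≤ c) (h : ∀ x, f x ≤ c) : ‖f ⊔ 0‖ ≤ c := by
  rw [ContinuousMap.norm_le _ hc]
  intro x
  rw [Real.norm_eq_abs, abs_of_nonneg (by simp)]
  simp [h x, hc]

theorem pos_norm_smul {X : Type*} [TopologicalSpace X] [CompactSpace X] (f : C(X, ℝ)) (c : ℝ)
    (hc : 0 < c) : ‖(c • f) ⊔ 0‖ = c * ‖f ⊔ 0‖ := by
  have : (c • f) ⊔ 0 = c • (f ⊔ 0) := by
    ext x
    simp only [ContinuousMap.sup_apply, ContinuousMap.coe_smul, Pi.smul_apply, smul_eq_mul,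
      ContinuousMap.zero_apply]
    rw [mul_max_of_nonneg _ _ hc.le, mul_zero]
  rw [this, norm_smul, Real.norm_eq_abs, abs_of_pos hc]

theorem pos_norm_add {X : Type*} [TopologicalSpace X] [CompactSpace X] (f g : C(X, ℝ)) :
    ‖(f + g) ⊔ 0‖ ≤ ‖f ⊔ 0‖ + ‖g ⊔ 0‖ :=
  pos_norm_le _ _ (by positivity) fun x => add_le_add (pos_norm_nonneg f x) (pos_norm_nonneg g x)

theorem pos_of_le {X : Type*} [TopologicalSpace X] [CompactSpace X] (L : C(X, ℝ) →ₗ[ℝ] ℝ) (M : ℝ)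
    (h : ∀ f, L f ≤ M * ‖f ⊔ 0‖) (f : C(X, ℝ)) (hf : 0 ≤ f) : 0 ≤ L f := by
  have := h (-f)
  have h2 : (-f) ⊔ 0 = 0 := sup_eq_right.mpr (by simpa using hf)
  rw [h2] at this
  simp at this
  exact this

/-- Real parts of polynomials, restricted to `K`. -/
def rePoly (K : Set ℂ) : Polynomial ℂ →ₗ[ℝ] C(K, ℝ) where
  toFun P := ⟨fun x => (P.eval (x : ℂ)).re, by fun_prop⟩
  map_add' P Q := by ext x; simp
  map_smul' c P := by ext x; simp

/-- A continuous function not approximable by real parts of polynomials gives two measures. -/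
theorem two_measures {K : Set ℂ} (hK : IsCompact K) (ψ : C(ℂ, ℝ)) (ε : ℝ) (hε : 0 < ε)
    (hno : ∀ P : Polynomial ℂ, ∃ x ∈ K, ε < |(P.eval x).re - ψ x|) :
    ∃ ν₁ ν₂ : Measure ℂ, IsFiniteMeasure ν₁ ∧ IsFiniteMeasure ν₂ ∧ ν₁ Kᶜ = 0 ∧ ν₂ Kᶜ = 0 ∧
      (∀ P : Polynomial ℂ, ∫ x, (P.eval x).re ∂ν₁ = ∫ x, (P.eval x).re ∂ν₂) ∧
      ∫ x, ψ x ∂ν₁ ≠ ∫ x, ψ x ∂ν₂ := by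
  have : CompactSpace K := isCompact_iff_compactSpace.mp hK
  have hcl : ψ.restrict K ∉ closure ((LinearMap.range (rePoly K) : Submodule ℝ C(K, ℝ)) : Set C(K, ℝ)) := by
    intro hmem
    obtain ⟨g, ⟨P, rfl⟩, hg⟩ := Metric.mem_closure_iff.mp hmem ε hε
    obtain ⟨x, hx, hxε⟩ := hno P
    have := ContinuousMap.dist_apply_le_dist (f := ψ.restrict K) (g := rePoly K P) ⟨x, hx⟩
    rw [Real.dist_eq, abs_sub_comm] at this
    have h3 : |(P.eval x).re - ψ x| ≤ dist (ψ.restrict K) (rePoly K P) := this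
    linarith
  obtain ⟨l, a, hl1, hl2⟩ := geometric_hahn_banach_closed_point
    ((LinearMap.range (rePoly K)).convex.closure) isClosed_closure hcl
  have hl0 : ∀ P, l (rePoly K P) = 0 := by
    intro P
    by_contra hne
    have ha : 0 < a := by
      have := hl1 0 (subset_closure (Submodule.zero_mem _))
      simpa using this
    have := hl1 (((a + 1) / l (rePoly K P)) • rePoly K P)
      (subset_closure (Submodule.smul_mem _ _ ⟨P, rfl⟩))
    rw [map_smul, smul_eq_mul, div_mul_cancel₀ _ hne] at this
    linarith
  have hlψ : 0 < l (ψ.restrict K) := by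
    have := hl1 0 (subset_closure (Submodule.zero_mem _))
    simp at this
    linarith
  let N : C(K, ℝ) × C(K, ℝ) → ℝ := fun p => ‖l‖ * (‖p.1 ⊔ 0‖ + ‖p.2 ⊔ 0‖)
  obtain ⟨L, hL1, hL2⟩ := hb_ext
    (LinearMap.ker (LinearMap.fst ℝ C(K, ℝ) C(K, ℝ) + LinearMap.snd ℝ C(K, ℝ) C(K, ℝ)))
    ((l : C(K, ℝ) →ₗ[ℝ] ℝ).comp (LinearMap.fst ℝ C(K, ℝ) C(K, ℝ))) N
    (by
      intro c hc p
      simp only [N, Prod.smul_fst, Prod.smul_snd]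
      rw [pos_norm_smul _ _ hc, pos_norm_smul _ _ hc]; ring)
    (by
      intro p q
      simp only [N, Prod.fst_add, Prod.snd_add]
      rw [← mul_add]
      refine mul_le_mul_of_nonneg_left ?_ l.opNorm_nonneg
      linarith [pos_norm_add p.1 q.1, pos_norm_add p.2 q.2])
    (by
      intro p hp
      have hp' : p.2 = -p.1 := by
        have : p.1 + p.2 = 0 := by simpa using hp
        exact (neg_eq_of_add_eq_zero_right this).symm
      simp only [N, LinearMap.comp_apply, LinearMap.fst_apply]
      refine (le_abs_self _).trans ((l.le_opNorm p.1).trans ?_)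
      refine mul_le_mul_of_nonneg_left ?_ l.opNorm_nonneg
      rw [ContinuousMap.norm_le _ (by positivity)]
      intro x
      rw [Real.norm_eq_abs, abs_le, hp']
      have h1 := pos_norm_nonneg p.1 x
      have h2 := pos_norm_nonneg (-p.1) x
      simp only [ContinuousMap.neg_apply] at h2
      constructor <;> linarith [norm_nonneg (p.1 ⊔ 0), norm_nonneg (-p.1 ⊔ 0)])
  obtain ⟨ν₁, hf1, hn1, hi1⟩ := rmk_ext hK (L.comp (LinearMap.inl ℝ _ _))
    (pos_of_le _ ‖l‖ (fun f => by simpa [N] using hL2 (f, 0)))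
  obtain ⟨ν₂, hf2, hn2, hi2⟩ := rmk_ext hK (L.comp (LinearMap.inr ℝ _ _))
    (pos_of_le _ ‖l‖ (fun f => by simpa [N] using hL2 (0, f)))
  have key : ∀ f : C(ℂ, ℝ), ∫ x, f x ∂ν₁ - ∫ x, f x ∂ν₂ = l (f.restrict K) := by
    intro f
    rw [hi1, hi2]
    have := hL1 (f.restrict K, -f.restrict K) (by simp)
    have h2 : (f.restrict K, -f.restrict K) = LinearMap.inl ℝ C(K, ℝ) C(K, ℝ) (f.restrict K)
      - LinearMap.inr ℝ C(K, ℝ) C(K, ℝ) (f.restrict K) := by simp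
    rw [h2, map_sub] at this
    rw [LinearMap.comp_apply, LinearMap.comp_apply, this]
    simp
  refine ⟨ν₁, ν₂, hf1, hf2, hn1, hn2, fun P => ?_, fun h => ?_⟩
  · have := key ⟨fun x => (P.eval x).re, by fun_prop⟩
    have h2 : l ((⟨fun x => (P.eval x).re, by fun_prop⟩ : C(ℂ, ℝ)).restrict K) = 0 := hl0 P
    rw [h2] at this
    simpa using sub_eq_zero.mp this
  · have := key ψ
    rw [h, sub_self] at this
    linarith

/-- Jensen-type measures. -/
theorem jensen_measure {K G : Set ℂ} (hK : IsCompact K)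
    (hbd : Bornology.IsBounded G) (hfr : frontier G ⊆ K) (z : ℂ) (hz : z ∈ G) :
    ∃ μ : Measure ℂ, IsFiniteMeasure μ ∧ μ Kᶜ = 0 ∧
      (∀ P : Polynomial ℂ, ∫ x, (P.eval x).re ∂μ = (P.eval z).re) := by
  have : CompactSpace K := isCompact_iff_compactSpace.mp hK
  let N : Polynomial ℂ × C(K, ℝ) → ℝ := fun p => ‖(rePoly K p.1 + p.2) ⊔ 0‖
  let ev : Polynomial ℂ →ₗ[ℝ] ℝ :=
    { toFun := fun P => (P.eval z).re
      map_add' := fun P Q => by simp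
      map_smul' := fun c P => by simp }
  obtain ⟨L, hL1, hL2⟩ := hb_ext
    (LinearMap.ker (LinearMap.snd ℝ (Polynomial ℂ) C(K, ℝ)))
    (ev.comp (LinearMap.fst ℝ (Polynomial ℂ) C(K, ℝ))) N
    (by
      intro c hc p
      simp only [N, Prod.smul_fst, Prod.smul_snd]
      rw [map_smul, ← smul_add, pos_norm_smul _ _ hc])
    (by
      intro p q
      simp only [N, Prod.fst_add, Prod.snd_add]
      rw [map_add, add_add_add_comm]
      exact pos_norm_add _ _)
    (by
      intro p hp
      have hp' : p.2 = 0 := by simpa using hp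
      simp only [N, LinearMap.comp_apply, LinearMap.fst_apply, hp', add_zero]
      have := Complex.norm_le_of_forall_mem_frontier_norm_le hbd
        (f := fun x => Complex.exp (p.1.eval x)) (C := Real.exp ‖rePoly K p.1 ⊔ 0‖)
        (Differentiable.diffContOnCl (by fun_prop))
        (by
          intro x hx
          rw [Complex.norm_exp]
          exact Real.exp_le_exp.mpr (pos_norm_nonneg (rePoly K p.1) ⟨x, hfr hx⟩))
        (subset_closure hz)
      rw [Complex.norm_exp] at this
      exact Real.exp_le_exp.mp this)
  obtain ⟨μ, hf, hn, hi⟩ := rmk_ext hK (L.comp (LinearMap.inr ℝ _ _))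
    (pos_of_le _ 1 (fun f => by simpa [N] using hL2 (0, f)))
  refine ⟨μ, hf, hn, fun P => ?_⟩
  have h1 := hi ⟨fun x => (P.eval x).re, by fun_prop⟩
  simp only [ContinuousMap.coe_mk] at h1
  rw [h1]
  have h2 : (⟨fun x => (P.eval x).re, by fun_prop⟩ : C(ℂ, ℝ)).restrict K = rePoly K P := rfl
  rw [h2, LinearMap.comp_apply]
  have h3 := hL2 (P, -rePoly K P)
  have h4 := hL2 (-P, rePoly K P)
  have h5 := hL1 (P, 0) (by simp)
  have e1 : (P, -rePoly K P) = (P, (0 : C(K, ℝ))) - LinearMap.inr ℝ _ _ (rePoly K P) := by simp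
  have e2 : (-P, rePoly K P) = LinearMap.inr ℝ _ _ (rePoly K P) - (P, (0 : C(K, ℝ))) := by simp
  simp only [N, add_neg_cancel, map_neg, neg_add_cancel] at h3 h4
  rw [e1, map_sub, h5] at h3
  rw [e2, map_sub, h5] at h4
  simp [ev] at h3 h4
  simp only [LinearMap.inr_apply]
  linarith

/-- logarithmic potential -/
def pot (ν : Measure ℂ) (z : ℂ) : ℝ := ∫ y, Real.log ‖z - y‖ ∂ν

theorem integrable_of_contOn {E : Type*} [NormedAddCommGroup E] {K : Set ℂ} (hK : IsCompact K)
    {ν : Measure ℂ} [IsFiniteMeasure ν] (hν : ν Kᶜ = 0) {f : ℂ → E} (hf : ContinuousOn f K) :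
    Integrable f ν := by
  have h1 : ν.restrict K = ν := Measure.restrict_eq_self_of_ae_mem (by simpa [ae_iff] using! hν)
  have h2 : IntegrableOn f K ν := hf.integrableOn_compact hK
  rwa [IntegrableOn, h1] at h2

theorem ae_mem_of_null {K : Set ℂ} {ν : Measure ℂ} (hν : ν Kᶜ = 0) : ∀ᵐ y ∂ν, y ∈ K := by
  simpa [ae_iff] using! hν

theorem pot_local {K : Set ℂ} (hK : IsCompact K) (ν : Measure ℂ) [IsFiniteMeasure ν]
    (hν : ν Kᶜ = 0) (z₀ : ℂ) (hz : z₀ ∉ K) :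
    ∃ (F : ℂ → ℂ) (r : ℝ), 0 < r ∧ ∀ z ∈ Metric.ball z₀ r,
      HasDerivAt F (∫ y, (z - y)⁻¹ ∂ν) z ∧ pot ν z = (F z).re := by
  obtain ⟨d, hd, hdK⟩ : ∃ d > 0, ∀ y ∈ K, d ≤ ‖z₀ - y‖ := by
    obtain ⟨d, hd, h⟩ := Metric.isOpen_iff.mp hK.isClosed.isOpen_compl z₀ hz
    refine ⟨d, hd, fun y hy => ?_⟩
    by_contra hlt
    push Not at hlt
    exact h (by rw [Metric.mem_ball, dist_comm, dist_eq_norm]; exact hlt) hy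
  have hr : 0 < d / 2 := by positivity
  have hlow : ∀ y ∈ K, ∀ z ∈ Metric.ball z₀ (d/2), d / 2 ≤ ‖z - y‖ := by
    intro y hy z hz
    have h1 := hdK y hy
    have h2 : ‖z₀ - y‖ ≤ ‖z - z₀‖ + ‖z - y‖ := by
      rw [← norm_neg (z - z₀)]
      calc ‖z₀ - y‖ = ‖-(z - z₀) + (z - y)‖ := by congr 1; ring
        _ ≤ _ := norm_add_le _ _
    rw [Metric.mem_ball, dist_eq_norm] at hz
    linarith
  have hslit : ∀ y ∈ K, ∀ z ∈ Metric.ball z₀ (d/2), (z - y) / (z₀ - y) ∈ Complex.slitPlane := by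
    intro y hy z hz
    have h0 : z₀ - y ≠ 0 := by
      intro h; have := hdK y hy; rw [h, norm_zero] at this; linarith
    apply Complex.mem_slitPlane_of_norm_lt_one (z := (z - y) / (z₀ - y) - 1) _ |> fun h => by
      simpa using h
    have : (z - y) / (z₀ - y) - 1 = (z - z₀) / (z₀ - y) := by field_simp; ring
    rw [this, norm_div, div_lt_one (norm_pos_iff.mpr h0)]
    rw [Metric.mem_ball, dist_eq_norm] at hz
    linarith [hdK y hy]
  let F : ℂ → ℂ → ℂ := fun z y => Complex.log ((z - y) / (z₀ - y)) + (Real.log ‖z₀ - y‖ : ℝ)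
  have hne : ∀ y ∈ K, z₀ - y ≠ 0 := fun y hy h => by
    have := hdK y hy; rw [h, norm_zero] at this; linarith
  have h_intg : ∀ z ∈ Metric.ball z₀ (d/2), Integrable (F z) ν := by
    intro z hz
    refine integrable_of_contOn hK hν ?_
    refine ContinuousOn.add ?_ ?_
    · refine ContinuousOn.clog ?_ (fun y hy => hslit y hy z hz)
      exact ContinuousOn.div (by fun_prop) (by fun_prop) hne
    · refine Complex.continuous_ofReal.comp_continuousOn ?_
      exact ContinuousOn.log (by fun_prop) (fun y hy => norm_ne_zero_iff.mpr (hne y hy))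
  refine ⟨fun z => ∫ y, F z y ∂ν, d / 2, hr, fun z hz => ⟨?_, ?_⟩⟩
  · have hnb : Metric.ball z₀ (d/2) ∈ nhds z := Metric.isOpen_ball.mem_nhds hz
    refine (hasDerivAt_integral_of_dominated_loc_of_deriv_le (F' := fun z y => (z - y)⁻¹)
      (bound := fun _ => (d/2)⁻¹) hnb ?_ (h_intg z hz) ?_ ?_ (integrable_const _) ?_).2
    · filter_upwards [hnb] with z hz using (h_intg z hz).aestronglyMeasurable
    · exact (by fun_prop : Measurable fun y => (z - y)⁻¹).aestronglyMeasurable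
    · filter_upwards [ae_mem_of_null hν] with y hy x hx
      rw [norm_inv]
      exact inv_anti₀ hr (hlow y hy x hx)
    · filter_upwards [ae_mem_of_null hν] with y hy x hx
      have h1 : HasDerivAt (fun x : ℂ => (x - y) / (z₀ - y)) (1 / (z₀ - y)) x :=
        ((hasDerivAt_id x).sub_const y).div_const _
      have h2 := (h1.clog (hslit y hy x hx)).add_const ((Real.log ‖z₀ - y‖ : ℝ) : ℂ)
      have hx0 : x - y ≠ 0 := by
        intro h; have := hlow y hy x hx; rw [h, norm_zero] at this; linarith
      convert h2 using 1
      have := hne y hy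
      field_simp
  · rw [pot]
    have h1 : (∫ y, F z y ∂ν).re = ∫ y, (F z y).re ∂ν := by
      have := integral_re (h_intg z hz)
      simpa using this.symm
    rw [h1]
    refine integral_congr_ae ?_
    filter_upwards [ae_mem_of_null hν] with y hy
    have hx0 : ‖z - y‖ ≠ 0 := by have := hlow y hy z hz; linarith
    have hx1 : ‖z₀ - y‖ ≠ 0 := norm_ne_zero_iff.mpr (hne y hy)
    simp only [F, Complex.add_re, Complex.log_re, Complex.ofReal_re, norm_div]
    rw [Real.log_div hx0 hx1]; ring

theorem pot_analyticAt {K : Set ℂ} (hK : IsCompact K) (ν : Measure ℂ) [IsFiniteMeasure ν]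
    (hν : ν Kᶜ = 0) (z₀ : ℂ) (hz : z₀ ∉ K) : AnalyticAt ℝ (pot ν) z₀ := by
  obtain ⟨F, r, hr, h⟩ := pot_local hK ν hν z₀ hz
  have hb : Metric.ball z₀ r ∈ nhds z₀ := Metric.ball_mem_nhds _ hr
  have h1 : AnalyticAt ℂ F z₀ :=
    DifferentiableOn.analyticAt (s := Metric.ball z₀ r)
      (fun z hz => (h z hz).1.differentiableAt.differentiableWithinAt) hb
  have h2 : AnalyticAt ℝ (fun z => (F z).re) z₀ :=
    (Complex.reCLM.analyticAt _).comp h1.restrictScalars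
  refine h2.congr ?_
  filter_upwards [hb] with z hz using (h z hz).2.symm

theorem pot_hasFDerivAt {K : Set ℂ} (hK : IsCompact K) (ν : Measure ℂ) [IsFiniteMeasure ν]
    (hν : ν Kᶜ = 0) (z : ℂ) (hz : z ∉ K) :
    HasFDerivAt (pot ν) (Complex.reCLM.comp (mulL (∫ y, (z - y)⁻¹ ∂ν))) z := by
  obtain ⟨F, r, hr, h⟩ := pot_local hK ν hν z hz
  have hb : Metric.ball z r ∈ nhds z := Metric.ball_mem_nhds _ hr
  have h1 := hasFDerivAt_mulL (h z (Metric.mem_ball_self hr)).1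
  have h2 := Complex.reCLM.hasFDerivAt.comp z h1
  refine h2.congr_of_eventuallyEq ?_
  filter_upwards [hb] with z hz using (h z hz).2

theorem pot_far {R : ℝ} (hR : 0 < R) (ν : Measure ℂ) [IsFiniteMeasure ν]
    (hν : ν (Metric.closedBall 0 R)ᶜ = 0) (z : ℂ) (hz : R < ‖z‖) :
    HasSum (fun n : ℕ => ∫ y, ((y / z) ^ n / n).re ∂ν)
      ((∫ _, Real.log ‖z‖ ∂ν) - pot ν z) := by
  have hK : IsCompact (Metric.closedBall (0:ℂ) R) := isCompact_closedBall _ _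
  have hz0 : z ≠ 0 := by
    rintro rfl; simp at hz; linarith
  have hzp : 0 < ‖z‖ := norm_pos_iff.mpr hz0
  have hq : ∀ y ∈ Metric.closedBall (0:ℂ) R, ‖y / z‖ ≤ R / ‖z‖ := by
    intro y hy
    rw [norm_div]
    have : ‖y‖ ≤ R := by simpa using hy
    gcongr
  have hq1 : R / ‖z‖ < 1 := by rw [div_lt_one hzp]; exact hz
  have hq0 : 0 ≤ R / ‖z‖ := by positivity
  have h_intg : ∀ n : ℕ, Integrable (fun y : ℂ => ((y / z) ^ n / n).re) ν := fun n =>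
    integrable_of_contOn hK hν (Complex.continuous_re.comp (by fun_prop)).continuousOn
  have hbd : ∀ n : ℕ, ∀ y ∈ Metric.closedBall (0:ℂ) R, ‖((y / z) ^ n / n).re‖ ≤ (R / ‖z‖) ^ n := by
    intro n y hy
    refine (Complex.abs_re_le_norm _).trans ?_
    rw [norm_div, norm_pow]
    have h1 : ‖y / z‖ ^ n ≤ (R / ‖z‖) ^ n := pow_le_pow_left₀ (norm_nonneg _) (hq y hy) n
    rcases n.eq_zero_or_pos with rfl | hn
    · simp
    · refine (div_le_self (by positivity) ?_).trans h1
      simp only [RCLike.norm_natCast]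
      exact_mod_cast hn
  have hs : Summable fun n : ℕ => ∫ y, ‖((y / z) ^ n / n).re‖ ∂ν := by
    refine Summable.of_nonneg_of_le (fun n => integral_nonneg fun y => norm_nonneg _) (fun n => ?_)
      ((summable_geometric_of_lt_one hq0 hq1).mul_left (∫ _, (1:ℝ) ∂ν))
    rw [← integral_mul_const]
    refine integral_mono_ae (h_intg n).norm (by fun_prop) ?_
    filter_upwards [ae_mem_of_null hν] with y hy
    simpa using hbd n y hy
  have := hasSum_integral_of_summable_integral_norm h_intg hs
  suffices hgoal : (∫ _, Real.log ‖z‖ ∂ν) - pot ν z = ∫ y, ∑' n : ℕ, ((y / z) ^ n / n).re ∂ν by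
    rw [hgoal]; exact this
  have hzy : ∀ y ∈ Metric.closedBall (0:ℂ) R, z - y ≠ 0 := by
    intro y hy h
    have : z = y := sub_eq_zero.mp h
    rw [this] at hz
    have h2 : ‖y‖ ≤ R := by simpa using hy
    linarith
  simp only [pot]
  rw [← integral_sub (integrable_const _) (integrable_of_contOn hK hν
    (ContinuousOn.log (by fun_prop) (fun y hy => norm_ne_zero_iff.mpr (hzy y hy))))]
  refine integral_congr_ae ?_
  filter_upwards [ae_mem_of_null hν] with y hy
  have h1 := (Complex.hasSum_taylorSeries_neg_log (z := y / z) ((hq y hy).trans_lt hq1))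
  have h2 := (Complex.hasSum_re h1).tsum_eq
  rw [h2, Complex.neg_re, Complex.log_re]
  have : 1 - y / z = (z - y) / z := by field_simp
  rw [this, norm_div, Real.log_div (norm_ne_zero_iff.mpr (hzy y hy)) hzp.ne']
  ring

theorem pot_eq_outside {K : Set ℂ} (hK : IsCompact K) (hV : IsPreconnected Kᶜ)
    (ν₁ ν₂ : Measure ℂ) [IsFiniteMeasure ν₁] [IsFiniteMeasure ν₂] (h₁ : ν₁ Kᶜ = 0) (h₂ : ν₂ Kᶜ = 0)
    (hP : ∀ P : Polynomial ℂ, ∫ x, (P.eval x).re ∂ν₁ = ∫ x, (P.eval x).re ∂ν₂) (z : ℂ)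
    (hz : z ∉ K) : pot ν₁ z = pot ν₂ z := by
  obtain ⟨R, hR, hKR⟩ : ∃ R > 0, K ⊆ Metric.closedBall 0 R := by
    obtain ⟨R, hR⟩ := hK.isBounded.subset_closedBall (0:ℂ)
    exact ⟨max R 1, by positivity, hR.trans (Metric.closedBall_subset_closedBall (le_max_left _ _))⟩
  have hfar : ∀ z : ℂ, R < ‖z‖ → pot ν₁ z = pot ν₂ z := by
    intro z hz
    have a1 := pot_far hR ν₁ (measure_mono_null (Set.compl_subset_compl.mpr hKR) h₁) z hz
    have a2 := pot_far hR ν₂ (measure_mono_null (Set.compl_subset_compl.mpr hKR) h₂) z hz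
    have e : (fun n : ℕ => ∫ y, ((y / z) ^ n / n).re ∂ν₁) =
        fun n : ℕ => ∫ y, ((y / z) ^ n / n).re ∂ν₂ := by
      funext n
      have := hP (Polynomial.C (1 / z ^ n / n) * Polynomial.X ^ n)
      simp only [Polynomial.eval_mul, Polynomial.eval_C, Polynomial.eval_pow,
        Polynomial.eval_X] at this
      convert this using 3 <;> (rename_i y; congr 1; rw [div_pow]; ring)
    rw [e] at a1
    have e2 := a1.unique a2
    have e3 := hP (Polynomial.C (Real.log ‖z‖ : ℂ))
    simp only [Polynomial.eval_C, Complex.ofReal_re] at e3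
    linarith
  have hz₁ : R < ‖((R + 1 : ℝ) : ℂ)‖ := by
    rw [Complex.norm_real, Real.norm_eq_abs, abs_of_pos (by positivity)]; linarith
  refine AnalyticOnNhd.eqOn_of_preconnected_of_eventuallyEq
    (fun z hz => pot_analyticAt hK ν₁ h₁ z hz) (fun z hz => pot_analyticAt hK ν₂ h₂ z hz) hV
    (z₀ := ((R + 1 : ℝ) : ℂ)) ?_ ?_ hz
  · intro hmem
    have := hKR hmem
    rw [mem_closedBall_zero_iff] at this
    linarith
  · filter_upwards [(isOpen_lt continuous_const continuous_norm).mem_nhds hz₁] with z hz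
      using hfar z hz

theorem log_upper {K : Set ℂ} (hK : IsCompact K) {xs : ℕ → ℂ} {x : ℂ}
    (hx : Filter.Tendsto xs Filter.atTop (nhds x)) :
    ∃ L : ℝ, 0 ≤ L ∧ ∀ y ∈ K, Real.log ‖x - y‖ ≤ L ∧ ∀ n, Real.log ‖xs n - y‖ ≤ L := by
  obtain ⟨R, hR⟩ := hK.isBounded.subset_closedBall (0:ℂ)
  obtain ⟨S, hS⟩ := (Metric.isBounded_range_of_tendsto xs hx).subset_closedBall (0:ℂ)
  have key : ∀ r : ℝ, 0 ≤ r → r ≤ |S| + ‖x‖ + |R| → Real.log r ≤ |S| + ‖x‖ + |R| := by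
    intro r hr h
    rcases hr.eq_or_lt with h0 | h0
    · rw [← h0, Real.log_zero]; positivity
    · linarith [Real.log_le_sub_one_of_pos h0]
  refine ⟨|S| + ‖x‖ + |R|, by positivity, fun y hy => ?_⟩
  have hy' : ‖y‖ ≤ |R| := by
    have := hR hy; rw [mem_closedBall_zero_iff] at this; exact this.trans (le_abs_self R)
  refine ⟨key _ (norm_nonneg _) ?_, fun n => key _ (norm_nonneg _) ?_⟩
  · have := norm_sub_le x y; have := abs_nonneg S; linarith
  · have h1 := norm_sub_le (xs n) y
    have h2 : ‖xs n‖ ≤ |S| := by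
      have := hS ⟨n, rfl⟩; rw [mem_closedBall_zero_iff] at this; exact this.trans (le_abs_self S)
    have := norm_nonneg x; linarith

theorem integrable_log_off {K : Set ℂ} (hK : IsCompact K) (ν : Measure ℂ) [IsFiniteMeasure ν]
    (hν : ν Kᶜ = 0) (z : ℂ) (hz : z ∉ K) : Integrable (fun y => Real.log ‖z - y‖) ν :=
  integrable_of_contOn hK hν (ContinuousOn.log (by fun_prop) (fun y hy => by
    rw [norm_ne_zero_iff, sub_ne_zero]; rintro rfl; exact hz hy))

theorem measurable_log_norm_sub (x : ℂ) : Measurable (fun y : ℂ => Real.log ‖x - y‖) :=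
  Real.measurable_log.comp (by fun_prop)

theorem pot_fatou {K : Set ℂ} (hK : IsCompact K) (ν : Measure ℂ) [IsFiniteMeasure ν]
    (hν : ν Kᶜ = 0) {xs : ℕ → ℂ} {x : ℂ} (hx : Filter.Tendsto xs Filter.atTop (nhds x))
    (hxK : ∀ n, xs n ∉ K) (hxin : x ∈ K) (M : ℝ) (hM : ∀ n, M ≤ pot ν (xs n)) :
    ν {x} = 0 ∧ Integrable (fun y => Real.log ‖x - y‖) ν := by
  obtain ⟨L, hL0, hL⟩ := log_upper hK hx
  have hne : ∀ n, 0 < ‖xs n - x‖ := fun n => by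
    rw [norm_pos_iff, sub_ne_zero]; intro h; exact hxK n (h ▸ hxin)
  let g : ℕ → ℂ → ENNReal := fun n y => ENNReal.ofReal (L - Real.log ‖xs n - y‖)
  have hgm : ∀ n, Measurable (g n) := fun n =>
    ENNReal.measurable_ofReal.comp ((measurable_log_norm_sub _).const_sub _)
  have hfat := lintegral_liminf_le (μ := ν) (u := Filter.atTop) hgm
  have hb : ∀ n, ∫⁻ y, g n y ∂ν ≤ ENNReal.ofReal ((∫ _, L ∂ν) - M) := by
    intro n
    have hi := integrable_log_off hK ν hν (xs n) (hxK n)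
    have hi2 : Integrable (fun y => L - Real.log ‖xs n - y‖) ν := (integrable_const L).sub hi
    simp only [g]
    rw [← ofReal_integral_eq_lintegral_ofReal hi2]
    · apply ENNReal.ofReal_le_ofReal
      rw [integral_sub (integrable_const L) hi]
      have := hM n
      simp only [pot] at this
      linarith
    · filter_upwards [ae_mem_of_null hν] with y hy
      have := (hL y hy).2 n
      simp only [Pi.zero_apply]
      linarith
  have hlt : ∫⁻ y, Filter.liminf (fun n => g n y) Filter.atTop ∂ν < ⊤ := by
    refine hfat.trans_lt (lt_of_le_of_lt ?_ (ENNReal.ofReal_lt_top (r := (∫ _, L ∂ν) - M)))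
    refine (Filter.liminf_le_liminf (Filter.Eventually.of_forall hb)).trans ?_
    simp
  have hliy : ∀ y, y ≠ x → Filter.liminf (fun n => g n y) Filter.atTop
      = ENNReal.ofReal (L - Real.log ‖x - y‖) := by
    intro y hy
    apply Filter.Tendsto.liminf_eq
    apply (ENNReal.continuous_ofReal.tendsto _).comp
    refine Filter.Tendsto.const_sub _ ?_
    refine Filter.Tendsto.log ((hx.sub_const y).norm) ?_
    rw [norm_ne_zero_iff, sub_ne_zero]; exact hy.symm
  have hlix : Filter.liminf (fun n => g n x) Filter.atTop = ⊤ := by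
    apply Filter.Tendsto.liminf_eq
    refine ENNReal.tendsto_ofReal_atTop.comp ?_
    have h1 : Filter.Tendsto (fun n => ‖xs n - x‖) Filter.atTop (nhdsWithin 0 (Set.Ioi 0)) := by
      refine tendsto_nhdsWithin_iff.mpr ⟨?_, Filter.Eventually.of_forall hne⟩
      simpa using (hx.sub_const x).norm
    have h2 := Real.tendsto_log_nhdsGT_zero.comp h1
    have h3 := Filter.tendsto_atTop_add_const_left _ L (Filter.tendsto_neg_atBot_atTop.comp h2)
    simpa [sub_eq_add_neg] using! h3
  have hx0 : ν {x} = 0 := by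
    have := ae_lt_top (Measurable.liminf hgm) hlt.ne
    rw [ae_iff] at this
    refine measure_mono_null ?_ this
    rintro y rfl
    simp [hlix]
  refine ⟨hx0, ?_⟩
  have hxae : ∀ᵐ y ∂ν, y ≠ x := by
    rw [ae_iff]; simpa using hx0
  have hI : Integrable (fun y => L - Real.log ‖x - y‖) ν := by
    refine ⟨((measurable_log_norm_sub _).const_sub _).aestronglyMeasurable, ?_⟩
    rw [hasFiniteIntegral_iff_ofReal]
    · refine lt_of_eq_of_lt ?_ hlt
      refine lintegral_congr_ae ?_
      filter_upwards [hxae] with y hy using (hliy y hy).symm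
    · filter_upwards [ae_mem_of_null hν] with y hy
      have := (hL y hy).1
      simp only [Pi.zero_apply]
      linarith
  have := (integrable_const L).sub hI
  refine this.congr (Filter.Eventually.of_forall fun y => ?_)
  simp

theorem pot_tendsto {K : Set ℂ} (hK : IsCompact K) (ν : Measure ℂ) [IsFiniteMeasure ν]
    (hν : ν Kᶜ = 0) {xs : ℕ → ℂ} {x : ℂ} (hx : Filter.Tendsto xs Filter.atTop (nhds x))
    {c : ℝ} (hc : 0 < c) (hcone : ∀ n, ∀ y ∈ K, c * ‖x - y‖ ≤ ‖xs n - y‖)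
    (hx0 : ν {x} = 0) (hI : Integrable (fun y => Real.log ‖x - y‖) ν) :
    Filter.Tendsto (fun n => pot ν (xs n)) Filter.atTop (nhds (pot ν x)) := by
  obtain ⟨L, hL0, hL⟩ := log_upper hK hx
  have hxae : ∀ᵐ y ∂ν, y ≠ x := by
    rw [ae_iff]; simpa using hx0
  refine tendsto_integral_of_dominated_convergence
    (fun y => |Real.log ‖x - y‖| + |Real.log c| + L)
    (fun n => (measurable_log_norm_sub _).aestronglyMeasurable)
    ((hI.abs.add (integrable_const _)).add (integrable_const _)) (fun n => ?_) ?_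
  · filter_upwards [ae_mem_of_null hν, hxae] with y hy hyx
    have hpos : 0 < ‖x - y‖ := by rw [norm_pos_iff, sub_ne_zero]; exact hyx.symm
    have h1 : Real.log c + Real.log ‖x - y‖ ≤ Real.log ‖xs n - y‖ := by
      rw [← Real.log_mul hc.ne' hpos.ne']
      exact Real.log_le_log (by positivity) (hcone n y hy)
    have h2 := (hL y hy).2 n
    rw [Real.norm_eq_abs, abs_le]
    constructor
    · linarith [neg_abs_le (Real.log c), neg_abs_le (Real.log ‖x - y‖)]
    · linarith [abs_nonneg (Real.log c), abs_nonneg (Real.log ‖x - y‖)]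
  · filter_upwards [hxae] with y hyx
    refine Filter.Tendsto.log ((hx.sub_const y).norm) ?_
    rw [norm_ne_zero_iff, sub_ne_zero]; exact hyx.symm

/-- potentials agree inside -/
theorem pot_eq_inside {K : Set ℂ} (hK : IsCompact K) (μ ν₁ ν₂ : Measure ℂ) [IsFiniteMeasure μ]
    [IsFiniteMeasure ν₁] [IsFiniteMeasure ν₂] (hμ : μ Kᶜ = 0) (h₁ : ν₁ Kᶜ = 0) (h₂ : ν₂ Kᶜ = 0)
    (z : ℂ) (hz : z ∉ K)
    (hμK : ∀ y ∈ K, μ {y} = 0 ∧ Integrable (fun x => Real.log ‖y - x‖) μ ∧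
      pot μ y = Real.log ‖y - z‖)
    (hν : ∀ x ∈ K, ν₁ {x} = 0 → ν₂ {x} = 0 → Integrable (fun y => Real.log ‖x - y‖) ν₁ →
      Integrable (fun y => Real.log ‖x - y‖) ν₂ → pot ν₁ x = pot ν₂ x) :
    pot ν₁ z = pot ν₂ z := by
  have hfub : ∀ (ν : Measure ℂ) [IsFiniteMeasure ν], ν Kᶜ = 0 →
      (∀ᵐ x ∂μ, ν {x} = 0 ∧ Integrable (fun y => Real.log ‖x - y‖) ν) ∧
      pot ν z = ∫ x, pot ν x ∂μ := by
    intro ν _ hνK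
    obtain ⟨L, hL0, hL⟩ : ∃ L : ℝ, 0 ≤ L ∧ ∀ x ∈ K, ∀ y ∈ K, Real.log ‖x - y‖ ≤ L := by
      obtain ⟨R, hR⟩ := hK.isBounded.subset_closedBall (0:ℂ)
      refine ⟨2 * |R|, by positivity, fun x hx y hy => ?_⟩
      have hx' : ‖x‖ ≤ |R| := by
        have := hR hx; rw [mem_closedBall_zero_iff] at this; exact this.trans (le_abs_self R)
      have hy' : ‖y‖ ≤ |R| := by
        have := hR hy; rw [mem_closedBall_zero_iff] at this; exact this.trans (le_abs_self R)
      rcases (norm_nonneg (x - y)).eq_or_lt with h0 | h0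
      · rw [← h0, Real.log_zero]; positivity
      · linarith [Real.log_le_sub_one_of_pos h0, norm_sub_le x y]
    have hmeas : Measurable (fun p : ℂ × ℂ => Real.log ‖p.1 - p.2‖) :=
      Real.measurable_log.comp (by fun_prop)
    have h_intg : Integrable (fun p : ℂ × ℂ => Real.log ‖p.1 - p.2‖) (μ.prod ν) := by
      rw [integrable_prod_iff' hmeas.aestronglyMeasurable]
      constructor
      · filter_upwards [ae_mem_of_null hνK] with y hy
        have := (hμK y hy).2.1
        simpa [norm_sub_rev] using this
      · have hb : Integrable (fun y => (∫ _, 2 * L ∂μ) - Real.log ‖z - y‖) ν :=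
          (integrable_const _).sub (integrable_log_off hK ν hνK z hz)
        refine hb.mono' ?_ ?_
        · exact (hmeas.norm.stronglyMeasurable.integral_prod_left).aestronglyMeasurable
        · filter_upwards [ae_mem_of_null hνK] with y hy
          have hi := (hμK y hy).2.1
          have hp := (hμK y hy).2.2
          rw [Real.norm_eq_abs, abs_of_nonneg (integral_nonneg fun x => norm_nonneg _)]
          rw [norm_sub_rev z y, ← hp]
          simp only [pot]
          rw [← integral_sub (integrable_const _) hi]
          refine integral_mono_ae ?_ ((integrable_const _).sub hi) ?_
          · simpa [norm_sub_rev] using hi.abs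
          · filter_upwards [ae_mem_of_null hμ] with x hx
            have h3 := hL y hy x hx
            simp only [norm_sub_rev x y]
            rw [Real.norm_eq_abs, abs_le]
            constructor <;> linarith
    have hdiag : (fun x => ν (Prod.mk x ⁻¹' {p : ℂ × ℂ | p.1 = p.2})) =ᵐ[μ] 0 := by
      apply Measure.measure_ae_null_of_prod_null
      have hms : MeasurableSet {p : ℂ × ℂ | p.1 = p.2} := measurableSet_eq_fun measurable_fst measurable_snd
      rw [Measure.prod_apply_symm hms]
      rw [lintegral_eq_zero_iff (measurable_measure_prodMk_right hms)]
      filter_upwards [ae_mem_of_null hνK] with y hy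
      have := (hμK y hy).1
      simpa using! this
    refine ⟨?_, ?_⟩
    · filter_upwards [hdiag, h_intg.prod_right_ae] with x hx hx2
      refine ⟨?_, hx2⟩
      have : Prod.mk x ⁻¹' {p : ℂ × ℂ | p.1 = p.2} = {x} := by
        ext y; simp [eq_comm]
      rw [this] at hx
      exact hx
    · have hsw := integral_integral_swap (f := fun x y => Real.log ‖x - y‖) h_intg
      simp only [pot]
      rw [hsw]
      refine integral_congr_ae ?_
      filter_upwards [ae_mem_of_null hνK] with y hy
      have := (hμK y hy).2.2
      simp only [pot] at this
      rw [norm_sub_rev z y, ← this]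
      simp only [norm_sub_rev]
  obtain ⟨a1, b1⟩ := hfub ν₁ h₁
  obtain ⟨a2, b2⟩ := hfub ν₂ h₂
  rw [b1, b2]
  refine integral_congr_ae ?_
  filter_upwards [a1, a2, ae_mem_of_null hμ] with x hx1 hx2 hxK
  exact hν x hxK hx1.1 hx2.1 hx1.2 hx2.2

theorem walsh_lebesgue {K G : Set ℂ} (hK : IsCompact K) (hK0 : volume K = 0)
    (hbd : Bornology.IsBounded G) (hdisj : Disjoint G K) (hfr : frontier G ⊆ K)
    (hV : IsPreconnected (G ∪ K)ᶜ)
    (hcone : ∀ x ∈ K, ∃ c > 0, ∃ xs : ℕ → ℂ, Filter.Tendsto xs Filter.atTop (nhds x) ∧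
      (∀ n, xs n ∉ G ∪ K) ∧ ∀ n, ∀ y ∈ K, c * ‖x - y‖ ≤ ‖xs n - y‖)
    {ψ : ℂ → ℝ} (hψ : ContDiff ℝ 1 ψ) (hc : HasCompactSupport ψ) (ε : ℝ) (hε : 0 < ε) :
    ∃ P : Polynomial ℂ, ∀ x ∈ K, |(P.eval x).re - ψ x| ≤ ε := by
  by_contra hno
  push Not at hno
  obtain ⟨ν₁, ν₂, hf1, hf2, h₁, h₂, hP, hne⟩ := two_measures hK ⟨ψ, hψ.continuous⟩ ε hε hno
  apply hne
  have hKG : IsCompact (G ∪ K) := by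
    refine Metric.isCompact_of_isClosed_isBounded ?_ (hbd.union hK.isBounded)
    have : G ∪ K = closure G ∪ K := by
      rw [closure_eq_self_union_frontier, Set.union_assoc, Set.union_eq_self_of_subset_left hfr]
    rw [this]
    exact isClosed_closure.union hK.isClosed
  have hsub : (G ∪ K)ᶜ ⊆ Kᶜ := Set.compl_subset_compl.mpr Set.subset_union_right
  have hout : ∀ z ∉ G ∪ K, pot ν₁ z = pot ν₂ z := fun z hz =>
    pot_eq_outside hKG hV ν₁ ν₂ (measure_mono_null hsub h₁) (measure_mono_null hsub h₂) hP z hz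
  have hin : ∀ z ∈ G, pot ν₁ z = pot ν₂ z := by
    intro z hz
    obtain ⟨μ, hμf, hμ, hμP⟩ := jensen_measure hK hbd hfr z hz
    have hzK : z ∉ K := fun h => Set.disjoint_left.mp hdisj hz h
    have hpd : ∀ a, pot (Measure.dirac z) a = Real.log ‖a - z‖ := fun a => by simp [pot]
    have hμo : ∀ a ∉ G ∪ K, pot μ a = Real.log ‖a - z‖ := by
      intro a ha
      rw [← hpd]
      refine pot_eq_outside hKG hV μ _ (measure_mono_null hsub hμ) ?_ (fun P => ?_) a ha
      · simp [hz]
      · rw [hμP]; simp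
    refine pot_eq_inside hK μ ν₁ ν₂ hμ h₁ h₂ z hzK (fun y hy => ?_) (fun x hx e1 e2 i1 i2 => ?_)
    · obtain ⟨c, hc, xs, hxs, hxo, hco⟩ := hcone y hy
      have hyz : ‖y - z‖ ≠ 0 := by
        rw [norm_ne_zero_iff, sub_ne_zero]; rintro rfl; exact hzK hy
      have ht : Filter.Tendsto (fun n => pot μ (xs n)) Filter.atTop (nhds (Real.log ‖y - z‖)) := by
        simp only [fun n => hμo (xs n) (hxo n)]
        exact Filter.Tendsto.log ((hxs.sub_const z).norm) hyz
      obtain ⟨M, hM⟩ := (Metric.isBounded_range_of_tendsto _ ht).bddBelow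
      obtain ⟨q1, q2⟩ := pot_fatou hK μ hμ hxs (fun n h => hxo n (Or.inr h)) hy M
        (fun n => hM ⟨n, rfl⟩)
      exact ⟨q1, q2, tendsto_nhds_unique (pot_tendsto hK μ hμ hxs hc hco q1 q2) ht⟩
    · obtain ⟨c, hc, xs, hxs, hxo, hco⟩ := hcone x hx
      have t1 := pot_tendsto hK ν₁ h₁ hxs hc hco e1 i1
      have t2 := pot_tendsto hK ν₂ h₂ hxs hc hco e2 i2
      simp only [fun n => hout (xs n) (hxo n)] at t1
      exact tendsto_nhds_unique t1 t2
  have hall : ∀ z ∉ K, pot ν₁ z = pot ν₂ z := by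
    intro z hz
    by_cases h : z ∈ G
    · exact hin z h
    · exact hout z (by simp [h, hz])
  have hC : ∀ z ∉ K, ∫ x, (z - x)⁻¹ ∂ν₁ = ∫ x, (z - x)⁻¹ ∂ν₂ := by
    intro z hz
    have d1 := pot_hasFDerivAt hK ν₁ h₁ z hz
    have d2 := pot_hasFDerivAt hK ν₂ h₂ z hz
    have d1' := d1.congr_of_eventuallyEq (f₁ := pot ν₂) (by
      filter_upwards [hK.isClosed.isOpen_compl.mem_nhds hz] with a ha using (hall a ha).symm)
    have e := d1'.unique d2
    apply Complex.ext
    · have := congrArg (fun T => T 1) e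
      simpa [mulL_apply] using this
    · have := congrArg (fun T => T Complex.I) e
      simpa [mulL_apply] using this
  have hconj : ∀ (ν : Measure ℂ) (z : ℂ), ∫ x, (starRingEnd ℂ (z - x))⁻¹ ∂ν =
      starRingEnd ℂ (∫ x, (z - x)⁻¹ ∂ν) := by
    intro ν z
    rw [← integral_conj]
    simp only [map_inv₀]
  show ∫ x, ψ x ∂ν₁ = ∫ x, ψ x ∂ν₂
  rw [(pompeiu_measure hψ hc ν₁).2.2, (pompeiu_measure hψ hc ν₂).2.2]
  congr 1
  refine integral_congr_ae ?_
  have : ∀ᵐ z : ℂ, z ∉ K := by rw [ae_iff]; simpa using hK0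
  filter_upwards [this] with z hz
  rw [hconj, hconj, hC z hz]

theorem exterior_preconnected (R : ℝ) (hR : 0 ≤ R) : IsPreconnected {z : ℂ | R < ‖z‖} := by
  have h1 : IsPreconnected (Set.Ioi R ×ˢ (Set.univ : Set ℝ)) :=
    isPreconnected_Ioi.prod isPreconnected_univ
  have h2 := h1.image (fun p : ℝ × ℝ => (p.1 : ℂ) * Complex.exp (p.2 * Complex.I)) (by fun_prop)
  convert h2 using 1
  ext z
  simp only [Set.mem_setOf_eq, Set.mem_image, Set.mem_prod, Set.mem_Ioi, Set.mem_univ, and_true,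
    Prod.exists]
  constructor
  · intro h
    exact ⟨‖z‖, z.arg, h, Complex.norm_mul_exp_arg_mul_I z⟩
  · rintro ⟨r, θ, hr, rfl⟩
    rw [norm_mul, Complex.norm_exp_ofReal_mul_I, mul_one, Complex.norm_real, Real.norm_eq_abs]
    exact hr.trans_le (le_abs_self _)

theorem side_closure {u : ℂ → ℝ} {x : ℂ} (hu : DifferentiableAt ℝ u x) (h : fderiv ℝ u x ≠ 0)
    (s : ℝ) (hs : s ≠ 0) {W : Set ℂ} (hW : W ∈ nhds x) : ∃ y ∈ W, 0 < s * (u y - u x) := by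
  by_contra hno
  push Not at hno
  have hm : IsLocalMax (fun y => s * (u y - u x)) x := by
    filter_upwards [hW] with y hy
    simpa using hno y hy
  have h2 := hm.fderiv_eq_zero
  have h3 : HasFDerivAt (fun y => s * (u y - u x)) (s • fderiv ℝ u x) x :=
    (hu.hasFDerivAt.sub_const _).const_mul s
  rw [h3.fderiv] at h2
  exact (smul_ne_zero hs h) h2

theorem flow_box {u : ℂ → ℝ} (hu : ContDiff ℝ 1 u) {x : ℂ} (h : fderiv ℝ u x ≠ 0)
    {O : Set ℂ} (hO : O ∈ nhds x) :
    ∃ W : Set ℂ, IsOpen W ∧ x ∈ W ∧ W ⊆ O ∧ IsPreconnected (W ∩ {y | u y = u x}) ∧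
      ∀ s : ℝ, s ≠ 0 → IsPreconnected (W ∩ {y | 0 < s * (u y - u x)}) := by
  have hf : HasStrictFDerivAt u (fderiv ℝ u x) x := hu.contDiffAt.hasStrictFDerivAt (by simp)
  have hf' : (fderiv ℝ u x).range = ⊤ := by
    refine LinearMap.range_eq_top.mpr (LinearMap.surjective ?_)
    intro h0; apply h; ext y; exact DFunLike.congr_fun h0 y
  let e := hf.implicitToOpenPartialHomeomorph u (fderiv ℝ u x) hf'
  have hes : x ∈ e.source := hf.mem_implicitToOpenPartialHomeomorph_source hf'
  have hex : e x = (u x, 0) := hf.implicitToOpenPartialHomeomorph_self hf'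
  have he1 : ∀ y, (e y).1 = u y := fun y => hf.implicitToOpenPartialHomeomorph_fst hf' y
  have hnb : e.symm ⁻¹' O ∩ e.target ∈ nhds (u x, (0 : (fderiv ℝ u x).ker)) := by
    rw [← hex]
    refine Filter.inter_mem ?_ (e.open_target.mem_nhds (e.map_source hes))
    exact (e.tendsto_symm hes) hO
  obtain ⟨r, hr, hb⟩ := Metric.mem_nhds_iff.mp hnb
  have hbox : Metric.ball (u x, (0 : (fderiv ℝ u x).ker)) r =
      Metric.ball (u x) r ×ˢ Metric.ball (0 : (fderiv ℝ u x).ker) r := (ball_prod_same _ _ _).symm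
  have hpc : ∀ S : Set ℝ, Convex ℝ S →
      IsPreconnected (e.symm '' (Metric.ball (u x, (0 : (fderiv ℝ u x).ker)) r) ∩ {y | u y ∈ S}) := by
    intro S hS
    have h1 : IsPreconnected ((Metric.ball (u x) r ∩ S) ×ˢ Metric.ball (0 : (fderiv ℝ u x).ker) r) :=
      (((convex_ball _ _).inter hS).prod (convex_ball _ _)).isPreconnected
    have h2 := h1.image e.symm (e.continuousOn_symm.mono (by
      rintro ⟨a, b⟩ ⟨ha, hb'⟩
      exact (hb (by rw [hbox]; exact ⟨ha.1, hb'⟩)).2))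
    convert h2 using 1
    ext y
    constructor
    · rintro ⟨⟨p, hp, rfl⟩, hy⟩
      refine ⟨p, ?_, rfl⟩
      have hpt := (hb hp).2
      have : u (e.symm p) = p.1 := by rw [← he1, e.right_inv hpt]
      rw [hbox] at hp
      refine ⟨⟨hp.1, ?_⟩, hp.2⟩
      rw [Set.mem_setOf_eq, this] at hy
      exact hy
    · rintro ⟨p, ⟨⟨hp1, hp2⟩, hp3⟩, rfl⟩
      have hp : p ∈ Metric.ball (u x, (0 : (fderiv ℝ u x).ker)) r := by rw [hbox]; exact ⟨hp1, hp3⟩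
      refine ⟨⟨p, hp, rfl⟩, ?_⟩
      have : u (e.symm p) = p.1 := by rw [← he1, e.right_inv (hb hp).2]
      rw [Set.mem_setOf_eq, this]
      exact hp2
  refine ⟨e.symm '' (Metric.ball (u x, (0 : (fderiv ℝ u x).ker)) r), ?_, ?_, ?_, ?_, ?_⟩
  · exact e.isOpen_image_symm_of_subset_target Metric.isOpen_ball (fun p hp => (hb hp).2)
  · exact ⟨e x, by rw [hex]; exact Metric.mem_ball_self hr, e.left_inv hes⟩
  · rintro _ ⟨p, hp, rfl⟩
    exact (hb hp).1
  · exact hpc {u x} (convex_singleton _)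
  · intro s hs
    refine hpc {a | 0 < s * (a - u x)} ?_
    have : {a : ℝ | 0 < s * (a - u x)} = {a : ℝ | s * u x < s * a} := by
      ext a; simp only [Set.mem_setOf_eq]; constructor <;> intro h <;> linarith
    rw [this]
    exact convex_halfSpace_gt ⟨fun a b => by ring, fun c a => by simp; ring⟩ _

theorem level_compact {u : ℂ → ℝ} (hu : Continuous u) (hc : HasCompactSupport u) {t : ℝ}
    (ht : 0 < t) : IsCompact {y | t ≤ u y} := by
  refine hc.isCompact.of_isClosed_subset (isClosed_le continuous_const hu) ?_
  intro y hy
  apply subset_tsupport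
  rw [Function.mem_support]
  have : t ≤ u y := hy
  linarith

/-- components of a regular level set -/
theorem level_components {u : ℂ → ℝ} (hu : ContDiff ℝ 1 u) (hc : HasCompactSupport u) {t : ℝ}
    (ht : 0 < t) (hreg : ∀ y, u y = t → fderiv ℝ u y ≠ 0) :
    ∃ (n : ℕ) (Γ N : Fin n → Set ℂ), (∀ i, IsCompact (Γ i)) ∧ (∀ i, IsPreconnected (Γ i)) ∧
      (∀ i, (Γ i).Nonempty) ∧ (∀ i, IsOpen (N i)) ∧ (∀ i j, i ≠ j → Disjoint (N i) (N j)) ∧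
      (∀ i, N i ∩ {y | u y = t} = Γ i) ∧ {y | u y = t} = ⋃ i, Γ i := by
  classical
  let K : Set ℂ := {y | u y = t}
  have hK : IsCompact K := by
    refine (level_compact hu.continuous hc ht).of_isClosed_subset
      (isClosed_eq hu.continuous continuous_const) ?_
    intro y hy
    exact (show u y = t from hy).ge
  have : CompactSpace K := isCompact_iff_compactSpace.mp hK
  have hop : ∀ x : K, IsOpen (connectedComponent x) := by
    intro x
    rw [isOpen_iff_mem_nhds]
    intro y hy
    have hyt : u y.1 = t := y.2
    obtain ⟨W, hWo, hyW, -, hWp, -⟩ := flow_box hu (hreg y.1 hyt) (O := Set.univ) Filter.univ_mem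
    rw [hyt] at hWp
    have h1 : IsPreconnected (Subtype.val ⁻¹' W : Set K) := by
      rw [← Topology.IsInducing.subtypeVal.isPreconnected_image]
      convert hWp using 1
      rw [Subtype.image_preimage_coe, Set.inter_comm]
    rw [connectedComponent_eq hy]
    refine Filter.mem_of_superset ((hWo.preimage continuous_subtype_val).mem_nhds hyW) ?_
    exact h1.subset_connectedComponent hyW
  have hdisc : DiscreteTopology (ConnectedComponents K) :=
    ConnectedComponents.discreteTopology_iff.mpr hop
  have : Finite (ConnectedComponents K) := finite_of_compact_of_discrete
  obtain ⟨n, ⟨eqv⟩⟩ := Finite.exists_equiv_fin (ConnectedComponents K)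
  let q : K → Fin n := fun x => eqv (ConnectedComponents.mk x)
  let Γ : Fin n → Set ℂ := fun i => Subtype.val '' (q ⁻¹' {i})
  have hqeq : ∀ x : K, q ⁻¹' {q x} = connectedComponent x := by
    intro x
    ext y
    simp only [q, Set.mem_preimage, Set.mem_singleton_iff, EmbeddingLike.apply_eq_iff_eq]
    rw [ConnectedComponents.coe_eq_coe']
  have hqs : Function.Surjective q := eqv.surjective.comp ConnectedComponents.surjective_coe
  have hΓc : ∀ i, IsCompact (Γ i) := by
    intro i
    obtain ⟨x, rfl⟩ := hqs i
    refine IsCompact.image ?_ continuous_subtype_val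
    rw [hqeq]
    exact isClosed_connectedComponent.isCompact
  have hΓn : ∀ i, (Γ i).Nonempty := by
    intro i
    obtain ⟨x, rfl⟩ := hqs i
    exact ⟨x, x, rfl, rfl⟩
  have hΓd : ∀ i j, i ≠ j → ∀ z ∈ Γ i, z ∉ Γ j := by
    rintro i j hij z ⟨x, hx, rfl⟩ ⟨y, hy, hxy⟩
    have : y = x := Subtype.ext hxy
    subst this
    exact hij (by rw [← hx]; exact hy)
  have hΓK : ∀ i, Γ i ⊆ K := by
    rintro i _ ⟨x, hx, rfl⟩; exact x.2
  have hcov : K = ⋃ i, Γ i := by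
    ext z
    constructor
    · intro hz
      exact Set.mem_iUnion.mpr ⟨q ⟨z, hz⟩, ⟨z, hz⟩, rfl, rfl⟩
    · intro hz
      obtain ⟨i, hi⟩ := Set.mem_iUnion.mp hz
      exact hΓK i hi
  let N : Fin n → Set ℂ := fun i => ⋂ j, {z | j ≠ i → Metric.infDist z (Γ i) < Metric.infDist z (Γ j)}
  have hΓN : ∀ i, Γ i ⊆ N i := by
    intro i z hz
    refine Set.mem_iInter.mpr fun j hj => ?_
    rw [Metric.infDist_zero_of_mem hz]
    exact ((hΓc j).isClosed.notMem_iff_infDist_pos (hΓn j)).mp (hΓd i j hj.symm z hz)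
  have hNd : ∀ i j, i ≠ j → Disjoint (N i) (N j) := by
    intro i j hij
    rw [Set.disjoint_left]
    intro z h1 h2
    have a := Set.mem_iInter.mp h1 j hij.symm
    have b := Set.mem_iInter.mp h2 i hij
    exact lt_asymm a b
  refine ⟨n, Γ, N, hΓc, ?_, hΓn, ?_, hNd, ?_, hcov⟩
  · intro i
    obtain ⟨x, rfl⟩ := hqs i
    refine IsPreconnected.image ?_ _ continuous_subtype_val.continuousOn
    rw [hqeq]
    exact isPreconnected_connectedComponent
  · intro i
    refine isOpen_iInter_of_finite fun j => ?_
    by_cases hj : j = i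
    · simp [hj]
    · simp only [ne_eq, hj, not_false_eq_true, forall_const]
      exact isOpen_lt (Metric.continuous_infDist_pt _) (Metric.continuous_infDist_pt _)
  · intro i
    refine Set.Subset.antisymm ?_ (fun z hz => ⟨hΓN i hz, hΓK i hz⟩)
    rintro z ⟨hz1, hz2⟩
    have hz3 : z ∈ K := hz2
    rw [hcov] at hz3
    obtain ⟨j, hj⟩ := Set.mem_iUnion.mp hz3
    by_cases hij : i = j
    · rw [hij]; exact hj
    · exact absurd (hΓN j hj) (Set.disjoint_left.mp (hNd i j hij) hz1)

theorem form_primitive {g : ℂ → ℝ} (hg : ContDiff ℝ 3 g) (hgc : HasCompactSupport g)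
    {N N' : Set ℂ} (hN : IsOpen N) (hN' : IsOpen N') (hd : Disjoint N N')
    (hs : tsupport (fderiv ℝ g) ⊆ N ∪ N') :
    ∃ B : ℂ → ℝ, ContDiff ℝ 2 B ∧ HasCompactSupport B ∧
      ∀ z, HasFDerivAt B (N.indicator (fderiv ℝ g) z) z := by
  classical
  let A : ℂ → (ℂ →L[ℝ] ℝ) := N.indicator (fderiv ℝ g)
  have hloc : ∀ z, A =ᶠ[nhds z] fderiv ℝ g ∨ A =ᶠ[nhds z] fun _ => 0 := by
    intro z
    by_cases hz : z ∈ N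
    · left
      filter_upwards [hN.mem_nhds hz] with y hy
      exact Set.indicator_of_mem hy _
    · right
      by_cases hz' : z ∈ N'
      · filter_upwards [hN'.mem_nhds hz'] with y hy
        exact Set.indicator_of_notMem (fun h => Set.disjoint_left.mp hd h hy) _
      · have hzt : z ∉ tsupport (fderiv ℝ g) := fun h => (hs h).elim hz hz'
        filter_upwards [(isClosed_tsupport (fderiv ℝ g)).isOpen_compl.mem_nhds hzt] with y hy
        have : fderiv ℝ g y = 0 := image_eq_zero_of_notMem_tsupport hy
        by_cases hy' : y ∈ N
        · exact (Set.indicator_of_mem hy' _).trans this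
        · exact Set.indicator_of_notMem hy' _
  have hdg : ContDiff ℝ 2 (fderiv ℝ g) := hg.fderiv_right (by norm_num)
  have hA : ContDiff ℝ 2 A := by
    rw [contDiff_iff_contDiffAt]
    intro z
    rcases hloc z with h | h
    · exact hdg.contDiffAt.congr_of_eventuallyEq h
    · exact contDiffAt_const.congr_of_eventuallyEq h
  have hsym : ∀ z x y, fderiv ℝ A z x y = fderiv ℝ A z y x := by
    intro z x y
    rcases hloc z with h | h
    · rw [h.fderiv_eq]
      have : IsSymmSndFDerivAt ℝ g z :=
        hg.contDiffAt.isSymmSndFDerivAt (by simp; norm_num)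
      exact this x y
    · rw [h.fderiv_eq]; simp
  obtain ⟨B, hB⟩ : ∃ B : ℂ → ℝ, ∀ z ∈ (Set.univ : Set ℂ), HasFDerivAt B (A z) z := by
    apply Convex.exists_forall_hasFDerivAt_of_fderiv_symmetric convex_univ isOpen_univ
    · exact (hA.differentiable (by norm_num)).differentiableOn
    · intro z _ x y
      exact hsym z x y
  have hB1 : ∀ z, HasFDerivAt B (A z) z := fun z => hB z trivial
  have hBC : ContDiff ℝ 2 B := by
    have : ContDiff ℝ (1 + 1) B := by
      rw [contDiff_succ_iff_fderiv]
      refine ⟨fun z => (hB1 z).differentiableAt, by simp, ?_⟩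
      have : fderiv ℝ B = A := funext fun z => (hB1 z).fderiv
      rw [this]
      exact hA.of_le (by norm_num)
    simpa [one_add_one_eq_two] using this
  obtain ⟨R, hR⟩ := hgc.isCompact.isBounded.subset_closedBall 0
  have hout : ∀ z : ℂ, R < ‖z‖ → A z = 0 := by
    intro z hz
    have hzt : z ∉ tsupport g := by
      intro h
      have := hR h
      rw [mem_closedBall_zero_iff] at this
      linarith
    have h0 : fderiv ℝ g z = 0 := by
      by_contra h
      exact hzt (support_fderiv_subset ℝ h)
    by_cases hy' : z ∈ N
    · exact (Set.indicator_of_mem hy' _).trans h0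
    · exact Set.indicator_of_notMem hy' _
  have hEo : IsOpen {z : ℂ | R < ‖z‖} := isOpen_lt continuous_const continuous_norm
  have hEc : IsPreconnected {z : ℂ | R < ‖z‖} := by
    have h1 := exterior_preconnected (max R 0) (le_max_right _ _)
    by_cases hR0 : 0 ≤ R
    · rwa [max_eq_left hR0] at h1
    · have : {z : ℂ | R < ‖z‖} = Set.univ := by
        ext z; simp only [Set.mem_ofPred_eq, Set.mem_univ, iff_true]
        have := norm_nonneg z; linarith
      rw [this]; exact isPreconnected_univ
  obtain ⟨k, hk⟩ := hEo.exists_is_const_of_fderiv_eq_zero (𝕜 := ℝ) (f := B) hEc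
    (fun z _ => (hB1 z).differentiableAt.differentiableWithinAt)
    (fun z hz => by rw [(hB1 z).fderiv]; exact hout z hz)
  refine ⟨fun z => B z - k, hBC.sub contDiff_const, ?_, fun z => (hB1 z).sub_const k⟩
  refine HasCompactSupport.of_support_subset_isCompact (isCompact_closedBall 0 R) ?_
  intro z hz
  rw [mem_closedBall_zero_iff]
  by_contra h
  push Not at h
  apply hz
  simp [hk z h]

/-- The region bounded by one component of a regular level set. -/
theorem component_region {u : ℂ → ℝ} (hu : ContDiff ℝ 3 u) (hc : HasCompactSupport u)
    {t c : ℝ} (hc0 : 0 < c) (hct : c < t) (hreg : ∀ y, u y = t → fderiv ℝ u y ≠ 0)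
    {Γ N N' : Set ℂ} (hΓc : IsCompact Γ) (hΓp : IsPreconnected Γ) (hΓn : Γ.Nonempty)
    (hN : IsOpen N) (hN' : IsOpen N') (hd : Disjoint N N') (hNΓ : N ∩ {y | u y = t} = Γ)
    (hcov : ∀ z, |u z - t| ≤ c → z ∈ N ∪ N')
    {β : ℝ → ℝ} (hβ : ContDiff ℝ 3 β) (hβ0 : ∀ r, r ≤ t - c → β r = 0)
    (hβ1 : ∀ r, t + c ≤ r → β r = 1) :
    ∃ (B : ℂ → ℝ) (s : ℝ) (G N2 : Set ℂ), ContDiff ℝ 2 B ∧ HasCompactSupport B ∧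
      (∀ z, HasFDerivAt B (N.indicator (fderiv ℝ (fun z => β (u z))) z) z) ∧
      (s = 1 ∨ s = -1) ∧ IsOpen G ∧ Bornology.IsBounded G ∧ Disjoint G Γ ∧ frontier G ⊆ Γ ∧
      IsPreconnected (G ∪ Γ)ᶜ ∧ IsOpen N2 ∧ Γ ⊆ N2 ∧ N2 ⊆ N ∧
      (∀ z ∈ N2, u z ≠ t → (z ∈ G ↔ 0 < s * (u z - t))) ∧
      ∀ z, z ∉ Γ → B z - N.indicator (fun z => β (u z)) z
        + (N ∩ {y | t < u y}).indicator (fun _ => (1 : ℝ)) z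
        = s * G.indicator (fun _ => (1 : ℝ)) z := by
  classical
  have hucont := hu.continuous
  have hg : ContDiff ℝ 3 (fun z => β (u z)) := hβ.comp hu
  have hgc : HasCompactSupport (fun z => β (u z)) :=
    hc.comp_left (g := β) (hβ0 0 (by linarith))
  have hsupp : tsupport (fderiv ℝ (fun z => β (u z))) ⊆ N ∪ N' := by
    have h1 : tsupport (fderiv ℝ (fun z => β (u z))) ⊆ {z | |u z - t| ≤ c} := by
      refine closure_minimal ?_ (isClosed_le (by fun_prop) continuous_const)
      intro z hz
      by_contra hno
      apply hz
      have hno' : c < |u z - t| := not_le.mp hno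
      rcases lt_abs.mp hno' with h | h
      · have : (fun z => β (u z)) =ᶠ[nhds z] fun _ => 1 := by
          have ho : IsOpen {z | t + c < u z} := isOpen_lt continuous_const hucont
          filter_upwards [ho.mem_nhds (show t + c < u z by linarith)] with y hy
          exact hβ1 _ (le_of_lt hy)
        rw [this.fderiv_eq]; simp
      · have : (fun z => β (u z)) =ᶠ[nhds z] fun _ => 0 := by
          have ho : IsOpen {z | u z < t - c} := isOpen_lt hucont continuous_const
          filter_upwards [ho.mem_nhds (show u z < t - c by linarith)] with y hy
          exact hβ0 _ (le_of_lt hy)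
        rw [this.fderiv_eq]; simp
    exact fun z hz => hcov z (h1 hz)
  obtain ⟨B, hBC, hBc, hB⟩ := form_primitive hg hgc hN hN' hd hsupp
  set b : ℂ → ℝ := fun z => B z - N.indicator (fun z => β (u z)) z
        + (N ∩ {y | t < u y}).indicator (fun _ => (1 : ℝ)) z with hbdef
  have hgd : ∀ z, HasFDerivAt (fun z => β (u z)) (fderiv ℝ (fun z => β (u z)) z) z :=
    fun z => (hg.differentiable (by norm_num) z).hasFDerivAt
  have hΓN : Γ ⊆ N := by rw [← hNΓ]; exact Set.inter_subset_left
  have hΓu : ∀ x ∈ Γ, u x = t := by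
    intro x hx; rw [← hNΓ] at hx; exact hx.2
  have hbp : ∀ z ∈ N, t < u z → b z = B z - β (u z) + 1 := by
    intro z hz hzu
    simp only [hbdef]
    rw [Set.indicator_of_mem hz, Set.indicator_of_mem (show z ∈ N ∩ {y | t < u y} from ⟨hz, hzu⟩)]
  have hbm : ∀ z ∈ N, u z < t → b z = B z - β (u z) := by
    intro z hz hzu
    simp only [hbdef]
    rw [Set.indicator_of_mem hz,
      Set.indicator_of_notMem (show z ∉ N ∩ {y | t < u y} from fun h => lt_asymm hzu h.2), add_zero]
  have hb0 : ∀ z ∉ Γ, HasFDerivAt b (0 : ℂ →L[ℝ] ℝ) z := by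
    intro z hz
    by_cases hzN : z ∈ N
    · have hut : u z ≠ t := fun h => hz (by rw [← hNΓ]; exact ⟨hzN, h⟩)
      have hd0 : HasFDerivAt (fun z => B z - β (u z)) (0 : ℂ →L[ℝ] ℝ) z := by
        have h1 := (hB z).sub (hgd z)
        rw [Set.indicator_of_mem hzN, sub_self] at h1
        exact h1
      rcases lt_or_gt_of_ne hut with h | h
      · refine hd0.congr_of_eventuallyEq ?_
        filter_upwards [hN.mem_nhds hzN, (isOpen_lt hucont continuous_const).mem_nhds h] with y h1 h2
        exact hbm y h1 h2
      · refine (hd0.add_const 1).congr_of_eventuallyEq ?_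
        filter_upwards [hN.mem_nhds hzN, (isOpen_lt continuous_const hucont).mem_nhds h] with y h1 h2
        exact hbp y h1 h2
    · have hd0 : HasFDerivAt B (0 : ℂ →L[ℝ] ℝ) z := by
        have h1 := hB z
        rwa [Set.indicator_of_notMem hzN] at h1
      refine hd0.congr_of_eventuallyEq ?_
      by_cases hcz : |u z - t| ≤ c
      · have hzN' : z ∈ N' := (hcov z hcz).resolve_left hzN
        filter_upwards [hN'.mem_nhds hzN'] with y hy
        have hyN : y ∉ N := fun h => Set.disjoint_left.mp hd h hy
        simp only [hbdef]
        rw [Set.indicator_of_notMem hyN, Set.indicator_of_notMem (fun h => hyN h.1)]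
        ring
      · push Not at hcz
        rcases lt_abs.mp hcz with h | h
        · have ho : IsOpen {z | t + c < u z} := isOpen_lt continuous_const hucont
          filter_upwards [ho.mem_nhds (show t + c < u z by linarith)] with y hy
          have hy1 : t + c < u y := hy
          by_cases hyN : y ∈ N
          · rw [hbp y hyN (by linarith), hβ1 _ hy1.le]; ring
          · simp only [hbdef]
            rw [Set.indicator_of_notMem hyN, Set.indicator_of_notMem (fun h => hyN h.1)]
            ring
        · have ho : IsOpen {z | u z < t - c} := isOpen_lt hucont continuous_const
          filter_upwards [ho.mem_nhds (show u z < t - c by linarith)] with y hy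
          have hy1 : u y < t - c := hy
          by_cases hyN : y ∈ N
          · rw [hbm y hyN (by linarith), hβ0 _ hy1.le]; ring
          · simp only [hbdef]
            rw [Set.indicator_of_notMem hyN, Set.indicator_of_notMem (fun h => hyN h.1)]
            ring
  have hΓo : IsOpen Γᶜ := hΓc.isClosed.isOpen_compl
  let Q : ℂ → Set ℂ := fun p => connectedComponentIn Γᶜ p
  have hQo : ∀ p, IsOpen (Q p) := fun p => hΓo.connectedComponentIn
  have hQs : ∀ p, Q p ⊆ Γᶜ := fun p => connectedComponentIn_subset _ _
  have hQm : ∀ p, p ∉ Γ → p ∈ Q p := fun p hp => mem_connectedComponentIn hp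
  have hQc : ∀ p, IsPreconnected (Q p) := fun p => isPreconnected_connectedComponentIn
  have hQsub : ∀ p (S : Set ℂ), IsPreconnected S → S ⊆ Γᶜ → ∀ z ∈ S, z ∈ Q p → S ⊆ Q p := by
    intro p S hS hSΓ z hz hzQ
    have h1 := hS.subset_connectedComponentIn hz hSΓ
    have h2 : connectedComponentIn Γᶜ p = connectedComponentIn Γᶜ z := connectedComponentIn_eq hzQ
    show S ⊆ connectedComponentIn Γᶜ p
    rw [h2]; exact h1
  have hbQ : ∀ p, ∀ z ∈ Q p, p ∉ Γ → b z = b p := by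
    intro p z hz hp
    exact (hQo p).is_const_of_fderiv_eq_zero (𝕜 := ℝ) (f := b) (hQc p)
      (fun y hy => (hb0 y (hQs p hy)).differentiableAt.differentiableWithinAt)
      (fun y hy => (hb0 y (hQs p hy)).fderiv) hz (hQm p hp)
  -- flow boxes
  have hW : ∀ x : Γ, ∃ W : Set ℂ, IsOpen W ∧ x.1 ∈ W ∧ W ⊆ N ∧ ∀ s : ℝ, s ≠ 0 →
      IsPreconnected (W ∩ {y | 0 < s * (u y - t)}) := by
    rintro ⟨x, hx⟩
    obtain ⟨W, h1, h2, h3, -, h5⟩ := flow_box (hu.of_le (by norm_num)) (hreg x (hΓu x hx))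
      (hN.mem_nhds (hΓN hx))
    refine ⟨W, h1, h2, h3, fun s hs => ?_⟩
    have := h5 s hs
    rwa [hΓu x hx] at this
  choose W hWo hWm hWN hWp using hW
  let S : Γ → ℝ → Set ℂ := fun x s => W x ∩ {y | 0 < s * (u y - t)}
  have hSΓ : ∀ x s, S x s ⊆ Γᶜ := by
    intro x s z hz hzΓ
    have h1 : 0 < s * (u z - t) := hz.2
    rw [hΓu z hzΓ] at h1; simp at h1
  have hSQ : ∀ x s, s ≠ 0 → ∀ p, ∀ z ∈ S x s, z ∈ Q p → S x s ⊆ Q p :=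
    fun x s hs p z hz hzQ => hQsub p _ (hWp x s hs) (hSΓ x s) z hz hzQ
  have hside : ∀ x ∈ Γ, ∀ s : ℝ, s ≠ 0 → ∀ O ∈ nhds x, ∃ y ∈ O, 0 < s * (u y - t) := by
    intro x hx s hs O hO
    have := side_closure (hu.differentiable (by norm_num) x) (hreg x (hΓu x hx)) s hs hO
    rwa [hΓu x hx] at this
  have hSne : ∀ x s, s ≠ 0 → (S x s).Nonempty := by
    intro x s hs
    obtain ⟨y, h1, h2⟩ := hside x.1 x.2 s hs (W x) ((hWo x).mem_nhds (hWm x))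
    exact ⟨y, h1, h2⟩
  -- all or none
  have hall : ∀ p s, s ≠ 0 → ∀ x y : Γ, S x s ⊆ Q p → S y s ⊆ Q p := by
    intro p s hs x y hx
    by_contra hy
    have hpre := hΓp (⋃ x : {x : Γ // S x s ⊆ Q p}, W x.1) (⋃ x : {x : Γ // ¬ S x s ⊆ Q p}, W x.1)
      (isOpen_iUnion fun x => hWo _) (isOpen_iUnion fun x => hWo _) (by
        intro z hz
        by_cases h : S ⟨z, hz⟩ s ⊆ Q p
        · exact Or.inl (Set.mem_iUnion.mpr ⟨⟨⟨z, hz⟩, h⟩, hWm ⟨z, hz⟩⟩)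
        · exact Or.inr (Set.mem_iUnion.mpr ⟨⟨⟨z, hz⟩, h⟩, hWm ⟨z, hz⟩⟩))
      ⟨x.1, x.2, Set.mem_iUnion.mpr ⟨⟨x, hx⟩, hWm x⟩⟩
      ⟨y.1, y.2, Set.mem_iUnion.mpr ⟨⟨y, hy⟩, hWm y⟩⟩
    obtain ⟨z, hzΓ, hz1, hz2⟩ := hpre
    obtain ⟨⟨x', hx'⟩, hzx⟩ := Set.mem_iUnion.mp hz1
    obtain ⟨⟨y', hy'⟩, hzy⟩ := Set.mem_iUnion.mp hz2
    obtain ⟨q, ⟨hq1, hq2⟩, hq3⟩ := hside z hzΓ s hs (W x' ∩ W y')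
      (((hWo x').inter (hWo y')).mem_nhds ⟨hzx, hzy⟩)
    exact hy' (hSQ y' s hs p q ⟨hq2, hq3⟩ (hx' ⟨hq1, hq3⟩))
  have htouch : ∀ p, p ∉ Γ → ∃ x : Γ, S x 1 ⊆ Q p ∨ S x (-1) ⊆ Q p := by
    intro p hp
    have hfr : (frontier (Q p)).Nonempty := by
      rw [nonempty_frontier_iff]
      refine ⟨⟨p, hQm p hp⟩, ?_⟩
      intro h
      obtain ⟨x, hx⟩ := hΓn
      exact hQs p (h ▸ Set.mem_univ x) hx
    obtain ⟨x, hx⟩ := hfr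
    rw [(hQo p).frontier_eq] at hx
    have hxΓ : x ∈ Γ := by
      by_contra hno
      obtain ⟨z, hz1, hz2⟩ := mem_closure_iff.mp hx.1 (Q x) (hQo x) (hQm x hno)
      have h1 : connectedComponentIn Γᶜ p = connectedComponentIn Γᶜ z := connectedComponentIn_eq hz2
      have h2 : connectedComponentIn Γᶜ x = connectedComponentIn Γᶜ z := connectedComponentIn_eq hz1
      apply hx.2
      show x ∈ connectedComponentIn Γᶜ p
      rw [h1, ← h2]
      exact hQm x hno
    obtain ⟨z, hz1, hz2⟩ := mem_closure_iff.mp hx.1 (W ⟨x, hxΓ⟩) (hWo _) (hWm ⟨x, hxΓ⟩)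
    have hut : u z ≠ t := fun h => hQs p hz2 (by rw [← hNΓ]; exact ⟨hWN _ hz1, h⟩)
    refine ⟨⟨x, hxΓ⟩, ?_⟩
    rcases lt_or_gt_of_ne hut with h | h
    · right
      exact hSQ _ (-1) (by norm_num) p z ⟨hz1, show 0 < -1 * (u z - t) by linarith⟩ hz2
    · left
      exact hSQ _ 1 (by norm_num) p z ⟨hz1, show 0 < 1 * (u z - t) by linarith⟩ hz2
  obtain ⟨R, hR⟩ := (hBc.isCompact.isBounded.union
    (hc.isCompact.isBounded.union hΓc.isBounded)).subset_closedBall 0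
  set R' := max R 0 with hR'
  have hEout : ∀ z : ℂ, R' < ‖z‖ → z ∉ tsupport B ∪ (tsupport u ∪ Γ) := by
    intro z hz h
    have := hR h
    rw [mem_closedBall_zero_iff] at this
    have := le_max_left R 0
    linarith
  let p0 : ℂ := ((R' + 1 : ℝ) : ℂ)
  have hp0n : R' < ‖p0‖ := by
    rw [Complex.norm_real, Real.norm_eq_abs]
    exact (lt_add_one _).trans_le (le_abs_self _)
  have hp0 : p0 ∉ Γ := fun h => hEout p0 hp0n (Or.inr (Or.inr h))
  have hbp0 : b p0 = 0 := by
    have h1 : B p0 = 0 := image_eq_zero_of_notMem_tsupport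
      fun h => hEout p0 hp0n (Or.inl h)
    have h2 : u p0 = 0 := image_eq_zero_of_notMem_tsupport
      fun h => hEout p0 hp0n (Or.inr (Or.inl h))
    by_cases hN0 : p0 ∈ N
    · rw [hbm p0 hN0 (by linarith), h1, h2, hβ0 0 (by linarith)]; ring
    · simp only [hbdef]
      rw [Set.indicator_of_notMem hN0, Set.indicator_of_notMem (fun h => hN0 h.1), h1]; ring
  have hEV : {z : ℂ | R' < ‖z‖} ⊆ Q p0 :=
    hQsub p0 _ (exterior_preconnected R' (le_max_right _ _))
      (fun z hz h => hEout z hz (Or.inr (Or.inr h))) p0 hp0n (hQm p0 hp0)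
  have hbV : ∀ z ∈ Q p0, b z = 0 := fun z hz => (hbQ p0 z hz hp0).trans hbp0
  obtain ⟨x0, hx0⟩ := hΓn
  -- jump
  have hjump : ∀ kp km : ℝ, (∀ z ∈ S ⟨x0, hx0⟩ 1, b z = kp) → (∀ z ∈ S ⟨x0, hx0⟩ (-1), b z = km) →
      kp - km = 1 := by
    intro kp km h1 h2
    have hcont : Continuous fun z => B z - β (u z) := hBC.continuous.sub hg.continuous
    have e1 : B x0 - β (u x0) = kp - 1 := by
      by_contra hne
      have ho := (isOpen_ne_fun hcont (continuous_const (y := kp - 1))).mem_nhds hne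
      obtain ⟨y, ⟨hy1, hy2⟩, hy3⟩ := hside x0 hx0 1 one_ne_zero _
        (Filter.inter_mem ho ((hWo ⟨x0, hx0⟩).mem_nhds (hWm ⟨x0, hx0⟩)))
      have h3 := h1 y ⟨hy2, hy3⟩
      rw [hbp y (hWN _ hy2) (by linarith)] at h3
      exact hy1 (by linarith)
    have e2 : B x0 - β (u x0) = km := by
      by_contra hne
      have ho := (isOpen_ne_fun hcont (continuous_const (y := km))).mem_nhds hne
      obtain ⟨y, ⟨hy1, hy2⟩, hy3⟩ := hside x0 hx0 (-1) (by norm_num) _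
        (Filter.inter_mem ho ((hWo ⟨x0, hx0⟩).mem_nhds (hWm ⟨x0, hx0⟩)))
      have h3 := h2 y ⟨hy2, hy3⟩
      rw [hbm y (hWN _ hy2) (by linarith)] at h3
      exact hy1 (by linarith)
    linarith
  have hconst : ∀ s : ℝ, s ≠ 0 → ∃ k : ℝ, ∀ z ∈ S ⟨x0, hx0⟩ s, b z = k := by
    intro s hs
    obtain ⟨q, hq⟩ := hSne ⟨x0, hx0⟩ s hs
    refine ⟨b q, fun z hz => ?_⟩
    have hqΓ := hSΓ _ _ hq
    exact hbQ q z (hSQ _ s hs q q hq (hQm q hqΓ) hz) hqΓ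
  obtain ⟨σ, hσ, hσV, hσs⟩ : ∃ σ : ℝ, (σ = 1 ∨ σ = -1) ∧ S ⟨x0, hx0⟩ σ ⊆ Q p0 ∧
      ∀ z ∈ S ⟨x0, hx0⟩ (-σ), b z = -σ := by
    obtain ⟨kp, hkp⟩ := hconst 1 one_ne_zero
    obtain ⟨km, hkm⟩ := hconst (-1) (by norm_num)
    have hj := hjump kp km hkp hkm
    obtain ⟨x, hx | hx⟩ := htouch p0 hp0
    · have h1 := hall p0 1 one_ne_zero x ⟨x0, hx0⟩ hx
      refine ⟨1, Or.inl rfl, h1, ?_⟩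
      obtain ⟨q, hq⟩ := hSne ⟨x0, hx0⟩ 1 one_ne_zero
      have : kp = 0 := by rw [← hkp q hq]; exact hbV q (h1 hq)
      intro z hz
      rw [hkm z hz]; linarith
    · have h1 := hall p0 (-1) (by norm_num) x ⟨x0, hx0⟩ hx
      refine ⟨-1, Or.inr rfl, h1, ?_⟩
      obtain ⟨q, hq⟩ := hSne ⟨x0, hx0⟩ (-1) (by norm_num)
      have : km = 0 := by rw [← hkm q hq]; exact hbV q (h1 hq)
      intro z hz
      rw [neg_neg] at hz ⊢
      rw [hkp z hz]; linarith
  have hσ0 : σ ≠ 0 := by rcases hσ with h | h <;> rw [h] <;> norm_num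
  have hsig : ∀ z, u z ≠ t → 0 < σ * (u z - t) ∨ 0 < -σ * (u z - t) := by
    intro z hz
    have : σ * (u z - t) ≠ 0 := mul_ne_zero hσ0 (sub_ne_zero.mpr hz)
    rcases lt_or_gt_of_ne this with h | h
    · right; linarith
    · left; exact h
  let G : Set ℂ := (Q p0 ∪ Γ)ᶜ
  have hGb : ∀ p, p ∈ G → b p = -σ := by
    intro p hp
    have hpΓ : p ∉ Γ := fun h => hp (Or.inr h)
    have hpV : p ∉ Q p0 := fun h => hp (Or.inl h)
    have hdj : ∀ z ∈ Q p, z ∉ Q p0 := by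
      intro z hz hz0
      have h1 : connectedComponentIn Γᶜ p = connectedComponentIn Γᶜ z := connectedComponentIn_eq hz
      have h2 : connectedComponentIn Γᶜ p0 = connectedComponentIn Γᶜ z := connectedComponentIn_eq hz0
      apply hpV
      show p ∈ connectedComponentIn Γᶜ p0
      rw [h2, ← h1]
      exact hQm p hpΓ
    have key : S ⟨x0, hx0⟩ (-σ) ⊆ Q p := by
      have hno : ¬ S ⟨x0, hx0⟩ σ ⊆ Q p := by
        intro h
        obtain ⟨q, hq⟩ := hSne ⟨x0, hx0⟩ σ hσ0
        exact hdj q (h hq) (hσV hq)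
      obtain ⟨x, hx⟩ := htouch p hpΓ
      rcases hσ with rfl | rfl
      · rcases hx with hx | hx
        · exact absurd (hall p 1 one_ne_zero x _ hx) hno
        · exact hall p (-1) (by norm_num) x _ hx
      · rw [neg_neg]
        rcases hx with hx | hx
        · exact hall p 1 (by norm_num) x _ hx
        · exact absurd (hall p (-1) (by norm_num) x _ hx) hno
    obtain ⟨q, hq⟩ := hSne ⟨x0, hx0⟩ (-σ) (neg_ne_zero.mpr hσ0)
    rw [← hbQ p q (key hq) hpΓ]
    exact hσs q hq
  have hGo : IsOpen G := by
    rw [isOpen_iff_mem_nhds]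
    intro p hp
    have hpΓ : p ∉ Γ := fun h => hp (Or.inr h)
    have hpV : p ∉ Q p0 := fun h => hp (Or.inl h)
    refine Filter.mem_of_superset ((hQo p).mem_nhds (hQm p hpΓ)) ?_
    rintro z hz (h | h)
    · have h1 : connectedComponentIn Γᶜ p = connectedComponentIn Γᶜ z := connectedComponentIn_eq hz
      have h2 : connectedComponentIn Γᶜ p0 = connectedComponentIn Γᶜ z := connectedComponentIn_eq h
      apply hpV
      show p ∈ connectedComponentIn Γᶜ p0
      rw [h2, ← h1]
      exact hQm p hpΓ
    · exact hQs p hz h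
  refine ⟨B, -σ, G, ⋃ x, W x, hBC, hBc, hB, ?_, hGo, ?_, ?_, ?_, ?_, ?_, ?_, ?_, ?_, ?_⟩
  · rcases hσ with h | h <;> simp [h]
  · refine (Metric.isBounded_closedBall (x := (0 : ℂ)) (r := R')).subset ?_
    intro z hz
    rw [mem_closedBall_zero_iff]
    by_contra h
    push Not at h
    exact hz (Or.inl (hEV h))
  · exact Set.disjoint_left.mpr fun z hz h => hz (Or.inr h)
  · rw [hGo.frontier_eq]
    rintro z ⟨hz1, hz2⟩
    have : z ∈ Q p0 ∪ Γ := not_not.mp hz2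
    rcases this with h | h
    · obtain ⟨y, hy1, hy2⟩ := mem_closure_iff.mp hz1 _ (hQo p0) h
      exact absurd (Or.inl hy1) hy2
    · exact h
  · have : (G ∪ Γ)ᶜ = Q p0 := by
      ext z
      constructor
      · intro h
        by_contra h2
        apply h
        by_cases h3 : z ∈ Γ
        · exact Or.inr h3
        · exact Or.inl fun h4 => h4.elim h2 h3
      · rintro h (h1 | h1)
        · exact h1 (Or.inl h)
        · exact hQs p0 h h1
    rw [this]; exact hQc p0
  · exact isOpen_iUnion hWo
  · exact fun x hx => Set.mem_iUnion.mpr ⟨⟨x, hx⟩, hWm ⟨x, hx⟩⟩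
  · exact Set.iUnion_subset hWN
  · intro z hz hut
    obtain ⟨x, hx⟩ := Set.mem_iUnion.mp hz
    have hzΓ : z ∉ Γ := fun h => hut (hΓu z h)
    constructor
    · intro hG
      rcases hsig z hut with h | h
      · exact absurd (Or.inl (hall p0 σ hσ0 ⟨x0, hx0⟩ x hσV ⟨hx, h⟩)) hG
      · exact h
    · rintro h (h1 | h1)
      · have h2 := hSQ x (-σ) (neg_ne_zero.mpr hσ0) p0 z ⟨hx, h⟩ h1
        have h3 := hall p0 (-σ) (neg_ne_zero.mpr hσ0) x ⟨x0, hx0⟩ h2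
        obtain ⟨q, hq⟩ := hSne ⟨x0, hx0⟩ (-σ) (neg_ne_zero.mpr hσ0)
        have h4 := hbV q (h3 hq)
        rw [hσs q hq] at h4
        exact hσ0 (neg_eq_zero.mp h4)
      · exact hzΓ h1
  · intro z hz
    show b z = _
    by_cases hG : z ∈ G
    · rw [Set.indicator_of_mem hG, hGb z hG, mul_one]
    · rw [Set.indicator_of_notMem hG, mul_zero]
      have : z ∈ Q p0 ∪ Γ := not_not.mp hG
      exact hbV z (this.resolve_right hz)

theorem primitive_outside {Ω : Set ℂ} (hΩ : IsOpen Ω) (hsc : IsSimplyConnected Ω) {B : ℂ → ℝ}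
    (hB : ContDiff ℝ 2 B) (hBc : HasCompactSupport B) (hs : tsupport (fderiv ℝ B) ⊆ Ω)
    {a : ℂ} (ha : a ∉ Ω) : B a = 0 := by
  have hp := (pompeiu_measure (hB.of_le (by norm_num)) hBc (Measure.dirac a)).2.2
  simp only [integral_dirac] at hp
  obtain ⟨l, hl, hle⟩ := Complex.exists_continuousOn_eqOn_exp_comp hsc hΩ (g := fun z => z - a)
    (by fun_prop) (by
      rintro ⟨z, hz, h⟩
      have : z = a := sub_eq_zero.mp h
      exact ha (this ▸ hz))
  have hld : ∀ z ∈ Ω, HasDerivAt l (z - a)⁻¹ z := by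
    intro z hz
    have h1 : Complex.exp (l z) = z - a := hle hz
    have hne : z - a ≠ 0 := by rw [← h1]; exact Complex.exp_ne_zero _
    have h2 : HasDerivAt (fun x => Complex.exp x + a) (z - a) (l z) := by
      have := (Complex.hasDerivAt_exp (l z)).add_const a
      rwa [h1] at this
    refine HasDerivAt.of_local_left_inverse (hl.continuousAt (hΩ.mem_nhds hz)) h2 hne ?_
    filter_upwards [hΩ.mem_nhds hz] with y hy
    have : Complex.exp (l y) = y - a := hle hy
    rw [this]; ring
  have hlC : ContDiffOn ℝ 1 (fun z => (l z).im) Ω := by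
    have h1 : DifferentiableOn ℂ l Ω := fun z hz => (hld z hz).differentiableAt.differentiableWithinAt
    have h2 : ContDiffOn ℂ 1 l Ω := h1.contDiffOn hΩ
    exact Complex.imCLM.contDiff.comp_contDiffOn (h2.restrict_scalars ℝ)
  have hθ : ∀ z ∈ Ω, ∀ v, fderiv ℝ (fun z => (l z).im) z v = (v * (z - a)⁻¹).im := by
    intro z hz v
    have h1 : HasFDerivAt l (mulL (z - a)⁻¹) z := hasFDerivAt_mulL (hld z hz)
    have h2 := Complex.imCLM.hasFDerivAt.comp z h1
    have h3 : fderiv ℝ (fun z => (l z).im) z = Complex.imCLM.comp (mulL (z - a)⁻¹) := h2.fderiv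
    rw [h3]
    simp [mulL_apply, mul_comm]
  have hdB : ContDiff ℝ 1 (fderiv ℝ B) := hB.fderiv_right (by norm_num)
  have hdBc : HasCompactSupport (fderiv ℝ B) := hBc.fderiv (𝕜 := ℝ)
  have hv : ∀ v : ℂ, ContDiff ℝ 1 (fun z => fderiv ℝ B z v) ∧
      HasCompactSupport (fun z => fderiv ℝ B z v) ∧ tsupport (fun z => fderiv ℝ B z v) ⊆ Ω := by
    intro v
    have hsub : Function.support (fun z => fderiv ℝ B z v) ⊆ Function.support (fderiv ℝ B) := by
      intro z hz h
      apply hz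
      have h0 : fderiv ℝ B z = 0 := h
      simp [h0]
    refine ⟨hdB.clm_apply contDiff_const, ?_, (closure_mono hsub).trans hs⟩
    exact hdBc.mono hsub
  obtain ⟨i1, i2, i3⟩ := integral_fderiv_mul_local hΩ (hv 1).1 (hv 1).2.1 (hv 1).2.2 hlC Complex.I
  obtain ⟨j1, j2, j3⟩ := integral_fderiv_mul_local hΩ (hv Complex.I).1 (hv Complex.I).2.1
    (hv Complex.I).2.2 hlC 1
  have hsym : ∀ z, fderiv ℝ (fun z => fderiv ℝ B z 1) z Complex.I
      = fderiv ℝ (fun z => fderiv ℝ B z Complex.I) z 1 := by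
    intro z
    have hd : DifferentiableAt ℝ (fderiv ℝ B) z := hdB.differentiable (by norm_num) z
    rw [fderiv_clm_apply hd (differentiableAt_const _), fderiv_clm_apply hd (differentiableAt_const _)]
    have : IsSymmSndFDerivAt ℝ B z := hB.contDiffAt.isSymmSndFDerivAt (by simp)
    simpa using this Complex.I 1
  have heq : ∫ z, fderiv ℝ B z ((starRingEnd ℂ (z - a))⁻¹) =
      (∫ z, fderiv ℝ B z 1 * fderiv ℝ (fun z => (l z).im) z Complex.I)
      - ∫ z, fderiv ℝ B z Complex.I * fderiv ℝ (fun z => (l z).im) z 1 := by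
    rw [← integral_sub i2 j2]
    congr 1
    ext z
    by_cases hz : fderiv ℝ B z = 0
    · simp [hz]
    · have hzΩ : z ∈ Ω := hs (subset_tsupport _ hz)
      rw [hθ z hzΩ, hθ z hzΩ]
      have hdec : (starRingEnd ℂ (z - a))⁻¹ = ((Complex.I * (z - a)⁻¹).im : ℝ) • (1 : ℂ)
          + (-(1 * (z - a)⁻¹).im : ℝ) • Complex.I := by
        generalize z - a = q
        apply Complex.ext
        · simp
        · simp; ring
      rw [hdec, map_add, map_smul, map_smul, smul_eq_mul, smul_eq_mul]
      ring
  have hz : (∫ z, fderiv ℝ B z 1 * fderiv ℝ (fun z => (l z).im) z Complex.I)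
      - ∫ z, fderiv ℝ B z Complex.I * fderiv ℝ (fun z => (l z).im) z 1 = 0 := by
    have : ∫ z, fderiv ℝ (fun z => fderiv ℝ B z 1) z Complex.I * (l z).im =
        ∫ z, fderiv ℝ (fun z => fderiv ℝ B z Complex.I) z 1 * (l z).im := by
      congr 1; ext z; rw [hsym z]
    rw [i3, j3] at this
    linarith
  rw [hp, heq, hz, mul_zero]

/-- Decomposition of a regular superlevel set. -/
theorem level_decomp {Ω : Set ℂ} (hΩ : IsOpen Ω) (hsc : IsSimplyConnected Ω) {u : ℂ → ℝ}
    (hu : ContDiff ℝ 3 u) (hc : HasCompactSupport u) (hsu : tsupport u ⊆ Ω) {t : ℝ} (ht : 0 < t)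
    (hreg : ∀ y, u y = t → fderiv ℝ u y ≠ 0) :
    ∃ (n : ℕ) (Γ N G : Fin n → Set ℂ) (s : Fin n → ℝ), (∀ i, IsCompact (Γ i)) ∧
      (∀ i, s i = 1 ∨ s i = -1) ∧ (∀ i, IsOpen (G i)) ∧ (∀ i, Bornology.IsBounded (G i)) ∧
      (∀ i, Disjoint (G i) (Γ i)) ∧ (∀ i, frontier (G i) ⊆ Γ i) ∧
      (∀ i, IsPreconnected (G i ∪ Γ i)ᶜ) ∧ (∀ i, IsOpen (N i)) ∧
      (∀ i j, i ≠ j → Disjoint (N i) (N j)) ∧ (∀ i, N i ∩ {y | u y = t} = Γ i) ∧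
      (∀ i, ∀ z ∈ N i, u z ≠ t → (z ∈ G i ↔ 0 < s i * (u z - t))) ∧ (∀ i, G i ⊆ Ω) ∧
      (∀ z, u z = t → ∃ i, z ∈ N i) ∧ ∀ z, u z ≠ t → ∑ i, s i * (G i).indicator (fun _ => (1 : ℝ)) z
        = {y | t < u y}.indicator (fun _ => (1 : ℝ)) z := by
  classical
  obtain ⟨n, Γ, N, hΓc, hΓp, hΓn, hNo, hNd, hNΓ, hΓU⟩ :=
    level_components (hu.of_le (by norm_num)) hc ht hreg
  have hucont := hu.continuous
  obtain ⟨c, hc0, hct, hcov⟩ : ∃ c, 0 < c ∧ c < t ∧ ∀ z, |u z - t| ≤ c → ∃ i, z ∈ N i := by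
    let K : Set ℂ := {y | t / 2 ≤ u y} \ ⋃ i, N i
    have hK : IsCompact K := IsCompact.diff (level_compact hucont hc (half_pos ht)) (isOpen_iUnion hNo)
    have hcont : Continuous fun z => |u z - t| := by fun_prop
    have hpos : ∀ z ∈ K, 0 < |u z - t| := by
      intro z hz
      rw [abs_pos, sub_ne_zero]
      intro h
      have : z ∈ ⋃ i, Γ i := by rw [← hΓU]; exact h
      obtain ⟨i, hi⟩ := Set.mem_iUnion.mp this
      rw [← hNΓ i] at hi
      exact hz.2 (Set.mem_iUnion.mpr ⟨i, hi.1⟩)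
    obtain ⟨c0, hc0, hc1⟩ : ∃ c0 > 0, ∀ z ∈ K, c0 ≤ |u z - t| := by
      rcases K.eq_empty_or_nonempty with h | h
      · exact ⟨1, one_pos, by rw [h]; simp⟩
      · obtain ⟨z, hz, hm⟩ := hK.exists_isMinOn h hcont.continuousOn
        exact ⟨_, hpos z hz, fun y hy => hm hy⟩
    refine ⟨min (c0 / 2) (t / 2), by positivity, ?_, ?_⟩
    · exact (min_le_right _ _).trans_lt (by linarith)
    · intro z hz
      by_contra hno
      have h1 : t / 2 ≤ u z := by
        have := (abs_le.mp (hz.trans (min_le_right _ _))).1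
        linarith
      have := hc1 z ⟨h1, fun h => hno (Set.mem_iUnion.mp h)⟩
      have := hz.trans (min_le_left _ _)
      linarith
  let β : ℝ → ℝ := fun r => Real.smoothTransition ((r - t + c) / (2 * c))
  have hβ : ContDiff ℝ 3 β := Real.smoothTransition.contDiff.comp (by fun_prop)
  have hβ0 : ∀ r, r ≤ t - c → β r = 0 := fun r hr =>
    Real.smoothTransition.zero_of_nonpos (div_nonpos_of_nonpos_of_nonneg (by linarith) (by linarith))
  have hβ1 : ∀ r, t + c ≤ r → β r = 1 := fun r hr =>
    Real.smoothTransition.one_of_one_le (by rw [le_div_iff₀ (by linarith)]; linarith)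
  have hg : ContDiff ℝ 3 (fun z => β (u z)) := hβ.comp hu
  have hgc : HasCompactSupport (fun z => β (u z)) :=
    hc.comp_left (g := β) (hβ0 0 (by linarith))
  have hg0 : ∀ z, (∀ i, z ∉ N i) → fderiv ℝ (fun z => β (u z)) z = 0 := by
    intro z hz
    have hno' : c < |u z - t| := by
      by_contra h
      obtain ⟨i, hi⟩ := hcov z (not_lt.mp h)
      exact hz i hi
    rcases lt_abs.mp hno' with h | h
    · have : (fun z => β (u z)) =ᶠ[nhds z] fun _ => 1 := by
        have ho : IsOpen {z | t + c < u z} := isOpen_lt continuous_const hucont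
        filter_upwards [ho.mem_nhds (show t + c < u z by linarith)] with y hy
        exact hβ1 _ (le_of_lt hy)
      rw [this.fderiv_eq]; simp
    · have : (fun z => β (u z)) =ᶠ[nhds z] fun _ => 0 := by
        have ho : IsOpen {z | u z < t - c} := isOpen_lt hucont continuous_const
        filter_upwards [ho.mem_nhds (show u z < t - c by linarith)] with y hy
        exact hβ0 _ (le_of_lt hy)
      rw [this.fderiv_eq]; simp
  have hreg' := fun i => component_region hu hc hc0 hct hreg (hΓc i) (hΓp i) (hΓn i) (hNo i)
    (N' := ⋃ j : {j // j ≠ i}, N j.1) (isOpen_iUnion fun j => hNo _)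
    (Set.disjoint_iUnion_right.mpr fun j => hNd i j.1 j.2.symm) (hNΓ i) (by
      intro z hz
      obtain ⟨j, hj⟩ := hcov z hz
      by_cases h : j = i
      · subst h; exact Or.inl hj
      · exact Or.inr (Set.mem_iUnion.mpr ⟨⟨j, h⟩, hj⟩)) hβ hβ0 hβ1
  choose B s G N2 hBC hBc hBd hs hGo hGb hGd hGf hGp hN2o hN2Γ hN2N hN2G hb using hreg'
  -- sum of the primitives
  have huniq : ∀ z j, z ∈ N j → ∀ i, i ≠ j → z ∉ N i :=
    fun z j hj i hij h => Set.disjoint_left.mp (hNd i j hij) h hj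
  have hsumN : ∀ {E : Type} [AddCommMonoid E] (F : ℂ → E) z j, z ∈ N j →
      ∑ i, (N i).indicator F z = F z := by
    intro E _ F z j hj
    rw [Finset.sum_eq_single j, Set.indicator_of_mem hj]
    · intro i _ hij
      exact Set.indicator_of_notMem (huniq z j hj i hij) _
    · simp
  have hBsum : ∀ z, ∑ i, B i z = β (u z) := by
    have hd : ∀ z, HasFDerivAt (fun z => ∑ i, B i z - β (u z)) (0 : ℂ →L[ℝ] ℝ) z := by
      intro z
      have h1 := (HasFDerivAt.fun_sum (u := Finset.univ) fun i _ => hBd i z).sub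
        ((hg.differentiable (by norm_num) z).hasFDerivAt)
      suffices hz0 : ∑ i, (N i).indicator (fderiv ℝ fun z => β (u z)) z
          - fderiv ℝ (fun z => β (u z)) z = 0 by
        rw [hz0] at h1; exact h1
      by_cases h : ∃ j, z ∈ N j
      · obtain ⟨j, hj⟩ := h
        rw [hsumN _ z j hj, sub_self]
      · push Not at h
        rw [hg0 z h, sub_zero, Finset.sum_eq_zero]
        exact fun i _ => Set.indicator_of_notMem (h i) _
    have hconst := is_const_of_fderiv_eq_zero (𝕜 := ℝ) (f := fun z => ∑ i, B i z - β (u z))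
      (fun z => (hd z).differentiableAt) (fun z => (hd z).fderiv)
    have hev : ∀ᶠ z in Filter.coclosedCompact ℂ, (∀ i, B i z = 0) ∧ β (u z) = 0 := by
      refine Filter.Eventually.and (Filter.eventually_all.mpr fun i => ?_) ?_
      · exact hasCompactSupport_iff_eventuallyEq.mp (hBc i)
      · exact hasCompactSupport_iff_eventuallyEq.mp hgc
    rw [Filter.coclosedCompact_eq_cocompact] at hev
    obtain ⟨z0, hz0, hz1⟩ := hev.exists
    intro z
    have := hconst z z0
    simp only [hz0, hz1, Finset.sum_const_zero, sub_zero] at this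
    linarith
  refine ⟨n, Γ, N2, G, s, hΓc, hs, hGo, hGb, hGd, hGf, hGp, hN2o, ?_, ?_, hN2G, ?_, ?_, ?_⟩
  · intro i j hij
    exact (hNd i j hij).mono (hN2N i) (hN2N j)
  · intro i
    apply Set.Subset.antisymm
    · rw [← hNΓ i]; exact Set.inter_subset_inter_left _ (hN2N i)
    · intro z hz
      refine ⟨hN2Γ i hz, ?_⟩
      rw [← hNΓ i] at hz; exact hz.2
  · intro i a haG
    by_contra haΩ
    have hua : u a = 0 := image_eq_zero_of_notMem_tsupport fun h => haΩ (hsu h)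
    have hB0 : B i a = 0 := by
      refine primitive_outside hΩ hsc (hBC i) (hBc i) ?_ haΩ
      refine Set.Subset.trans ?_ hsu
      have h1 : tsupport (fderiv ℝ (B i)) ⊆ tsupport (fderiv ℝ (fun z => β (u z))) := by
        refine closure_mono ?_
        intro z hz h
        apply hz
        rw [(hBd i z).fderiv]
        have h : fderiv ℝ (fun z => β (u z)) z = 0 := h
        by_cases hzN : z ∈ N i
        · rw [Set.indicator_of_mem hzN]; exact h
        · exact Set.indicator_of_notMem hzN _
      refine h1.trans ((tsupport_fderiv_subset ℝ).trans (closure_mono ?_))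
      intro z hz h
      apply hz
      have : u z = 0 := h
      simp only [this]
      exact hβ0 0 (by linarith)
    have haΓ : a ∉ Γ i := fun h => Set.disjoint_left.mp (hGd i) haG h
    have := hb i a haΓ
    rw [hB0, Set.indicator_of_mem haG, Set.indicator_of_notMem (s := N i ∩ {y | t < u y})
      (fun h => by have h2 : t < u a := h.2; linarith)] at this
    have h3 : (N i).indicator (fun z => β (u z)) a = 0 := by
      by_cases hzN : a ∈ N i
      · rw [Set.indicator_of_mem hzN, hua]; exact hβ0 0 (by linarith)
      · exact Set.indicator_of_notMem hzN _
    rw [h3] at this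
    rcases hs i with h | h <;> rw [h] at this <;> norm_num at this
  · intro z hz
    have : z ∈ ⋃ i, Γ i := by rw [← hΓU]; exact hz
    obtain ⟨i, hi⟩ := Set.mem_iUnion.mp this
    exact ⟨i, hN2Γ i hi⟩
  · intro z hz
    have hzΓ : ∀ i, z ∉ Γ i := by
      intro i h
      rw [← hNΓ i] at h
      exact hz h.2
    have h1 : ∑ i, s i * (G i).indicator (fun _ => (1 : ℝ)) z
        = ∑ i, (B i z - (N i).indicator (fun z => β (u z)) z
        + (N i ∩ {y | t < u y}).indicator (fun _ => (1 : ℝ)) z) :=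
      Finset.sum_congr rfl fun i _ => (hb i z (hzΓ i)).symm
    rw [h1, Finset.sum_add_distrib, Finset.sum_sub_distrib, hBsum z]
    by_cases h : ∃ j, z ∈ N j
    · obtain ⟨j, hj⟩ := h
      have h2 : ∑ i, (N i ∩ {y | t < u y}).indicator (fun _ => (1 : ℝ)) z
          = ∑ i, (N i).indicator ({y | t < u y}.indicator (fun _ => (1 : ℝ))) z := by
        refine Finset.sum_congr rfl fun i _ => ?_
        rw [Set.indicator_indicator]
      rw [h2, hsumN _ z j hj, hsumN _ z j hj]; ring
    · push Not at h
      rw [Finset.sum_eq_zero (fun i _ => Set.indicator_of_notMem (h i) _),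
        Finset.sum_eq_zero (fun i _ => Set.indicator_of_notMem (fun h' => h i h'.1) _)]
      have hno' : c < |u z - t| := by
        by_contra h'
        obtain ⟨i, hi⟩ := hcov z (not_lt.mp h')
        exact h i hi
      rcases lt_abs.mp hno' with h' | h'
      · rw [hβ1 _ (by linarith), Set.indicator_of_mem (show z ∈ {y | t < u y} from
          show t < u z by linarith)]; ring
      · rw [hβ0 _ (by linarith), Set.indicator_of_notMem (show z ∉ {y | t < u y} from
          fun h2 => by have h3 : t < u z := h2; linarith)]; ring

theorem level_nbhd {u : ℂ → ℝ} (hu : Continuous u) (hc : HasCompactSupport u) {t : ℝ}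
    (ht : 0 < t) {M : Set ℂ} (hM : IsOpen M) (h : ∀ z, u z = t → z ∈ M) :
    ∃ c, 0 < c ∧ c < t ∧ ∀ z, |u z - t| ≤ c → z ∈ M := by
  let K : Set ℂ := {y | t / 2 ≤ u y} \ M
  have hK : IsCompact K := IsCompact.diff (level_compact hu hc (half_pos ht)) hM
  have hcont : Continuous fun z => |u z - t| := by fun_prop
  have hpos : ∀ z ∈ K, 0 < |u z - t| := by
    intro z hz
    rw [abs_pos, sub_ne_zero]
    intro h'
    exact hz.2 (h z h')
  obtain ⟨c0, hc0, hc1⟩ : ∃ c0 > 0, ∀ z ∈ K, c0 ≤ |u z - t| := by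
    rcases K.eq_empty_or_nonempty with h | h
    · exact ⟨1, one_pos, by rw [h]; simp⟩
    · obtain ⟨z, hz, hm⟩ := hK.exists_isMinOn h hcont.continuousOn
      exact ⟨_, hpos z hz, fun y hy => hm hy⟩
  refine ⟨min (c0 / 2) (t / 2), by positivity, ?_, ?_⟩
  · exact (min_le_right _ _).trans_lt (by linarith)
  · intro z hz
    by_contra hno
    have h1 : t / 2 ≤ u z := by
      have := (abs_le.mp (hz.trans (min_le_right _ _))).1
      linarith
    have := hc1 z ⟨h1, hno⟩
    have := hz.trans (min_le_left _ _)
    linarith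

theorem cone_point {u : ℂ → ℝ} (hu : ContDiff ℝ 1 u) (hc : HasCompactSupport u) {t : ℝ}
    {x : ℂ} (hx : u x = t) (hreg : fderiv ℝ u x ≠ 0) {s : ℝ} (hs : s ≠ 0)
    {N G Γ : Set ℂ} (hN : IsOpen N) (hxN : x ∈ N) (hNΓ : N ∩ {y | u y = t} = Γ)
    (hG : ∀ z ∈ N, u z ≠ t → (z ∈ G ↔ 0 < s * (u z - t))) :
    ∃ c > 0, ∃ xs : ℕ → ℂ, Filter.Tendsto xs Filter.atTop (nhds x) ∧
      (∀ n, xs n ∉ G ∪ Γ) ∧ ∀ n, ∀ y ∈ Γ, c * ‖x - y‖ ≤ ‖xs n - y‖ := by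
  obtain ⟨M, hM⟩ := ContDiff.lipschitzWith_of_hasCompactSupport hc hu (by simp)
  obtain ⟨v0, hv0⟩ : ∃ v, fderiv ℝ u x v ≠ 0 := by
    by_contra h
    push Not at h
    exact hreg (by ext v <;> simp [h])
  obtain ⟨v, hv⟩ : ∃ v, s * fderiv ℝ u x v = -1 := by
    refine ⟨(-(s * fderiv ℝ u x v0)⁻¹) • v0, ?_⟩
    rw [map_smul, smul_eq_mul]
    field_simp
  have hd : HasDerivAt (fun r : ℝ => s * (u (x + r • v) - t)) (-1) 0 := by
    have h0 : HasFDerivAt u (fderiv ℝ u x) (x + (0 : ℝ) • v) := by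
      simpa using (hu.differentiable (by simp) x).hasFDerivAt
    have h1 : HasDerivAt (fun r : ℝ => x + r • v) v 0 := by
      simpa using ((hasDerivAt_id (0 : ℝ)).smul_const v).const_add x
    have h2 := ((h0.comp_hasDerivAt (0 : ℝ) h1).sub_const t).const_mul s
    rw [hv] at h2
    exact h2
  have hsl := (hasDerivAt_iff_tendsto_slope_zero.mp hd)
  have hxt : Filter.Tendsto (fun r : ℝ => x + r • v) (nhdsWithin 0 (Set.Ioi 0)) (nhds x) := by
    have : Continuous fun r : ℝ => x + r • v := by fun_prop
    simpa using (this.tendsto 0).mono_left nhdsWithin_le_nhds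
  have hev : ∀ᶠ r in nhdsWithin (0 : ℝ) (Set.Ioi 0), s * (u (x + r • v) - t) ≤ -(r / 2) ∧
      x + r • v ∈ N ∧ 0 < r := by
    have h1 := (hsl.mono_left (nhdsWithin_mono 0 (fun r hr => ne_of_gt hr :
      Set.Ioi (0 : ℝ) ⊆ {0}ᶜ))).eventually (gt_mem_nhds (show (-1 : ℝ) < -(1 / 2) by norm_num))
    filter_upwards [h1, hxt.eventually (hN.mem_nhds hxN), self_mem_nhdsWithin] with r hr1 hr2 hr3
    have hr3 : 0 < r := hr3
    refine ⟨?_, hr2, hr3⟩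
    simp only [zero_add, zero_smul, add_zero, hx, sub_self, mul_zero, sub_zero, smul_eq_mul] at hr1
    rw [inv_mul_lt_iff₀ hr3] at hr1
    linarith
  have hseq : Filter.Tendsto (fun n : ℕ => 1 / ((n : ℝ) + 1)) Filter.atTop
      (nhdsWithin 0 (Set.Ioi 0)) := by
    refine tendsto_nhdsWithin_iff.mpr ⟨tendsto_one_div_add_atTop_nhds_zero_nat, ?_⟩
    exact Filter.Eventually.of_forall fun n => show (0 : ℝ) < 1 / ((n : ℝ) + 1) by positivity
  obtain ⟨n0, hn0⟩ := Filter.eventually_atTop.mp (hseq.eventually hev)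
  set C : ℝ := 1 + 2 * |s| * M * ‖v‖ with hC
  have hCpos : 0 < C := by
    have : 0 ≤ 2 * |s| * M * ‖v‖ := by positivity
    linarith
  refine ⟨1 / C, by positivity, fun n => x + (1 / (((n + n0 : ℕ) : ℝ) + 1)) • v, ?_, ?_, ?_⟩
  · exact (hxt.comp hseq).comp (Filter.tendsto_add_atTop_nat n0)
  · intro n h
    obtain ⟨h1, h2, h3⟩ := hn0 (n + n0) (by omega)
    have hne : u (x + (1 / (((n + n0 : ℕ) : ℝ) + 1)) • v) ≠ t := by
      intro h'
      rw [h', sub_self, mul_zero] at h1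
      linarith
    rcases h with h | h
    · have := (hG _ h2 hne).mp h
      linarith
    · rw [← hNΓ] at h
      exact hne h.2
  · intro n y hy
    obtain ⟨h1, h2, h3⟩ := hn0 (n + n0) (by omega)
    set r := 1 / (((n + n0 : ℕ) : ℝ) + 1)
    have huy : u y = t := by rw [← hNΓ] at hy; exact hy.2
    have hlip : |u (x + r • v) - t| ≤ M * ‖x + r • v - y‖ := by
      have := hM.dist_le_mul (x + r • v) y
      rwa [Real.dist_eq, dist_eq_norm, huy] at this
    have h4 : r / 2 ≤ |s| * |u (x + r • v) - t| := by
      rw [← abs_mul]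
      exact le_trans (by linarith) (neg_le_abs _)
    have h5 : r ≤ 2 * |s| * M * ‖x + r • v - y‖ := by
      have := mul_le_mul_of_nonneg_left hlip (abs_nonneg s)
      linarith
    have h6 : ‖x - y‖ ≤ ‖x + r • v - y‖ + r * ‖v‖ := by
      have : x - y = (x + r • v - y) - r • v := by ring
      rw [this]
      refine (norm_sub_le _ _).trans ?_
      rw [norm_smul, Real.norm_eq_abs, abs_of_pos h3]
    rw [one_div, inv_mul_le_iff₀ hCpos, hC]
    have := mul_le_mul_of_nonneg_right h5 (norm_nonneg v)
    linarith

open Laplacian in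
theorem exists_holo {Ω U : Set ℂ} (hU : IsOpen U) (hΩU : Ω ⊆ U) {w : ℂ → ℝ}
    (hw : ContDiffOn ℝ 2 w U) {u : ℂ → ℝ} (hu : ContDiff ℝ 3 u) (hc : HasCompactSupport u)
    (hsu : tsupport u ⊆ Ω) {t : ℝ} (ht : 0 < t) (hreg : ∀ y, u y = t → fderiv ℝ u y ≠ 0)
    (hnull : volume {y | u y = t} = 0) {s : ℝ} (hs : s ≠ 0)
    {N G Γ : Set ℂ} (hN : IsOpen N) (hNΓ : N ∩ {y | u y = t} = Γ)
    (hG : ∀ z ∈ N, u z ≠ t → (z ∈ G ↔ 0 < s * (u z - t))) (hΓ : IsCompact Γ)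
    (hbd : Bornology.IsBounded G) (hdisj : Disjoint G Γ) (hfr : frontier G ⊆ Γ)
    (hV : IsPreconnected (G ∪ Γ)ᶜ) {ε : ℝ} (hε : 0 < ε) :
    ∃ (f : ℂ → ℂ) (h : ℂ → ℝ), Differentiable ℂ f ∧ (∀ z, deriv f z ≠ 0) ∧ ContDiff ℝ 2 h ∧
      (∀ y, ‖deriv f y‖ ^ 2 = exp (h y)) ∧ (∀ y, Δ h y = 0) ∧
      ∀ y ∈ Γ, w y ≤ h y ∧ h y ≤ w y + 2 * ε := by
  have hΓu : ∀ x ∈ Γ, x ∈ N ∧ u x = t := by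
    intro x hx; rw [← hNΓ] at hx; exact hx
  let γ : ℝ → ℝ := fun r => Real.smoothTransition ((r - t / 2) / (t / 2))
  have hγ : ContDiff ℝ 3 γ := Real.smoothTransition.contDiff.comp (by fun_prop)
  have hγ0 : γ 0 = 0 := Real.smoothTransition.zero_of_nonpos
    (div_nonpos_of_nonpos_of_nonneg (by linarith) (by linarith))
  have hγ1 : γ t = 1 := Real.smoothTransition.one_of_one_le
    (by rw [le_div_iff₀ (by linarith)]; linarith)
  have hz : ∀ z, z ∉ tsupport u → γ (u z) = 0 := by
    intro z hz
    rw [image_eq_zero_of_notMem_tsupport hz, hγ0]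
  have hψ : ContDiff ℝ 1 (fun z => γ (u z) * w z) := by
    rw [contDiff_iff_contDiffAt]
    intro z
    by_cases hzu : z ∈ tsupport u
    · have hzU : z ∈ U := hΩU (hsu hzu)
      exact ((hγ.comp hu).contDiffAt.of_le (by norm_num)).mul
        ((hw.contDiffAt (hU.mem_nhds hzU)).of_le (by norm_num))
    · refine (contDiffAt_const (c := (0 : ℝ))).congr_of_eventuallyEq ?_
      filter_upwards [(isClosed_tsupport u).isOpen_compl.mem_nhds hzu] with y hy
      rw [hz y hy, zero_mul]
  have hψc : HasCompactSupport (fun z => γ (u z) * w z) := by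
    have : HasCompactSupport (fun z => γ (u z)) := hc.comp_left (g := γ) hγ0
    exact this.mul_right
  obtain ⟨P, hP⟩ := walsh_lebesgue hΓ
    (measure_mono_null (fun x hx => (hΓu x hx).2) hnull) hbd hdisj hfr hV
    (fun x hx => cone_point (hu.of_le (by norm_num)) hc (hΓu x hx).2 (hreg x (hΓu x hx).2) hs hN
      (hΓu x hx).1 hNΓ hG) hψ hψc ε hε
  let E : ℂ → ℂ := fun z => P.eval z + ε
  have hE : Differentiable ℂ E := P.differentiable.add_const _
  obtain ⟨f, hf⟩ := (show Differentiable ℂ (fun z => Complex.exp (E z / 2)) from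
    (hE.div_const 2).cexp).isExactOn_univ
  have hfd : ∀ z, HasDerivAt f (Complex.exp (E z / 2)) z := fun z => hf z trivial
  have hharm : ∀ z, InnerProductSpace.HarmonicAt (fun z => (E z).re) z := by
    intro z
    exact (hE.analyticAt z).harmonicAt_re
  refine ⟨f, fun z => (E z).re, fun z => (hfd z).differentiableAt, ?_, ?_, ?_, ?_, ?_⟩
  · intro z
    rw [(hfd z).deriv]
    exact Complex.exp_ne_zero _
  · rw [contDiff_iff_contDiffAt]
    exact fun z => (hharm z).1
  · intro y
    rw [(hfd y).deriv, Complex.norm_exp, ← Real.exp_nat_mul]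
    congr 1
    rw [show E y / 2 = E y / ((2 : ℝ) : ℂ) by norm_num, Complex.div_ofReal_re]
    push_cast; ring
  · intro y
    exact (hharm y).2.self_of_nhds
  · intro y hy
    have h1 := abs_le.mp (hP y hy)
    rw [(hΓu y hy).2, hγ1, one_mul] at h1
    have h2 : (E y).re = (P.eval y).re + ε := by simp [E]
    simp only [h2]
    constructor <;> linarith [h1.1, h1.2]

theorem bddIntOn {h : ℂ → ℝ} (hh : Continuous h) {S : Set ℂ} (hS : Bornology.IsBounded S) :
    IntegrableOn h S := by
  have h1 : IsCompact (closure S) := hS.isCompact_closure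
  exact (hh.continuousOn.integrableOn_compact h1).mono_set subset_closure

theorem ramp_ineq {f : ℂ → ℂ} {h w u : ℂ → ℝ} (hf : Differentiable ℂ f) (hf' : ∀ z, deriv f z ≠ 0)
    (hh : Continuous h) (hfh : ∀ y, ‖deriv f y‖ ^ 2 = exp (h y))
    (hu : ContDiff ℝ 1 u) (hc : HasCompactSupport u) {t : ℝ} (ht : 0 < t)
    (h_intg : Integrable (fun z => ‖fderiv ℝ u z‖ * exp (w z / 2))) {s : ℝ} (hs : s = 1 ∨ s = -1)
    {N N' G Γ : Set ℂ} (hN : IsOpen N) (hN' : IsOpen N') (hd : Disjoint N N')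
    (hNΓ : N ∩ {y | u y = t} = Γ)
    (hG : ∀ z ∈ N, u z ≠ t → (z ∈ G ↔ 0 < s * (u z - t)))
    (hGo : IsOpen G) (hbd : Bornology.IsBounded G) (hfr : frontier G ⊆ Γ)
    {c q ε : ℝ} (hcov : ∀ z, |u z - t| ≤ c → z ∈ N ∪ N')
    (hq : ∀ z ∈ N, |u z - t| ≤ c → h z ≤ w z + q) (hε : 0 < ε) (hεc : ε ≤ c) (hε1 : ε ≤ 1) :
    2 * √π * ((1 - ε) * ((∫ y in G, exp (h y)) - ∫ y in {y | t ≤ u y ∧ u y ≤ t + ε}, exp (h y))) ≤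
      √((∫ y in G, exp (h y)) + ∫ y in {y | t ≤ u y ∧ u y ≤ t + ε}, exp (h y)) *
      (exp (q / 2) * (1 / ε * ∫ z in N ∩ {z | t < u z ∧ u z < t + ε},
        ‖fderiv ℝ u z‖ * exp (w z / 2))) := by
  classical
  have hucont := hu.continuous
  obtain ⟨β, hβC, hβ0, hβ1, hβ01, hβκ, hβd, hβd0⟩ := exists_ramp hε t hε
  set κ := β (t + ε) with hκ
  have hκ0 : 0 ≤ κ := (hβ01 _).1
  have hmono : Monotone β := monotone_of_deriv_nonneg (hβC.differentiable (by simp))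
    fun x => (hβd x).1
  have hβle : ∀ r, β r ≤ κ := by
    intro r
    rcases le_total r (t + ε) with h | h
    · exact hmono h
    · rw [hβ1 r h]
  set T : Set ℂ := {y | t ≤ u y ∧ u y ≤ t + ε} with hT
  have hTc : IsClosed T := (isClosed_le continuous_const hucont).inter
    (isClosed_le hucont continuous_const)
  have hTb : Bornology.IsBounded T :=
    (level_compact hucont hc ht).isBounded.subset fun z hz => hz.1
  let η : ℂ → ℝ := fun z => if z ∈ N then κ * (1 - s) / 2 + s * β (u z)
    else κ * G.indicator (fun _ => (1 : ℝ)) z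
  have hηT : ∀ z, z ∉ T → η z = κ * G.indicator (fun _ => (1 : ℝ)) z := by
    intro z hz
    by_cases hzN : z ∈ N
    · simp only [η, if_pos hzN]
      rcases lt_or_ge (u z) t with h1 | h1
      · rw [hβ0 _ h1.le]
        rcases hs with rfl | rfl
        · have : z ∉ G := fun hg => by
            have := (hG z hzN h1.ne).mp hg
            linarith
          rw [Set.indicator_of_notMem this]; ring
        · have : z ∈ G := (hG z hzN h1.ne).mpr (by linarith)
          rw [Set.indicator_of_mem this]; ring
      · have h2 : t + ε < u z := by
          by_contra h3
          exact hz ⟨h1, not_lt.mp h3⟩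
        have hne : u z ≠ t := by linarith
        rw [hβ1 _ h2.le]
        rcases hs with rfl | rfl
        · have : z ∈ G := (hG z hzN hne).mpr (by linarith)
          rw [Set.indicator_of_mem this]; ring
        · have : z ∉ G := fun hg => by
            have := (hG z hzN hne).mp hg
            linarith
          rw [Set.indicator_of_notMem this]; ring
    · simp only [η, if_neg hzN]
  have hηconst : ∀ z, z ∉ N → ∃ k, η =ᶠ[nhds z] fun _ => k := by
    intro z hzN
    have h1 : ∀ᶠ y in nhds z, η y = κ * G.indicator (fun _ => (1 : ℝ)) y := by
      by_cases hzT : z ∈ T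
      · have hzN' : z ∈ N' := (hcov z (by
          rw [abs_of_nonneg (by linarith [hzT.1])]
          linarith [hzT.2])).resolve_left hzN
        filter_upwards [hN'.mem_nhds hzN'] with y hy
        have : y ∉ N := fun h => Set.disjoint_left.mp hd h hy
        simp only [η, if_neg this]
      · filter_upwards [hTc.isOpen_compl.mem_nhds hzT] with y hy
        exact hηT y hy
    have hzΓ : z ∉ Γ := fun h => hzN (by rw [← hNΓ] at h; exact h.1)
    by_cases hzG : z ∈ G
    · refine ⟨κ, ?_⟩
      filter_upwards [h1, hGo.mem_nhds hzG] with y hy1 hy2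
      rw [hy1, Set.indicator_of_mem hy2, mul_one]
    · have hzc : z ∉ closure G := by
        rw [closure_eq_self_union_frontier]
        rintro (h | h)
        · exact hzG h
        · exact hzΓ (hfr h)
      refine ⟨0, ?_⟩
      filter_upwards [h1, isClosed_closure.isOpen_compl.mem_nhds hzc] with y hy1 hy2
      rw [hy1, Set.indicator_of_notMem (fun h => hy2 (subset_closure h)), mul_zero]
  have hηN : ∀ z ∈ N, η =ᶠ[nhds z] fun z => κ * (1 - s) / 2 + s * β (u z) := by
    intro z hz
    filter_upwards [hN.mem_nhds hz] with y hy
    simp only [η, if_pos hy]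
  have hηC : ContDiff ℝ 1 η := by
    rw [contDiff_iff_contDiffAt]
    intro z
    by_cases hz : z ∈ N
    · refine ContDiffAt.congr_of_eventuallyEq ?_ (hηN z hz)
      exact (contDiff_const.add (contDiff_const.mul (hβC.comp hu))).contDiffAt
    · obtain ⟨k, hk⟩ := hηconst z hz
      exact contDiffAt_const.congr_of_eventuallyEq hk
  have hη0 : ∀ z, 0 ≤ η z := by
    intro z
    by_cases hz : z ∈ N
    · simp only [η, if_pos hz]
      have h1 := hβle (u z)
      have h2 := (hβ01 (u z)).1
      rcases hs with rfl | rfl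
      · linarith
      · linarith
    · simp only [η, if_neg hz]
      exact mul_nonneg hκ0 (Set.indicator_nonneg (fun _ _ => zero_le_one) _)
  have hsupp : {y | η y ≠ 0} ⊆ G ∪ T := by
    intro z hz
    by_contra hno
    apply hz
    rw [hηT z fun h => hno (Or.inr h), Set.indicator_of_notMem fun h => hno (Or.inl h), mul_zero]
  have hηc : HasCompactSupport η := by
    refine HasCompactSupport.of_support_subset_isCompact (hbd.union hTb).isCompact_closure ?_
    exact hsupp.trans subset_closure
  have hfl := flat_isoperimetric hf hf' hηC hηc
  simp only [hfh] at hfl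
  have hec : Continuous fun y => exp (h y) := hh.rexp
  have iG := bddIntOn hec hbd
  have iT := bddIntOn hec hTb
  have hle : (1 - ε) * ((∫ y in G, exp (h y)) - ∫ y in T, exp (h y)) ≤ ∫ y, η y * exp (h y) := by
    have e1 : (∫ y in G, exp (h y)) ≤ (∫ y in G \ T, exp (h y)) + ∫ y in T, exp (h y) := by
      rw [← setIntegral_union Set.disjoint_sdiff_left hTc.measurableSet
        (iG.mono_set Set.sdiff_subset) iT]
      refine setIntegral_mono_set ((iG.union iT).mono_set ?_) ?_ ?_
      · exact Set.union_subset (Set.sdiff_subset.trans Set.subset_union_left) Set.subset_union_right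
      · exact Filter.Eventually.of_forall fun y => (exp_pos _).le
      · refine Filter.Eventually.of_forall fun y hy => ?_
        by_cases hyT : y ∈ T
        · exact Or.inr hyT
        · exact Or.inl ⟨hy, hyT⟩
    have e2 : κ * ∫ y in G \ T, exp (h y) ≤ ∫ y, η y * exp (h y) := by
      rw [← integral_const_mul, ← integral_indicator (hGo.measurableSet.diff hTc.measurableSet)]
      refine integral_mono_of_nonneg ?_ ?_ ?_
      · exact Filter.Eventually.of_forall fun y => Set.indicator_nonneg
          (fun _ _ => mul_nonneg hκ0 (exp_pos _).le) _
      · exact ((hηC.continuous.mul hec).integrable_of_hasCompactSupport hηc.mul_right)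
      · refine Filter.Eventually.of_forall fun y => ?_
        by_cases hy : y ∈ G \ T
        · simp only [Set.indicator_of_mem hy, hηT y hy.2, Set.indicator_of_mem hy.1, mul_one]
          exact le_rfl
        · simp only [Set.indicator_of_notMem hy]
          exact mul_nonneg (hη0 y) (exp_pos _).le
    have e3 : 0 ≤ ∫ y in G \ T, exp (h y) := integral_nonneg fun y => (exp_pos _).le
    calc _ ≤ (1 - ε) * ∫ y in G \ T, exp (h y) :=
          mul_le_mul_of_nonneg_left (by linarith) (by linarith)
      _ ≤ κ * ∫ y in G \ T, exp (h y) := mul_le_mul_of_nonneg_right hβκ e3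
      _ ≤ _ := e2
  have hS : (∫ y in {y | η y ≠ 0}, exp (h y)) ≤ (∫ y in G, exp (h y)) + ∫ y in T, exp (h y) := by
    have h1 : (∫ y in {y | η y ≠ 0}, exp (h y)) ≤ ∫ y in G ∪ (T \ G), exp (h y) := by
      refine setIntegral_mono_set ((iG.union iT).mono_set ?_) ?_ ?_
      · exact Set.union_subset_union_right _ Set.sdiff_subset
      · exact Filter.Eventually.of_forall fun y => (exp_pos _).le
      · refine Filter.Eventually.of_forall fun y hy => ?_
        have := hsupp hy
        rw [← Set.union_sdiff_self] at this
        exact this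
    rw [setIntegral_union Set.disjoint_sdiff_right (hTc.measurableSet.diff hGo.measurableSet) iG
      (iT.mono_set Set.sdiff_subset)] at h1
    have h2 : (∫ y in T \ G, exp (h y)) ≤ ∫ y in T, exp (h y) :=
      setIntegral_mono_set iT (Filter.Eventually.of_forall fun y => (exp_pos _).le)
        (Filter.Eventually.of_forall fun y hy => hy.1)
    linarith
  have hL : ∫ y, ‖fderiv ℝ η y‖ * ‖deriv f y‖ ≤ exp (q / 2) * (1 / ε *
      ∫ z in N ∩ {z | t < u z ∧ u z < t + ε}, ‖fderiv ℝ u z‖ * exp (w z / 2)) := by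
    have hop : IsOpen {z | t < u z ∧ u z < t + ε} :=
      (isOpen_lt continuous_const hucont).inter (isOpen_lt hucont continuous_const)
    have hms := (hN.inter hop).measurableSet
    rw [← integral_const_mul, ← integral_const_mul, ← integral_indicator hms]
    refine integral_mono_of_nonneg (Filter.Eventually.of_forall fun y => by positivity) ?_ ?_
    · rw [integrable_indicator_iff hms]
      exact ((h_intg.const_mul _).const_mul _).integrableOn
    · refine Filter.Eventually.of_forall fun z => ?_
      show ‖fderiv ℝ η z‖ * ‖deriv f z‖ ≤ _
      by_cases hz : z ∈ N
      · have hfd : fderiv ℝ η z = s • (deriv β (u z) • fderiv ℝ u z) := by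
          rw [(hηN z hz).fderiv_eq]
          have h1 : HasFDerivAt (fun z => β (u z)) (deriv β (u z) • fderiv ℝ u z) z :=
            (hβC.differentiable (by simp) (u z)).hasDerivAt.comp_hasFDerivAt z
              (hu.differentiable (by simp) z).hasFDerivAt
          exact ((h1.const_mul s).const_add _).fderiv
        have hns : ‖s‖ = 1 := by rcases hs with rfl | rfl <;> simp
        rw [hfd, norm_smul, norm_smul, hns, one_mul, Real.norm_eq_abs, abs_of_nonneg (hβd _).1]
        by_cases hzu : t < u z ∧ u z < t + ε
        · rw [Set.indicator_of_mem (show z ∈ N ∩ {z | t < u z ∧ u z < t + ε} from ⟨hz, hzu⟩)]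
          have hfn : ‖deriv f z‖ ≤ exp (q / 2) * exp (w z / 2) := by
            have h1 : ‖deriv f z‖ ^ 2 ≤ (exp (q / 2) * exp (w z / 2)) ^ 2 := by
              rw [hfh, ← Real.exp_add, ← Real.exp_nat_mul]
              apply Real.exp_le_exp.mpr
              have := hq z hz (by rw [abs_of_pos (by linarith [hzu.1])]; linarith [hzu.2])
              push_cast; linarith
            exact (sq_le_sq₀ (norm_nonneg _) (by positivity)).mp h1
          have h2 := (hβd (u z)).2
          have h3 := (hβd (u z)).1
          calc deriv β (u z) * ‖fderiv ℝ u z‖ * ‖deriv f z‖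
              ≤ (1 / ε) * ‖fderiv ℝ u z‖ * (exp (q / 2) * exp (w z / 2)) := by gcongr
            _ = _ := by ring
        · rw [hβd0 _ hzu]
          simp only [zero_mul]
          exact Set.indicator_nonneg (fun _ _ => by positivity) _
      · obtain ⟨k, hk⟩ := hηconst z hz
        rw [hk.fderiv_eq]
        simp only [fderiv_const_apply, norm_zero, zero_mul]
        exact Set.indicator_nonneg (fun _ _ => by positivity) _
  calc _ ≤ 2 * √π * ∫ y, η y * exp (h y) := mul_le_mul_of_nonneg_left hle (by positivity)
    _ ≤ _ := hfl
    _ ≤ _ := mul_le_mul (Real.sqrt_le_sqrt hS) hL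
        (integral_nonneg fun y => by positivity) (Real.sqrt_nonneg _)

theorem shell_tendsto {u F : ℂ → ℝ} (hu : Continuous u) (hc : HasCompactSupport u) {t : ℝ}
    (ht : 0 < t) (hF : Continuous F) (hnull : volume {y | u y = t} = 0) :
    Filter.Tendsto (fun ε => ∫ y in {y | t ≤ u y ∧ u y ≤ t + ε}, F y) (nhdsWithin 0 (Set.Ioi 0))
      (nhds 0) := by
  have hms : ∀ ε, MeasurableSet {y | t ≤ u y ∧ u y ≤ t + ε} := fun ε =>
    ((isClosed_le continuous_const hu).inter (isClosed_le hu continuous_const)).measurableSet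
  have hK := level_compact hu hc ht
  simp_rw [fun ε => (integral_indicator (μ := volume) (f := F) (hms ε)).symm]
  have e0 : ∫ y : ℂ, (0 : ℝ) = 0 := by simp
  suffices h : Filter.Tendsto (fun ε => ∫ y, {y | t ≤ u y ∧ u y ≤ t + ε}.indicator F y)
    (nhdsWithin 0 (Set.Ioi 0)) (nhds (∫ y : ℂ, (0 : ℝ))) by rwa [e0] at h
  refine tendsto_integral_filter_of_dominated_convergence
    ({y | t ≤ u y}.indicator fun y => |F y|) ?_ ?_ ?_ ?_
  · exact Filter.Eventually.of_forall fun ε =>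
      (hF.aestronglyMeasurable.indicator (hms ε))
  · refine Filter.Eventually.of_forall fun ε => Filter.Eventually.of_forall fun y => ?_
    rw [norm_indicator_eq_indicator_norm]
    exact Set.indicator_le_indicator_of_subset (fun z hz => hz.1) (fun _ => abs_nonneg _) y
  · rw [integrable_indicator_iff hK.measurableSet]
    exact bddIntOn hF.abs hK.isBounded
  · have : ∀ᵐ y, u y ≠ t := by
      rw [ae_iff]; simpa using hnull
    filter_upwards [this] with y hy
    refine tendsto_const_nhds.congr' ?_
    by_cases h : u y < t
    · refine Filter.Eventually.of_forall fun ε => ?_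
      show (0 : ℝ) = Set.indicator _ _ _
      rw [Set.indicator_of_notMem]
      rintro ⟨h1, -⟩
      linarith
    · have h' : 0 < u y - t := by
        have := lt_of_le_of_ne (not_lt.mp h) (Ne.symm hy); linarith
      have : ∀ᶠ ε in nhdsWithin (0 : ℝ) (Set.Ioi 0), ε < u y - t :=
        mem_nhdsWithin_of_mem_nhds (Iio_mem_nhds h')
      filter_upwards [this] with ε hε
      show (0 : ℝ) = Set.indicator _ _ _
      rw [Set.indicator_of_notMem]
      rintro ⟨-, h2⟩
      have : ε < u y - t := hε
      linarith

open Laplacian in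
theorem component_limit {Ω U : Set ℂ} (hU : IsOpen U) (hΩU : Ω ⊆ U) {w : ℂ → ℝ}
    (hw : ContDiffOn ℝ 2 w U) (hsup : ∀ y ∈ Ω, 0 ≤ Δ w y + exp (w y))
    {u : ℂ → ℝ} (hu : ContDiff ℝ 3 u) (hc : HasCompactSupport u)
    (hsu : tsupport u ⊆ Ω) {t : ℝ} (ht : 0 < t) (hreg : ∀ y, u y = t → fderiv ℝ u y ≠ 0)
    (hnull : volume {y | u y = t} = 0)
    (h_intg : Integrable (fun z => ‖fderiv ℝ u z‖ * exp (w z / 2)))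
    {s : ℝ} (hs : s = 1 ∨ s = -1)
    {N N' G Γ : Set ℂ} (hN : IsOpen N) (hN' : IsOpen N') (hd : Disjoint N N')
    (hNΓ : N ∩ {y | u y = t} = Γ)
    (hG : ∀ z ∈ N, u z ≠ t → (z ∈ G ↔ 0 < s * (u z - t))) (hΓ : IsCompact Γ)
    (hGo : IsOpen G)
    (hbd : Bornology.IsBounded G) (hdisj : Disjoint G Γ) (hfr : frontier G ⊆ Γ)
    (hV : IsPreconnected (G ∪ Γ)ᶜ) (hGΩ : G ⊆ Ω) (hcov : ∀ z, u z = t → z ∈ N ∪ N')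
    {η : ℝ} (hη : 0 < η) :
    ∀ᶠ ε in nhdsWithin 0 (Set.Ioi 0),
      √(4 * π * (∫ y in G, exp (w y)) - (∫ y in G, exp (w y)) ^ 2 / 2) - η ≤
        1 / ε * ∫ z in N ∩ {z | t < u z ∧ u z < t + ε}, ‖fderiv ℝ u z‖ * exp (w z / 2) := by
  set m := ∫ y in G, exp (w y) with hm
  set F := √(4 * π * m - m ^ 2 / 2) with hFdef
  by_cases hFη : F ≤ η
  · filter_upwards [self_mem_nhdsWithin] with ε hε
    have hε : 0 < ε := hε
    have : 0 ≤ 1 / ε * ∫ z in N ∩ {z | t < u z ∧ u z < t + ε}, ‖fderiv ℝ u z‖ * exp (w z / 2) :=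
      mul_nonneg (by positivity) (integral_nonneg fun z => by positivity)
    linarith
  push Not at hFη
  have hF0 : 0 < F := hη.trans hFη
  set q := η / F with hq
  have hq0 : 0 < q := by positivity
  obtain ⟨f, h, hf, hf', hh, hfh, hharm, hΓw⟩ := exists_holo hU hΩU hw hu hc hsu ht hreg hnull
    (s := s) (by rcases hs with rfl | rfl <;> norm_num) hN hNΓ hG hΓ hbd hdisj hfr hV
    (ε := q / 3) (by positivity)
  have hΓΩ : Γ ⊆ Ω := by
    rw [← hNΓ]
    rintro z ⟨-, hz⟩
    apply hsu (subset_tsupport u _)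
    simp only [Set.mem_ofPred_eq] at hz
    simp [Function.mem_support, hz, ht.ne']
  have hcl : closure G ⊆ U := by
    rw [closure_eq_self_union_frontier]
    exact (Set.union_subset hGΩ (hfr.trans hΓΩ)).trans hΩU
  have hbol := inner_bol hGo hbd hU hcl hw (fun y hy => hsup y (hGΩ hy)) hf hf' hh hfh hharm
    (fun y hy => (hΓw y (hfr hy)).1)
  rw [← hm] at hbol
  set a := ∫ y in G, exp (h y) with ha
  have hFsq : F ^ 2 = 4 * π * m - m ^ 2 / 2 := by
    rw [hFdef]; refine Real.sq_sqrt ?_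
    by_contra hneg
    push Not at hneg
    rw [hFdef, Real.sqrt_eq_zero_of_nonpos hneg.le] at hF0
    exact lt_irrefl _ hF0
  have hFa : F ^ 2 ≤ 4 * π * a := by
    rw [hFsq]
    have := mul_le_mul_of_nonneg_left hbol (show 0 ≤ 4 * π by positivity)
    have e : 4 * π * (m - m ^ 2 / (8 * π)) = 4 * π * m - m ^ 2 / 2 := by
      field_simp
      ring
    linarith
  have ha0 : 0 < a := by
    have : 0 < 4 * π * a := lt_of_lt_of_le (by positivity) hFa
    exact pos_of_mul_pos_right this (by positivity)
  -- neighbourhood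
  have hO : IsOpen (U ∩ (fun z => h z - w z) ⁻¹' Set.Iio q) :=
    ContinuousOn.isOpen_inter_preimage ((hh.continuous.continuousOn).sub hw.continuousOn) hU
      isOpen_Iio
  obtain ⟨c, hc0, -, hcM⟩ := level_nbhd hu.continuous hc ht ((hN.inter hO).union hN')
    (fun z hz => by
      rcases hcov z hz with hzN | hzN
      · have hzΓ : z ∈ Γ := by rw [← hNΓ]; exact ⟨hzN, hz⟩
        refine Or.inl ⟨hzN, hΩU (hΓΩ hzΓ), ?_⟩
        have := (hΓw z hzΓ).2
        show h z - w z < q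
        linarith
      · exact Or.inr hzN)
  have hr := shell_tendsto hu.continuous hc ht (Real.continuous_exp.comp hh.continuous) hnull
  simp only [Function.comp_apply] at hr
  set r : ℝ → ℝ := fun ε => ∫ y in {y | t ≤ u y ∧ u y ≤ t + ε}, exp (h y) with hrdef
  have hε0 : Filter.Tendsto (fun ε : ℝ => ε) (nhdsWithin 0 (Set.Ioi 0)) (nhds 0) :=
    nhdsWithin_le_nhds
  have hΦ : Filter.Tendsto (fun ε => 2 * √π * ((1 - ε) * (a - r ε)) / (√(a + r ε) * exp (q / 2)))
      (nhdsWithin 0 (Set.Ioi 0)) (nhds (2 * √π * ((1 - 0) * (a - 0)) / (√(a + 0) * exp (q / 2)))) := by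
    refine Filter.Tendsto.div ?_ ?_ ?_
    · exact ((tendsto_const_nhds.sub hε0).mul (tendsto_const_nhds.sub hr)).const_mul _
    · exact ((tendsto_const_nhds.add hr).sqrt).mul_const _
    · rw [add_zero]; positivity
  have hlim : F - η < 2 * √π * ((1 - 0) * (a - 0)) / (√(a + 0) * exp (q / 2)) := by
    have e : 2 * √π * ((1 - 0) * (a - 0)) / (√(a + 0) * exp (q / 2)) = 2 * √π * √a * exp (-(q / 2)) := by
      rw [Real.exp_neg, add_zero, sub_zero, sub_zero, one_mul]
      have : a = √a * √a := (Real.mul_self_sqrt ha0.le).symm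
      have hs : 0 < √a := Real.sqrt_pos.mpr ha0
      field_simp
      rw [Real.sq_sqrt ha0.le]
    rw [e]
    have h1 : F ≤ 2 * √π * √a := by
      refine (sq_le_sq₀ hF0.le (by positivity)).mp ?_
      rw [mul_pow, mul_pow, Real.sq_sqrt pi_pos.le, Real.sq_sqrt ha0.le]
      linarith
    have h2 : 1 - q / 2 ≤ exp (-(q / 2)) := by
      have := Real.add_one_le_exp (-(q / 2)); linarith
    have h3 : F * (1 - q / 2) ≤ F * exp (-(q / 2)) := mul_le_mul_of_nonneg_left h2 hF0.le
    have h4 : F * exp (-(q / 2)) ≤ 2 * √π * √a * exp (-(q / 2)) :=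
      mul_le_mul_of_nonneg_right h1 (exp_pos _).le
    have h5 : F * q = η := by rw [hq]; field_simp
    nlinarith
  have hc1 : ∀ᶠ ε in nhdsWithin (0 : ℝ) (Set.Ioi 0), ε < min c 1 :=
    mem_nhdsWithin_of_mem_nhds (Iio_mem_nhds (by positivity))
  filter_upwards [hΦ.eventually_const_lt hlim, self_mem_nhdsWithin, hc1] with ε h1 hε hεc
  have hε : 0 < ε := hε
  have hramp := ramp_ineq hf hf' hh.continuous hfh (hu.of_le (by norm_num)) hc ht h_intg hs hN hN' hd hNΓ hG
    hGo hbd hfr (c := c) (q := q) (ε := ε)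
    (fun z hz => (hcM z hz).imp (fun h => h.1) id)
    (fun z hz hzc => by
      rcases hcM z hzc with h4 | h4
      · have : h z - w z < q := h4.2.2
        linarith
      · exact (Set.disjoint_left.mp hd hz h4).elim)
    hε (hεc.le.trans (min_le_left _ _)) (hεc.le.trans (min_le_right _ _))
  have hr0 : 0 ≤ r ε := integral_nonneg fun y => (exp_pos _).le
  have hpos : 0 < √(a + r ε) * exp (q / 2) := by
    have : 0 < √(a + r ε) := Real.sqrt_pos.mpr (by linarith)
    positivity
  refine h1.le.trans ?_
  rw [div_le_iff₀ hpos]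
  calc _ ≤ _ := hramp
    _ = _ := by ring


theorem fract_sub_add (x y : ℝ) : Int.fract (x + y) * (1 - Int.fract (x + y)) ≤
    Int.fract x * (1 - Int.fract x) + Int.fract y * (1 - Int.fract y) := by
  have ha := Int.fract_nonneg x
  have ha' := Int.fract_lt_one x
  have hb := Int.fract_nonneg y
  have hb' := Int.fract_lt_one y
  have ex := Int.floor_add_fract x
  have ey := Int.floor_add_fract y
  by_cases h : Int.fract x + Int.fract y < 1
  · have : Int.fract (x + y) = Int.fract x + Int.fract y := by
      rw [Int.fract_eq_iff]
      refine ⟨by positivity, h, ⌊x⌋ + ⌊y⌋, ?_⟩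
      push_cast; linarith
    rw [this]
    nlinarith [mul_nonneg ha hb]
  · have : Int.fract (x + y) = Int.fract x + Int.fract y - 1 := by
      rw [Int.fract_eq_iff]
      refine ⟨by linarith, by linarith, ⌊x⌋ + ⌊y⌋ + 1, ?_⟩
      push_cast; linarith
    rw [this]
    nlinarith [mul_nonneg (sub_nonneg.mpr ha'.le) (sub_nonneg.mpr hb'.le)]

theorem fract_val {x : ℝ} (h0 : 0 ≤ x) (h1 : x ≤ 1) :
    Int.fract x * (1 - Int.fract x) = x * (1 - x) := by
  rcases h1.lt_or_eq with h | rfl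
  · rw [Int.fract_eq_self.mpr ⟨h0, h⟩]
  · simp

theorem fract_neg_val (x : ℝ) : Int.fract (-x) * (1 - Int.fract (-x)) =
    Int.fract x * (1 - Int.fract x) := by
  by_cases h : Int.fract x = 0
  · rw [h, Int.fract_neg_eq_zero.mpr h]
  · rw [Int.fract_neg h]; ring

theorem sub_add_sum {n : ℕ} {x s : Fin n → ℝ} (hs : ∀ i, s i = 1 ∨ s i = -1)
    (hx : ∀ i, 0 ≤ x i ∧ x i ≤ 1) {X : ℝ} (hX : X = ∑ i, s i * x i) (h0 : 0 ≤ X) (h1 : X ≤ 1) :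
    X * (1 - X) ≤ ∑ i, x i * (1 - x i) := by
  rw [← fract_val h0 h1, hX]
  refine (Finset.le_sum_of_subadditive (fun x : ℝ => Int.fract x * (1 - Int.fract x)) (by simp)
    fract_sub_add _ _).trans ?_
  refine Finset.sum_le_sum fun i _ => ?_
  rw [← fract_val (hx i).1 (hx i).2]
  rcases hs i with h | h
  · rw [h, one_mul]
  · rw [h, neg_one_mul, fract_neg_val]

open Laplacian in
theorem level_iso {Ω U : Set ℂ} (hΩ : IsOpen Ω) (hsc : IsSimplyConnected Ω)
    (hU : IsOpen U) (hΩU : Ω ⊆ U) {w : ℂ → ℝ}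
    (hw : ContDiffOn ℝ 2 w U) (hsup : ∀ y ∈ Ω, 0 ≤ Δ w y + exp (w y))
    (hwint : IntegrableOn (fun y => exp (w y)) Ω) (hmass : ∫ y in Ω, exp (w y) ≤ 8 * π)
    {u : ℂ → ℝ} (hu : ContDiff ℝ 3 u) (hc : HasCompactSupport u)
    (hsu : tsupport u ⊆ Ω) {t : ℝ} (ht : 0 < t) (hreg : ∀ y, u y = t → fderiv ℝ u y ≠ 0)
    (hnull : volume {y | u y = t} = 0)
    (h_intg : Integrable (fun z => ‖fderiv ℝ u z‖ * exp (w z / 2)))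
    {η : ℝ} (hη : 0 < η) :
    ∀ᶠ ε in nhdsWithin 0 (Set.Ioi 0),
      √(4 * π * (∫ y in {y | t < u y}, exp (w y)) - (∫ y in {y | t < u y}, exp (w y)) ^ 2 / 2) - η ≤
        1 / ε * ∫ z in {z | t < u z ∧ u z < t + ε}, ‖fderiv ℝ u z‖ * exp (w z / 2) := by
  obtain ⟨n, Γ, N, G, s, hΓ, hs, hGo, hGb, hGΓ, hfr, hV, hN, hNd, hNΓ, hG, hGΩ, hcov, hind⟩ :=
    level_decomp hΩ hsc hu hc hsu ht hreg
  have hpos : ∀ S : Set ℂ, 0 ≤ ∫ y in S, exp (w y) := fun S => integral_nonneg fun y => (exp_pos _).le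
  have hle : ∀ S : Set ℂ, S ⊆ Ω → ∫ y in S, exp (w y) ≤ 8 * π := fun S hS =>
    (setIntegral_mono_set hwint (Filter.Eventually.of_forall fun y => (exp_pos _).le)
      (Filter.Eventually.of_forall fun y hy => hS hy)).trans hmass
  have hSΩ : {y | t < u y} ⊆ Ω := fun y hy => hsu (subset_tsupport u (by
    have : t < u y := hy
    exact (ht.trans this).ne'))
  have hSo : IsOpen {y | t < u y} := isOpen_lt continuous_const hu.continuous
  have hmsum : ∫ y in {y | t < u y}, exp (w y) = ∑ i, s i * ∫ y in G i, exp (w y) := by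
    have h1 : ∀ i, s i * ∫ y in G i, exp (w y) =
        ∫ y, s i * (G i).indicator (fun y => exp (w y)) y := fun i => by
      rw [integral_const_mul, integral_indicator (hGo i).measurableSet]
    simp_rw [h1]
    rw [← integral_finsetSum, ← integral_indicator hSo.measurableSet]
    · refine integral_congr_ae ?_
      have : ∀ᵐ y, u y ≠ t := by
        rw [ae_iff]; simpa using hnull
      filter_upwards [this] with y hy
      have := congrArg (fun x => x * exp (w y)) (hind y hy)
      have e1 : ∀ S : Set ℂ, S.indicator (fun _ => (1 : ℝ)) y * exp (w y) =
          S.indicator (fun y => exp (w y)) y := fun S => by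
        by_cases h : y ∈ S <;> simp [h]
      simp only [Finset.sum_mul, mul_assoc, e1] at this
      exact this.symm
    · intro i _
      exact (((integrable_indicator_iff (hGo i).measurableSet).mpr (hwint.mono_set (hGΩ i))).const_mul _)
  have hev : ∀ i ∈ Finset.univ, ∀ᶠ ε in nhdsWithin 0 (Set.Ioi 0),
      √(4 * π * (∫ y in G i, exp (w y)) - (∫ y in G i, exp (w y)) ^ 2 / 2) - η / (n + 1) ≤
        1 / ε * ∫ z in N i ∩ {z | t < u z ∧ u z < t + ε}, ‖fderiv ℝ u z‖ * exp (w z / 2) := by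
    intro i _
    refine component_limit hU hΩU hw hsup hu hc hsu ht hreg hnull h_intg (hs i) (hN i)
      (N' := ⋃ j, ⋃ (_ : j ≠ i), N j)
      (isOpen_iUnion fun j => isOpen_iUnion fun _ => hN j) ?_ (hNΓ i) (hG i) (hΓ i) (hGo i) (hGb i)
      (hGΓ i) (hfr i) (hV i) (hGΩ i) ?_ (by positivity)
    · simp only [Set.disjoint_iUnion_right]
      exact fun j hj => hNd i j hj.symm
    · intro z hz
      obtain ⟨j, hj⟩ := hcov z hz
      by_cases h : j = i
      · exact Or.inl (h ▸ hj)
      · exact Or.inr (Set.mem_iUnion₂.mpr ⟨j, h, hj⟩)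
  have hev' := (Filter.eventually_all_finset Finset.univ).mpr hev
  have hroot : √(4 * π * (∫ y in {y | t < u y}, exp (w y)) - (∫ y in {y | t < u y}, exp (w y)) ^ 2 / 2)
      ≤ ∑ i, √(4 * π * (∫ y in G i, exp (w y)) - (∫ y in G i, exp (w y)) ^ 2 / 2) := by
    refine Real.sqrt_le_iff.mpr ⟨Finset.sum_nonneg fun i _ => Real.sqrt_nonneg _, ?_⟩
    have key := sub_add_sum hs (x := fun i => (∫ y in G i, exp (w y)) / (8 * π))
      (fun i => ⟨div_nonneg (hpos _) (by positivity), (div_le_one (by positivity)).mpr (hle _ (hGΩ i))⟩)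
      (X := (∫ y in {y | t < u y}, exp (w y)) / (8 * π)) (by
        rw [hmsum, Finset.sum_div]
        exact Finset.sum_congr rfl fun i _ => by ring)
      (div_nonneg (hpos _) (by positivity)) ((div_le_one (by positivity)).mpr (hle _ hSΩ))
    have e : ∀ x : ℝ, 4 * π * x - x ^ 2 / 2 = (32 * π ^ 2) * (x / (8 * π) * (1 - x / (8 * π))) := by
      intro x
      field_simp
      ring
    rw [e]
    calc _ ≤ 32 * π ^ 2 * ∑ i, (∫ y in G i, exp (w y)) / (8 * π) *
          (1 - (∫ y in G i, exp (w y)) / (8 * π)) := mul_le_mul_of_nonneg_left key (by positivity)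
      _ = ∑ i, √(4 * π * (∫ y in G i, exp (w y)) - (∫ y in G i, exp (w y)) ^ 2 / 2) ^ 2 := by
          rw [Finset.mul_sum]
          refine Finset.sum_congr rfl fun i _ => ?_
          rw [← e, Real.sq_sqrt]
          have := hpos (G i)
          have := hle _ (hGΩ i)
          nlinarith
      _ ≤ _ := Finset.sum_sq_le_sq_sum_of_nonneg fun i _ => Real.sqrt_nonneg _
  filter_upwards [hev', self_mem_nhdsWithin] with ε h1 hε
  have hε : 0 < ε := hε
  have hop : IsOpen {z | t < u z ∧ u z < t + ε} :=
    hSo.inter (isOpen_lt hu.continuous continuous_const)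
  have h2 : ∑ i, ∫ z in N i ∩ {z | t < u z ∧ u z < t + ε}, ‖fderiv ℝ u z‖ * exp (w z / 2) ≤
      ∫ z in {z | t < u z ∧ u z < t + ε}, ‖fderiv ℝ u z‖ * exp (w z / 2) := by
    rw [← integral_iUnion_fintype (fun i => ((hN i).inter hop).measurableSet)]
    · refine setIntegral_mono_set h_intg.integrableOn
        (Filter.Eventually.of_forall fun y => by positivity) (Filter.Eventually.of_forall fun y hy => ?_)
      obtain ⟨i, hi⟩ := Set.mem_iUnion.mp hy
      exact hi.2
    · exact fun i j hij => (hNd i j hij).mono Set.inter_subset_left Set.inter_subset_left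
    · exact fun i => h_intg.integrableOn
  have h3 := Finset.sum_le_sum h1
  rw [Finset.sum_sub_distrib, ← Finset.mul_sum, Finset.sum_const, Finset.card_univ, Fintype.card_fin,
    nsmul_eq_mul] at h3
  have h4 := mul_le_mul_of_nonneg_left h2 (show 0 ≤ 1 / ε by positivity)
  have h5 : (n : ℝ) * (η / (n + 1)) ≤ η := by
    rw [mul_div_assoc', div_le_iff₀ (by positivity)]
    nlinarith
  linarith

/-- The squared isoperimetric profile with slack. -/
def prof (δ s : ℝ) : ℝ := 4 * π * s - (1 - δ) / 2 * s ^ 2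

/-- The Riccati weight. -/
def ricq (δ s : ℝ) : ℝ := 1 / (4 * π - s) + δ / (16 * π)

/-- The auxiliary function used as an upper bound for the integral of `prof * ricq ^ 2`. -/
def ricG (δ s : ℝ) : ℝ := prof δ s * ricq δ s - (1 + δ / 16) * s

theorem ricG_deriv {δ s : ℝ} (hδ : 0 < δ) (hδ1 : δ ≤ 1) (hs : 0 ≤ s) (hs1 : s < 4 * π) :
    ∃ G', HasDerivAt (ricG δ) G' s ∧ prof δ s * ricq δ s ^ 2 ≤ G' := by
  have hx : 0 < 4 * π - s := by linarith
  have h1 : HasDerivAt (prof δ) (4 * π * 1 - (1 - δ) / 2 * (2 * s)) s := by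
    unfold prof
    have := ((hasDerivAt_id s).const_mul (4 * π)).sub (((hasDerivAt_pow 2 s)).const_mul ((1 - δ) / 2))
    simpa using! this
  have h2 : HasDerivAt (ricq δ) (1 / (4 * π - s) ^ 2) s := by
    unfold ricq
    have := (((hasDerivAt_id s).const_sub (4 * π)).inv hx.ne').add_const (δ / (16 * π))
    simpa [one_div] using! this
  have h3 := (h1.mul h2).sub ((hasDerivAt_id s).const_mul (1 + δ / 16))
  refine ⟨_, h3, ?_⟩
  have hpi := pi_pos
  obtain ⟨x, hxd⟩ : ∃ x, x = 4 * π - s := ⟨_, rfl⟩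
  have hs' : s = 4 * π - x := by linarith
  simp only [prof, ricq, ← hxd]
  have hx0 : 0 < x := by linarith
  obtain ⟨g, hg⟩ : ∃ g, g = δ / (16 * π) := ⟨_, rfl⟩
  have hδg : δ = 16 * π * g := by rw [hg]; field_simp
  have hg0 : 0 < g := by rw [hg]; positivity
  obtain ⟨r, hr⟩ : ∃ r, r = 1 / x := ⟨_, rfl⟩
  have hxr : x * r = 1 := by rw [hr]; field_simp
  have hr0 : 0 < r := by rw [hr]; positivity
  have hr2 : 1 / x ^ 2 = r ^ 2 := by rw [hr]; field_simp
  rw [← hg, hr2, ← hr]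
  -- the Riccati inequality
  set F := 4 * π * s - (1 - δ) / 2 * s ^ 2 with hF
  have e1 : 4 * π * 1 - (1 - δ) / 2 * (2 * s) = x + δ * s := by rw [hxd]; ring
  rw [e1]
  have hFle : F ≤ 4 * π * s := by
    have : 0 ≤ (1 - δ) / 2 * s ^ 2 := mul_nonneg (by linarith) (sq_nonneg _)
    linarith
  have k1 : g ^ 2 * F ≤ g * δ * s := by
    calc g ^ 2 * F ≤ g ^ 2 * (4 * π * s) := mul_le_mul_of_nonneg_left hFle (by positivity)
      _ = (g * δ * s) / 4 := by rw [hδg]; ring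
      _ ≤ g * δ * s := by
        have : 0 ≤ g * δ * s := by positivity
        linarith
  have k2 : 2 * g * r * F ≤ δ * s * r / 2 := by
    calc 2 * g * r * F ≤ 2 * g * r * (4 * π * s) := mul_le_mul_of_nonneg_left hFle (by positivity)
      _ = _ := by rw [hδg]; ring
  have k3 : δ / 16 ≤ g * x + δ * s * r / 2 := by
    by_cases hxp : π ≤ x
    · have : g * π ≤ g * x := mul_le_mul_of_nonneg_left hxp hg0.le
      have e : δ / 16 = g * π := by rw [hδg]; ring
      have : 0 ≤ δ * s * r := by positivity
      linarith
    · push Not at hxp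
      have : 1 ≤ s * r := by
        have h : x ≤ s := by linarith
        calc 1 = x * r := hxr.symm
          _ ≤ s * r := mul_le_mul_of_nonneg_right h hr0.le
      have : δ * 1 ≤ δ * (s * r) := mul_le_mul_of_nonneg_left this hδ.le
      have : 0 ≤ g * x := by positivity
      nlinarith
  have e2 : (x + δ * s) * (r + g) = 1 + δ * s * r + g * x + g * δ * s := by
    linear_combination hxr
  have e3 : F * (r + g) ^ 2 = F * r ^ 2 + 2 * g * r * F + g ^ 2 * F := by ring
  rw [e2, e3]
  linarith

theorem prof_nonneg {δ s : ℝ} (hδ : 0 < δ) (hs : 0 ≤ s) (hs1 : s < 4 * π) :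
    0 ≤ prof δ s := by
  unfold prof
  have : (1 - δ) / 2 * s ^ 2 ≤ 1 / 2 * s ^ 2 := mul_le_mul_of_nonneg_right (by linarith) (sq_nonneg _)
  nlinarith [pi_pos]

theorem ricG_mono {δ : ℝ} (hδ : 0 < δ) (hδ1 : δ ≤ 1) : MonotoneOn (ricG δ) (Set.Ico 0 (4 * π)) := by
  apply monotoneOn_of_deriv_nonneg (convex_Ico _ _)
  · intro s hs
    obtain ⟨G', h, -⟩ := ricG_deriv hδ hδ1 hs.1 hs.2
    exact h.continuousAt.continuousWithinAt
  · intro s hs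
    rw [interior_Ico] at hs
    obtain ⟨G', h, -⟩ := ricG_deriv hδ hδ1 hs.1.le hs.2
    exact h.differentiableAt.differentiableWithinAt
  · intro s hs
    rw [interior_Ico] at hs
    obtain ⟨G', h, h1⟩ := ricG_deriv hδ hδ1 hs.1.le hs.2
    rw [h.deriv]
    exact (mul_nonneg (prof_nonneg hδ hs.1.le hs.2) (sq_nonneg _)).trans h1

theorem ricG_zero (δ : ℝ) : ricG δ 0 = 0 := by simp [ricG, prof]

theorem one_dim {D m : ℝ → ℝ} (hD : Monotone D) (hm : Antitone m) (hm0 : ∀ t, 0 ≤ m t) {M : ℝ}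
    (hM : M < 4 * π) (hmM : ∀ t, m t ≤ M) {t₀ T : ℝ} (ht₀ : 0 < t₀) (hT : t₀ ≤ T) (hmT : m T = 0)
    {δ : ℝ} (hδ : 0 < δ) (hδ1 : δ ≤ 1)
    (h : ∀ᵐ t, t ∈ Set.Ioo t₀ T → ∀ D' m', HasDerivAt D D' t → HasDerivAt m m' t →
      prof δ (m t) ≤ 4 * t * D' * (-m')) :
    (1 + δ / 16) * ∫ t in t₀..T, m t ≤ D T - D t₀ + t₀ * ricG δ M := by
  have hmI : ∀ t, m t ∈ Set.Ico 0 (4 * π) := fun t => ⟨hm0 t, (hmM t).trans_lt hM⟩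
  set g : ℝ → ℝ := fun t => - ricG δ (m t) with hg
  have hgm : Monotone g := fun s t hst => by
    simp only [hg]
    exact neg_le_neg (ricG_mono hδ hδ1 (hmI t) (hmI s) (hm hst))
  have hgi : ∀ a b, IntervalIntegrable g volume a b := fun a b => hgm.intervalIntegrable
  set R : ℝ → ℝ := fun t => D t + t * g t - ∫ τ in t₀..t, g τ with hR
  have hRm : MonotoneOn R (Set.uIcc t₀ T) := by
    rw [Set.uIcc_of_le hT]
    intro s hs t ht hst
    have e : ∫ τ in t₀..t, g τ = (∫ τ in t₀..s, g τ) + ∫ τ in s..t, g τ :=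
      (intervalIntegral.integral_add_adjacent_intervals (hgi _ _) (hgi _ _)).symm
    have h1 : ∫ τ in s..t, g τ ≤ ∫ τ in s..t, g t :=
      intervalIntegral.integral_mono_on hst (hgi _ _) (by simp) fun x hx => hgm hx.2
    rw [intervalIntegral.integral_const, smul_eq_mul] at h1
    have h2 := hD hst
    have h3 : s * g s ≤ s * g t := mul_le_mul_of_nonneg_left (hgm hst) (ht₀.le.trans hs.1)
    simp only [hR]
    rw [e]
    linarith
  have h1 := hRm.intervalIntegral_deriv_mem_uIcc
  have hRT : R t₀ ≤ R T := hRm (by simp) (by simp) hT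
  rw [Set.uIcc_of_le (sub_nonneg.2 hRT)] at h1
  have hmi : IntervalIntegrable m volume t₀ T := hm.intervalIntegrable
  have h2 : ∫ t in t₀..T, ((1 + δ / 16) * m t - g t) ≤ ∫ t in t₀..T, deriv R t := by
    apply intervalIntegral.integral_mono_ae_restrict hT ((hmi.const_mul _).sub (hgi _ _))
      hRm.intervalIntegrable_deriv
    have a1 : ∀ᵐ t, DifferentiableAt ℝ D t := hD.ae_differentiableAt
    have a2 : ∀ᵐ t, DifferentiableAt ℝ (fun t => -m t) t := hm.neg.ae_differentiableAt
    have h3 : ∀ᵐ t : ℝ, t ≠ t₀ := by simp [ae_iff]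
    have h4 : ∀ᵐ t : ℝ, t ≠ T := by simp [ae_iff]
    rw [Filter.EventuallyLE, ae_restrict_iff' measurableSet_Icc]
    filter_upwards [h, a1, a2, h3, h4] with t ht hDt hmt ha hb htI
    have htI' : t ∈ Set.Ioo t₀ T := ⟨lt_of_le_of_ne htI.1 (Ne.symm ha), lt_of_le_of_ne htI.2 hb⟩
    have hmt' : DifferentiableAt ℝ m t := by simpa using hmt.neg
    obtain ⟨D', hD'⟩ : ∃ D', HasDerivAt D D' t := ⟨_, hDt.hasDerivAt⟩
    obtain ⟨m', hm'⟩ : ∃ m', HasDerivAt m m' t := ⟨_, hmt'.hasDerivAt⟩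
    obtain ⟨G', hG', hGle⟩ := ricG_deriv hδ hδ1 (hm0 t) (hmI t).2
    have hgd : HasDerivAt g (-(G' * m')) t := (hG'.comp t hm').neg
    have hId : HasDerivAt (fun t => ∫ τ in t₀..t, g τ) (g t) t :=
      intervalIntegral.integral_hasDerivAt_right (hgi _ _)
        (hgm.measurable.stronglyMeasurable.stronglyMeasurableAtFilter) hgd.continuousAt
    have hRd : HasDerivAt R (D' + (1 * g t + t * (-(G' * m'))) - g t) t :=
      (hD'.add ((hasDerivAt_id t).mul hgd)).sub hId
    rw [hRd.deriv]
    have hD0 : 0 ≤ D' := by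
      rw [← hD'.deriv]; exact hD.deriv_nonneg
    have hm'0 : 0 ≤ -m' := by
      rw [← hm'.deriv]; have := hm.deriv_nonpos (x := t); linarith
    have hin := ht htI' D' m' hD' hm'
    have htp : 0 < t := ht₀.trans htI'.1
    have hp := prof_nonneg hδ (hm0 t) (hmI t).2
    have hq : 0 ≤ ricq δ (m t) := by
      unfold ricq
      have : 0 < 4 * π - m t := by linarith [(hmI t).2]
      positivity
    have hkey : prof δ (m t) * ricq δ (m t) ≤ D' + t * (prof δ (m t) * ricq δ (m t) ^ 2) * (-m') := by
      set p := prof δ (m t)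
      set q := ricq δ (m t)
      have hy : 0 ≤ t * (p * q ^ 2) * (-m') := by positivity
      refine abs_le_of_sq_le_sq' ?_ (by positivity) |>.2
      have : (p * q) ^ 2 ≤ 4 * D' * (t * (p * q ^ 2) * (-m')) := by
        have := mul_le_mul_of_nonneg_left hin (show 0 ≤ p * q ^ 2 by positivity)
        calc (p * q) ^ 2 = p * q ^ 2 * p := by ring
          _ ≤ _ := this
          _ = _ := by ring
      nlinarith [sq_nonneg (D' - t * (p * q ^ 2) * (-m'))]
    have h5 : t * (prof δ (m t) * ricq δ (m t) ^ 2) * (-m') ≤ t * G' * (-m') :=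
      mul_le_mul_of_nonneg_right (mul_le_mul_of_nonneg_left hGle htp.le) hm'0
    have h6 : (1 + δ / 16) * m t - g t = prof δ (m t) * ricq δ (m t) := by
      simp only [hg, ricG]; ring
    show (1 + δ / 16) * m t - g t ≤ _
    rw [h6]
    linarith
  rw [intervalIntegral.integral_sub (hmi.const_mul _) (hgi _ _), intervalIntegral.integral_const_mul] at h2
  have h3 := h1.2
  have h4 : R T - R t₀ = D T - D t₀ + t₀ * ricG δ (m t₀) - ∫ τ in t₀..T, g τ := by
    simp only [hR, hg, hmT, ricG_zero, intervalIntegral.integral_same]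
    ring
  have h5 : t₀ * ricG δ (m t₀) ≤ t₀ * ricG δ M :=
    mul_le_mul_of_nonneg_left (ricG_mono hδ hδ1 (hmI t₀) ⟨(hm0 t₀).trans (hmM t₀), hM⟩ (hmM t₀)) ht₀.le
  linarith

open Laplacian in
theorem iso_slack {Ω U : Set ℂ} (hΩ : IsOpen Ω) (hsc : IsSimplyConnected Ω)
    (hU : IsOpen U) (hΩU : Ω ⊆ U) {w : ℂ → ℝ}
    (hw : ContDiffOn ℝ 2 w U) {δ : ℝ} (hδ : 0 < δ) (hδ1 : δ < 1)
    (hsup : ∀ y ∈ Ω, 0 ≤ Δ w y + (1 - δ) * exp (w y))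
    (hwint : IntegrableOn (fun y => exp (w y)) Ω) (hmass : ∫ y in Ω, exp (w y) ≤ 8 * π)
    {u : ℂ → ℝ} (hu : ContDiff ℝ 3 u) (hc : HasCompactSupport u)
    (hsu : tsupport u ⊆ Ω) {t : ℝ} (ht : 0 < t) (hreg : ∀ y, u y = t → fderiv ℝ u y ≠ 0)
    (hnull : volume {y | u y = t} = 0)
    (h_intg : Integrable (fun z => ‖fderiv ℝ u z‖ * exp (w z / 2)))
    {η : ℝ} (hη : 0 < η) :
    ∀ᶠ ε in nhdsWithin 0 (Set.Ioi 0),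
      √(prof δ (∫ y in {y | t < u y}, exp (w y))) - η ≤
        1 / ε * ∫ z in {z | t < u z ∧ u z < t + ε}, ‖fderiv ℝ u z‖ * exp (w z / 2) := by
  have hd : 0 < 1 - δ := by linarith
  have hsd : 0 < √(1 - δ) := Real.sqrt_pos.mpr hd
  have e1 : ∀ y, exp (w y + Real.log (1 - δ)) = (1 - δ) * exp (w y) := fun y => by
    rw [Real.exp_add, Real.exp_log hd]; ring
  have e2 : ∀ y, exp ((w y + Real.log (1 - δ)) / 2) = √(1 - δ) * exp (w y / 2) := fun y => by
    rw [add_div, Real.exp_add, ← Real.log_sqrt hd.le, Real.exp_log hsd]; ring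
  have hpos : 0 ≤ ∫ y in Ω, exp (w y) := integral_nonneg fun y => (exp_pos _).le
  have key := level_iso (w := fun y => w y + Real.log (1 - δ)) hΩ hsc hU hΩU
    (hw.add contDiffOn_const) (fun y hy => by
      have h1 : ContDiffAt ℝ 2 w y := hw.contDiffAt (hU.mem_nhds (hΩU hy))
      have h2 : Δ (fun y => w y + Real.log (1 - δ)) y = Δ w y := by
        have := h1.laplacian_add (f₂ := fun _ => Real.log (1 - δ)) contDiffAt_const
        rw [InnerProductSpace.laplacian_const] at this
        simpa using! this
      rw [h2, e1]
      exact hsup y hy)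
    (by simp_rw [e1]; exact hwint.const_mul _)
    (by
      simp_rw [e1]; rw [integral_const_mul]
      nlinarith) hu hc hsu ht hreg hnull
    (by
      simp_rw [e2]
      have := h_intg.const_mul (√(1 - δ))
      refine this.congr (Filter.Eventually.of_forall fun z => ?_)
      show √(1 - δ) * (‖fderiv ℝ u z‖ * exp (w z / 2)) = ‖fderiv ℝ u z‖ * (√(1 - δ) * exp (w z / 2))
      ring)
    (η := √(1 - δ) * η) (by positivity)
  filter_upwards [key] with ε h
  simp_rw [e1, e2] at h
  rw [integral_const_mul] at h
  have e3 : ∀ z, ‖fderiv ℝ u z‖ * (√(1 - δ) * exp (w z / 2)) =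
      √(1 - δ) * (‖fderiv ℝ u z‖ * exp (w z / 2)) := fun z => by ring
  simp_rw [e3] at h
  rw [integral_const_mul] at h
  set A := ∫ y in {y | t < u y}, exp (w y)
  have e4 : 4 * π * ((1 - δ) * A) - ((1 - δ) * A) ^ 2 / 2 = (1 - δ) * prof δ A := by
    unfold prof; ring
  rw [e4, Real.sqrt_mul hd.le] at h
  set J := ∫ z in {z | t < u z ∧ u z < t + ε}, ‖fderiv ℝ u z‖ * exp (w z / 2)
  have e5 : 1 / ε * (√(1 - δ) * J) = √(1 - δ) * (1 / ε * J) := by ring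
  rw [e5, ← mul_sub] at h
  exact le_of_mul_le_mul_left h hsd

theorem cs_shell {U K : Set ℂ} {w : ℂ → ℝ} (hw : ContinuousOn w U) (hKU : K ⊆ U) (hK : IsCompact K)
    {ψ : ℂ → ℝ} (hψ : ContDiff ℝ 3 ψ) (hψK : K = tsupport ψ) {t ε : ℝ} (ht : 0 < t) (hε : 0 < ε) :
    (∫ z in {z | t < ψ z ^ 2 ∧ ψ z ^ 2 < t + ε}, ‖fderiv ℝ (fun y => ψ y ^ 2) z‖ * exp (w z / 2)) ^ 2 ≤
    4 * (t + ε) * ((∫ z in {z | ψ z ^ 2 ≤ t + ε}, ‖fderiv ℝ ψ z‖ ^ 2) -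
      ∫ z in {z | ψ z ^ 2 ≤ t}, ‖fderiv ℝ ψ z‖ ^ 2) *
      ((∫ z in K ∩ {z | t < ψ z ^ 2}, exp (w z)) - ∫ z in K ∩ {z | t + ε < ψ z ^ 2}, exp (w z)) := by
  set S := {z | t < ψ z ^ 2 ∧ ψ z ^ 2 < t + ε} with hS
  have hψc : Continuous fun z => ψ z ^ 2 := hψ.continuous.pow 2
  have hSo : IsOpen S := (isOpen_lt continuous_const hψc).inter (isOpen_lt hψc continuous_const)
  have hSK : S ⊆ K := fun z hz => by
    rw [hψK]; apply subset_tsupport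
    intro h0
    have := hz.1
    rw [h0] at this
    norm_num at this
    linarith
  have hcs : HasCompactSupport ψ := by rw [HasCompactSupport, ← hψK]; exact hK
  have hdψ : Continuous fun z => ‖fderiv ℝ ψ z‖ ^ 2 :=
    ((hψ.continuous_fderiv (by norm_num)).norm.pow 2)
  have hdi : Integrable fun z => ‖fderiv ℝ ψ z‖ ^ 2 := by
    refine hdψ.integrable_of_hasCompactSupport ?_
    exact (hcs.fderiv ℝ).comp_left (g := fun L : ℂ →L[ℝ] ℝ => ‖L‖ ^ 2) (by simp)
  have hei : IntegrableOn (fun z => exp (w z)) K :=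
    (Real.continuous_exp.comp_continuousOn (hw.mono hKU)).integrableOn_compact hK
  have hfd : ∀ z, ‖fderiv ℝ (fun y => ψ y ^ 2) z‖ = 2 * |ψ z| * ‖fderiv ℝ ψ z‖ := fun z => by
    have h1 : HasFDerivAt (fun y => ψ y ^ 2) ((2 * ψ z) • fderiv ℝ ψ z) z := by
      have := ((hψ.differentiable (by norm_num) z).hasFDerivAt).pow 2
      simpa using! this
    rw [h1.fderiv, norm_smul, Real.norm_eq_abs, abs_mul]
    norm_num
  have hm1 : AEStronglyMeasurable (fun z => ‖fderiv ℝ (fun y => ψ y ^ 2) z‖) (volume.restrict S) := by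
    simp_rw [hfd]
    exact ((continuous_const.mul hψ.continuous.abs).mul
      (hψ.continuous_fderiv (by norm_num)).norm).aestronglyMeasurable
  have hm2 : AEStronglyMeasurable (fun z => exp (w z / 2)) (volume.restrict S) := by
    have : ContinuousOn (fun z => exp (w z / 2)) K :=
      Real.continuous_exp.comp_continuousOn ((hw.mono hKU).div_const 2)
    exact (this.mono hSK).aestronglyMeasurable hSo.measurableSet
  have hb : ∀ z ∈ S, ‖fderiv ℝ (fun y => ψ y ^ 2) z‖ ^ 2 ≤ 4 * (t + ε) * ‖fderiv ℝ ψ z‖ ^ 2 := by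
    intro z hz
    rw [hfd, mul_pow, mul_pow, sq_abs]
    have : ψ z ^ 2 ≤ t + ε := hz.2.le
    nlinarith [sq_nonneg ‖fderiv ℝ ψ z‖]
  have hi1 : Integrable (fun z => ‖fderiv ℝ (fun y => ψ y ^ 2) z‖ ^ 2) (volume.restrict S) := by
    refine Integrable.mono' ((hdi.const_mul (4 * (t + ε))).integrableOn (s := S)) (hm1.pow 2) ?_
    rw [ae_restrict_iff' hSo.measurableSet]
    refine Filter.Eventually.of_forall fun z hz => ?_
    rw [Real.norm_of_nonneg (by positivity)]
    exact hb z hz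
  have e2 : ∀ z, exp (w z / 2) ^ 2 = exp (w z) := fun z => by
    rw [← Real.exp_nat_mul]; congr 1; push_cast; ring
  have hi2 : Integrable (fun z => exp (w z / 2) ^ 2) (volume.restrict S) := by
    simp_rw [e2]; exact hei.mono_set hSK
  have hcsz := (cauchy_schwarz_int hm1 hm2 hi1 hi2).2
  refine hcsz.trans ?_
  simp_rw [e2]
  have k1 : ∫ z in S, ‖fderiv ℝ (fun y => ψ y ^ 2) z‖ ^ 2 ≤
      4 * (t + ε) * ((∫ z in {z | ψ z ^ 2 ≤ t + ε}, ‖fderiv ℝ ψ z‖ ^ 2) -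
      ∫ z in {z | ψ z ^ 2 ≤ t}, ‖fderiv ℝ ψ z‖ ^ 2) := by
    have h1 : ∫ z in S, ‖fderiv ℝ (fun y => ψ y ^ 2) z‖ ^ 2 ≤ ∫ z in S, 4 * (t + ε) * ‖fderiv ℝ ψ z‖ ^ 2 :=
      setIntegral_mono_on hi1 (hdi.const_mul _).integrableOn hSo.measurableSet hb
    rw [integral_const_mul] at h1
    refine h1.trans (mul_le_mul_of_nonneg_left ?_ (by positivity))
    rw [← setIntegral_sdiff (isClosed_le hψc continuous_const).measurableSet hdi.integrableOn
      (show {z | ψ z ^ 2 ≤ t} ⊆ {z | ψ z ^ 2 ≤ t + ε} from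
        fun z (hz : ψ z ^ 2 ≤ t) => show ψ z ^ 2 ≤ t + ε by linarith)]
    refine setIntegral_mono_set hdi.integrableOn (Filter.Eventually.of_forall fun z => by positivity)
      (Filter.Eventually.of_forall fun z hz => ?_)
    exact ⟨hz.2.le, not_le.mpr hz.1⟩
  have k2 : ∫ z in S, exp (w z) ≤
      (∫ z in K ∩ {z | t < ψ z ^ 2}, exp (w z)) - ∫ z in K ∩ {z | t + ε < ψ z ^ 2}, exp (w z) := by
    have hmo : ∀ a, MeasurableSet (K ∩ {z | a < ψ z ^ 2}) := fun a =>
      hK.measurableSet.inter (isOpen_lt continuous_const hψc).measurableSet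
    rw [← setIntegral_sdiff (hmo _) (hei.mono_set Set.inter_subset_left)
      (show K ∩ {z | t + ε < ψ z ^ 2} ⊆ K ∩ {z | t < ψ z ^ 2} from
        fun z hz => ⟨hz.1, show t < ψ z ^ 2 by have : t + ε < ψ z ^ 2 := hz.2; linarith⟩)]
    refine setIntegral_mono_set (hei.mono_set (Set.sdiff_subset.trans Set.inter_subset_left))
      (Filter.Eventually.of_forall fun z => (exp_pos _).le)
      (Filter.Eventually.of_forall fun z hz => ?_)
    refine ⟨⟨hSK hz, hz.1⟩, fun h => ?_⟩
    have h1 : t + ε < ψ z ^ 2 := h.2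
    exact lt_asymm h1 hz.2
  exact mul_le_mul k1 k2 (integral_nonneg fun z => (exp_pos _).le)
    ((integral_nonneg fun z => by positivity).trans k1)

theorem layer_cake {K : Set ℂ} (hK : IsCompact K) {u E : ℂ → ℝ} (hu : Continuous u)
    (hE : IntegrableOn E K) {t₀ T : ℝ} (hT : t₀ ≤ T) (huT : ∀ y, u y ≤ T) :
    ∫ t in t₀..T, ∫ y in K ∩ {y | t < u y}, E y = ∫ y in K, max (u y - t₀) 0 * E y := by
  rw [intervalIntegral.integral_of_le hT]
  set F : ℝ → ℂ → ℝ := fun t y => {p : ℝ × ℂ | p.1 < u p.2}.indicator (fun p => E p.2) (t, y) with hF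
  have hP : MeasurableSet {p : ℝ × ℂ | p.1 < u p.2} :=
    (isOpen_lt continuous_fst (hu.comp continuous_snd)).measurableSet
  have h1 : ∀ t, ∫ y in K ∩ {y | t < u y}, E y = ∫ y in K, F t y := fun t => by
    rw [Set.inter_comm, ← Measure.restrict_restrict (isOpen_lt continuous_const hu).measurableSet,
      ← integral_indicator (isOpen_lt continuous_const hu).measurableSet]
    rfl
  simp_rw [h1]
  rw [integral_integral_swap]
  · refine setIntegral_congr_fun hK.measurableSet fun y _ => ?_
    have h2 : ∀ t, F t y = (Set.Iio (u y)).indicator (fun _ => E y) t := fun t => rfl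
    simp_rw [h2]
    rw [integral_indicator measurableSet_Iio, Measure.restrict_restrict measurableSet_Iio,
      setIntegral_const, smul_eq_mul]
    congr 1
    have h3 : volume.real (Set.Iio (u y) ∩ Set.Ioc t₀ T) = volume.real (Set.Ioo t₀ (u y)) := by
      by_cases h : u y < T
      · congr 1; ext x
        simp only [Set.mem_inter_iff, Set.mem_Iio, Set.mem_Ioc, Set.mem_Ioo]
        constructor
        · rintro ⟨a, b, c⟩; exact ⟨b, a⟩
        · rintro ⟨a, b⟩; exact ⟨b, a, by linarith⟩
      · congr 1; ext x
        have := huT y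
        simp only [Set.mem_inter_iff, Set.mem_Iio, Set.mem_Ioc, Set.mem_Ioo]
        constructor
        · rintro ⟨a, b, c⟩; exact ⟨b, a⟩
        · rintro ⟨a, b⟩; exact ⟨b, a, by linarith⟩
    rw [h3, Measure.real, Real.volume_Ioo, ENNReal.toReal_ofReal']
  · have : Integrable (fun p : ℝ × ℂ => E p.2)
        ((volume.restrict (Set.Ioc t₀ T)).prod (volume.restrict K)) := hE.comp_snd _
    exact this.indicator hP

theorem grad_sq_integrable {ψ : ℂ → ℝ} (hψ : ContDiff ℝ 1 ψ) (hc : HasCompactSupport ψ) :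
    Integrable fun z => ‖fderiv ℝ ψ z‖ ^ 2 := by
  have h1 : Continuous fun z => ‖fderiv ℝ ψ z‖ ^ 2 := (hψ.continuous_fderiv (by simp)).norm.pow 2
  refine h1.integrable_of_hasCompactSupport ?_
  exact (hc.fderiv ℝ).comp_left (g := fun L : ℂ →L[ℝ] ℝ => ‖L‖ ^ 2) (by simp)

/-- Passing to the limit in the shell inequality. -/
theorem shell_limit {D m J : ℝ → ℝ} (hD : Monotone D) (hm : Antitone m) {t S : ℝ} (ht : 0 < t)

    (hJ : ∀ ε, 0 < ε → J ε ^ 2 ≤ 4 * (t + ε) * (D (t + ε) - D t) * (m t - m (t + ε)))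
    (hS : ∀ η > 0, ∀ᶠ ε in nhdsWithin 0 (Set.Ioi 0), √S - η ≤ 1 / ε * J ε)
    {D' m' : ℝ} (hD' : HasDerivAt D D' t) (hm' : HasDerivAt m m' t) : S ≤ 4 * t * D' * (-m') := by
  have hD0 : 0 ≤ D' := by
    rw [← hD'.deriv]; exact hD.deriv_nonneg
  have hm0 : 0 ≤ -m' := by
    rw [← hm'.deriv]; have := hm.deriv_nonpos (x := t); linarith
  have hL : 0 ≤ 4 * t * D' * (-m') := by positivity
  have l1 := (hasDerivAt_iff_tendsto_slope_zero.mp hD').mono_left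
    (nhdsWithin_mono 0 (fun x (hx : 0 < x) => hx.ne') : nhdsWithin (0:ℝ) (Set.Ioi 0) ≤ _)
  have l2 := (hasDerivAt_iff_tendsto_slope_zero.mp hm').mono_left
    (nhdsWithin_mono 0 (fun x (hx : 0 < x) => hx.ne') : nhdsWithin (0:ℝ) (Set.Ioi 0) ≤ _)
  have l0 : Filter.Tendsto (fun ε : ℝ => 4 * (t + ε)) (nhdsWithin 0 (Set.Ioi 0)) (nhds (4 * (t + 0))) :=
    ((tendsto_const_nhds.add Filter.tendsto_id).const_mul 4).mono_left nhdsWithin_le_nhds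
  rw [add_zero] at l0
  have l3 := ((l0.mul l1).mul l2.neg).sqrt
  have hS' : ∀ η > 0, √S - η ≤ √(4 * t * D' * (-m')) := by
    intro η hη
    refine ge_of_tendsto l3 ?_
    filter_upwards [hS η hη, self_mem_nhdsWithin] with ε h hε
    have hε : 0 < ε := hε
    refine h.trans ?_
    apply Real.le_sqrt_of_sq_le
    have h1 := hJ ε hε
    simp only [smul_eq_mul]
    calc (1 / ε * J ε) ^ 2 = (ε⁻¹) ^ 2 * J ε ^ 2 := by rw [one_div]; ring
      _ ≤ (ε⁻¹) ^ 2 * (4 * (t + ε) * (D (t + ε) - D t) * (m t - m (t + ε))) :=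
          mul_le_mul_of_nonneg_left h1 (by positivity)
      _ = _ := by ring
  have h2 : √S ≤ √(4 * t * D' * (-m')) := le_of_forall_pos_sub_le hS'
  exact (Real.sqrt_le_sqrt_iff hL).mp h2

open Laplacian in
theorem energy_ineq {Ω U : Set ℂ} (hΩ : IsOpen Ω) (hsc : IsSimplyConnected Ω)
    (hU : IsOpen U) (hΩU : Ω ⊆ U) {w : ℂ → ℝ}
    (hw : ContDiffOn ℝ 2 w U) {δ : ℝ} (hδ : 0 < δ) (hδ1 : δ < 1)
    (hsup : ∀ y ∈ Ω, 0 ≤ Δ w y + (1 - δ) * exp (w y))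
    (hwint : IntegrableOn (fun y => exp (w y)) Ω) (hmass : ∫ y in Ω, exp (w y) ≤ 8 * π)
    {ψ : ℂ → ℝ} (hψ : ContDiff ℝ 3 ψ) (hc : HasCompactSupport ψ) (hsu : tsupport ψ ⊆ Ω)
    {M : ℝ} (hM : M < 4 * π) (hψM : ∫ y in tsupport ψ, exp (w y) ≤ M) {t₀ : ℝ} (ht₀ : 0 < t₀)
    (hreg : {t | t₀ < t ∧ ∃ y, ψ y ^ 2 = t ∧ fderiv ℝ (fun y => ψ y ^ 2) y = 0}.Countable) :
    (1 + δ / 16) * ∫ y in tsupport ψ, max (ψ y ^ 2 - t₀) 0 * exp (w y) ≤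
      (∫ y, ‖fderiv ℝ ψ y‖ ^ 2) + t₀ * ricG δ M := by
  obtain ⟨K, hKdef⟩ : ∃ K, K = tsupport ψ := ⟨_, rfl⟩
  have hK : IsCompact K := by rw [hKdef]; exact hc
  have hKΩ : K ⊆ Ω := hKdef ▸ hsu
  rw [← hKdef] at hψM ⊢
  have hψc : Continuous fun z => ψ z ^ 2 := hψ.continuous.pow 2
  have hu : ContDiff ℝ 3 fun z => ψ z ^ 2 := hψ.pow 2
  have hts : tsupport (fun z => ψ z ^ 2) ⊆ K := by
    rw [hKdef]
    refine closure_mono fun z hz => ?_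
    intro h0
    exact hz (by simp [h0])
  have hcu : HasCompactSupport fun z => ψ z ^ 2 := hK.of_isClosed_subset (isClosed_tsupport _) hts
  have hwK : ContinuousOn w K := hw.continuousOn.mono (hKΩ.trans hΩU)
  have hei : IntegrableOn (fun z => exp (w z)) K := hwint.mono_set hKΩ
  have hdi : Integrable fun z => ‖fderiv ℝ ψ z‖ ^ 2 := by
    exact grad_sq_integrable (hψ.of_le (by norm_num)) hc
  have h_intg : Integrable (fun z => ‖fderiv ℝ (fun y => ψ y ^ 2) z‖ * exp (w z / 2)) := by
    have h1 : IntegrableOn (fun z => ‖fderiv ℝ (fun y => ψ y ^ 2) z‖ * exp (w z / 2)) K := by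
      refine ContinuousOn.integrableOn_compact hK ?_
      exact (hu.continuous_fderiv (by norm_num)).norm.continuousOn.mul
        (Real.continuous_exp.comp_continuousOn (hwK.div_const 2))
    refine (integrableOn_iff_integrable_of_support_subset ?_).mp h1
    intro z hz
    apply hts
    apply support_fderiv_subset ℝ
    intro h0
    exact hz (by simp only [h0, norm_zero, zero_mul])
  set D : ℝ → ℝ := fun t => ∫ z in {z | ψ z ^ 2 ≤ t}, ‖fderiv ℝ ψ z‖ ^ 2 with hDdef
  set m : ℝ → ℝ := fun t => ∫ z in K ∩ {z | t < ψ z ^ 2}, exp (w z) with hmdef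
  have hDm : Monotone D := fun s t hst => setIntegral_mono_set hdi.integrableOn
    (Filter.Eventually.of_forall fun z => by positivity)
    (Filter.Eventually.of_forall fun z (hz : ψ z ^ 2 ≤ s) => show ψ z ^ 2 ≤ t from hz.trans hst)
  have hmm : Antitone m := fun s t hst => setIntegral_mono_set (hei.mono_set Set.inter_subset_left)
    (Filter.Eventually.of_forall fun z => (exp_pos _).le)
    (Filter.Eventually.of_forall fun z hz => ⟨hz.1, lt_of_le_of_lt hst hz.2⟩)
  have hm0 : ∀ t, 0 ≤ m t := fun t => integral_nonneg fun z => (exp_pos _).le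
  have hmM : ∀ t, m t ≤ M := fun t => (setIntegral_mono_set hei
    (Filter.Eventually.of_forall fun z => (exp_pos _).le)
    (Filter.Eventually.of_forall fun z hz => hz.1)).trans hψM
  obtain ⟨C, hC⟩ := hcu.exists_bound_of_continuous hψc
  have hCb : ∀ y, ψ y ^ 2 ≤ max t₀ C := fun y =>
    ((le_abs_self _).trans (hC y)).trans (le_max_right _ _)
  have hmT : m (max t₀ C) = 0 := by
    have : K ∩ {z | max t₀ C < ψ z ^ 2} = ∅ := by
      ext z
      simp only [Set.mem_inter_iff, Set.mem_ofPred_eq, Set.mem_empty_iff_false, iff_false, not_and, not_lt]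
      exact fun _ => hCb z
    simp only [hmdef]
    rw [this]; simp
  have hae : ∀ᵐ t, t ∈ Set.Ioo t₀ (max t₀ C) → ∀ D' m', HasDerivAt D D' t → HasDerivAt m m' t →
      prof δ (m t) ≤ 4 * t * D' * (-m') := by
    have hn : {t : ℝ | 0 < volume {a : ℂ | ψ a ^ 2 = t}}.Countable :=
      Measure.countable_meas_level_set_pos hψc.measurable
    have hnull := (hreg.union hn).measure_zero (volume : Measure ℝ)
    rw [measure_eq_zero_iff_ae_notMem] at hnull
    filter_upwards [hnull] with t ht htI D' m' hD' hm'
    rw [Set.mem_union, not_or] at ht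
    have ht0 : 0 < t := ht₀.trans htI.1
    have hlev : volume {y : ℂ | ψ y ^ 2 = t} = 0 := by
      have := ht.2
      simpa using this
    have hmt : ∫ y in {y | t < ψ y ^ 2}, exp (w y) = m t := by
      simp only [hmdef]
      congr 2
      rw [eq_comm, Set.inter_eq_right]
      intro z hz
      apply hts
      apply subset_tsupport
      have : t < ψ z ^ 2 := hz
      exact (ht0.trans this).ne'
    refine shell_limit hDm hmm ht0
      (J := fun ε => ∫ z in {z | t < ψ z ^ 2 ∧ ψ z ^ 2 < t + ε},
        ‖fderiv ℝ (fun y => ψ y ^ 2) z‖ * exp (w z / 2))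

      (fun ε hε => cs_shell hw.continuousOn (hKΩ.trans hΩU) hK hψ hKdef ht0 hε) ?_ hD' hm'
    intro η hη
    have := iso_slack hΩ hsc hU hΩU hw hδ hδ1 hsup hwint hmass hu hcu (hts.trans hKΩ) ht0
      (fun y hy h0 => ht.1 ⟨htI.1, y, hy, h0⟩) hlev h_intg hη
    rwa [hmt] at this
  have hone := one_dim hDm hmm hm0 hM hmM ht₀ (le_max_left t₀ C) hmT hδ hδ1.le hae
  simp only [hmdef] at hone
  rw [layer_cake hK hψc hei (le_max_left _ _) hCb] at hone
  have h1 : D (max t₀ C) ≤ ∫ y, ‖fderiv ℝ ψ y‖ ^ 2 :=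
    setIntegral_le_integral hdi (Filter.Eventually.of_forall fun z => by positivity)
  have h2 : 0 ≤ D t₀ := integral_nonneg fun z => by positivity
  linarith

/-- Almost every value of a `C¹` planar map has a countable fibre. -/
theorem dense_countable_fibre {g : ℂ → ℂ} (hg : ContDiff ℝ 1 g) :
    Dense {a : ℂ | {y | g y = a}.Countable} := by
  have hgd : Differentiable ℝ g := hg.differentiable (by simp)
  have h0 := addHaar_image_eq_zero_of_det_fderivWithin_eq_zero (volume : Measure ℂ)
    (s := {y | (fderiv ℝ g y).det = 0}) (f := g) (f' := fderiv ℝ g)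
    (fun x _ => (hgd x).hasFDerivAt.hasFDerivWithinAt) (fun x hx => hx)
  rw [measure_eq_zero_iff_ae_notMem] at h0
  refine (Measure.dense_of_ae h0).mono ?_
  intro a ha
  have hiso : ∀ y ∈ {y | g y = a}, {y} ∈ nhdsWithin y {y | g y = a} := by
    intro y hy
    have hdet : (fderiv ℝ g y).det ≠ 0 := fun h => ha ⟨y, h, hy⟩
    have hker : LinearMap.ker (fderiv ℝ g y : ℂ →ₗ[ℝ] ℂ) = ⊥ := by
      by_contra hne
      exact hdet (LinearMap.det_eq_zero_iff_ker_ne_bot.mpr hne)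
    obtain ⟨C, -, hC⟩ := LinearMap.exists_antilipschitzWith (fderiv ℝ g y : ℂ →ₗ[ℝ] ℂ) hker
    have := (hgd y).hasFDerivAt.eventually_ne (c := a) ⟨C, hC⟩
    rw [eventually_nhdsWithin_iff] at this
    rw [mem_nhdsWithin_iff_eventually]
    filter_upwards [this] with z hz hza
    by_contra hzy
    exact hz hzy hza
  obtain ⟨t, -, htc, hts⟩ := TopologicalSpace.countable_cover_nhdsWithin hiso
  refine htc.mono (hts.trans ?_)
  intro z hz
  simpa using hz

theorem clm_ext_re_im {L₁ L₂ : ℂ →L[ℝ] ℝ} (h1 : L₁ 1 = L₂ 1) (h2 : L₁ Complex.I = L₂ Complex.I) :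
    L₁ = L₂ := by
  ext z
  have hz : z = z.re • (1 : ℂ) + z.im • Complex.I := by
    simp [Complex.re_add_im]
  rw [hz]
  simp only [map_add, map_smul, h1, h2]

theorem exists_cutoff {S V : Set ℂ} (hS : IsCompact S) (hV : IsOpen V) (hSV : S ⊆ V) :
    ∃ χ : ℂ → ℝ, ContDiff ℝ 3 χ ∧ HasCompactSupport χ ∧ tsupport χ ⊆ V ∧ (∀ y ∈ S, χ y = 1) ∧
      ∀ y, 0 ≤ χ y ∧ χ y ≤ 1 := by
  obtain ⟨K, hK, hSK, hKV⟩ := exists_compact_between hS hV hSV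
  obtain ⟨f, h1, h2, h3⟩ := exists_contMDiffMap_one_nhds_of_subset_interior (n := 3) 𝓘(ℝ, ℂ)
    hS.isClosed hSK
  have hts : tsupport f ⊆ K := by
    refine closure_minimal (fun y hy => ?_) hK.isClosed
    by_contra h
    exact hy (h2 y h)
  refine ⟨f, f.contMDiff.contDiff, hK.of_isClosed_subset (isClosed_tsupport _) hts, hts.trans hKV,
    fun y hy => h1.self_of_nhdsSet y hy, h3⟩

open Laplacian in
theorem energy_final {Ω U V : Set ℂ} (hΩ : IsOpen Ω) (hsc : IsSimplyConnected Ω)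
    (hbd : Bornology.IsBounded Ω)
    (hU : IsOpen U) (hΩU : Ω ⊆ U) {w : ℂ → ℝ}
    (hw : ContDiffOn ℝ 2 w U) {δ : ℝ} (hδ : 0 < δ) (hδ1 : δ < 1)
    (hsup : ∀ y ∈ Ω, 0 ≤ Δ w y + (1 - δ) * exp (w y))
    (hwint : IntegrableOn (fun y => exp (w y)) Ω) (hmass : ∫ y in Ω, exp (w y) ≤ 8 * π)
    (hV : IsOpen V) (hne : V.Nonempty) (hVΩ : V ⊆ Ω) (hVm : ∫ y in V, exp (w y) ≤ 4 * π)
    {φ : ℂ → ℝ} (hφ : ContDiff ℝ 3 φ) (hc : HasCompactSupport φ) (hsu : tsupport φ ⊆ V) :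
    (1 + δ / 16) * ∫ y in V, φ y ^ 2 * exp (w y) ≤ ∫ y, ‖fderiv ℝ φ y‖ ^ 2 := by
  obtain ⟨χ, hχ, hχc, hχV, hχ1, hχb⟩ := exists_cutoff hc hV hsu
  obtain ⟨K, hKdef⟩ : ∃ K, K = tsupport χ := ⟨_, rfl⟩
  have hK : IsCompact K := by rw [hKdef]; exact hχc
  have hKV : K ⊆ V := hKdef ▸ hχV
  have hKΩ := hKV.trans hVΩ
  have hwV : IntegrableOn (fun y => exp (w y)) V := hwint.mono_set hVΩ
  have hwK : IntegrableOn (fun y => exp (w y)) K := hwV.mono_set hKV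
  -- the mass of `K` is strictly smaller than `4π`
  have hM : ∫ y in K, exp (w y) < 4 * π := by
    refine lt_of_lt_of_le ?_ hVm
    have hsub : (V \ K).Nonempty := by
      by_contra hemp
      rw [Set.not_nonempty_iff_eq_empty, Set.sdiff_eq_empty] at hemp
      have heq : V = K := hemp.antisymm hKV
      have hcl : IsClopen V := ⟨heq ▸ hK.isClosed, hV⟩
      rcases isClopen_iff.mp hcl with h | h
      · exact hne.ne_empty h
      · exact NoncompactSpace.noncompact_univ (X := ℂ) (by rw [← h, heq]; exact hK)
    have hopen : IsOpen (V \ K) := hV.sdiff hK.isClosed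
    have hpos : 0 < ∫ y in V \ K, exp (w y) := by
      rw [setIntegral_pos_iff_support_of_nonneg_ae]
      · have : Function.support (fun y => exp (w y)) = Set.univ := by
          ext y; simp
        rw [this, Set.univ_inter]
        exact hopen.measure_pos _ hsub
      · exact Filter.Eventually.of_forall fun y => (exp_pos _).le
      · exact hwV.mono_set Set.sdiff_subset
    rw [setIntegral_sdiff hK.measurableSet hwV hKV] at hpos
    linarith
  set p : ℂ → ℝ := fun y => χ y * y.re with hp
  set q : ℂ → ℝ := fun y => χ y * y.im with hq
  have hpC : ContDiff ℝ 3 p := hχ.mul Complex.reCLM.contDiff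
  have hqC : ContDiff ℝ 3 q := hχ.mul Complex.imCLM.contDiff
  have hpc : HasCompactSupport p := hχc.mul_right
  have hqc : HasCompactSupport q := hχc.mul_right
  set ψ : ℂ → ℂ → ℝ := fun a y => φ y - (a.re * p y + a.im * q y) with hψ
  have hψC : ∀ a, ContDiff ℝ 3 (ψ a) := fun a =>
    hφ.sub ((contDiff_const.mul hpC).add (contDiff_const.mul hqC))
  have hφK : tsupport φ ⊆ K := by
    rw [hKdef]
    intro y hy
    apply subset_tsupport
    simp [hχ1 y hy]
  have hψ0 : ∀ a, ∀ y ∉ K, ψ a y = 0 := fun a y hy => by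
    have h1 : φ y = 0 := by
      by_contra h; exact hy (hφK (subset_tsupport φ h))
    have h2 : χ y = 0 := by
      by_contra h; exact hy (hKdef ▸ subset_tsupport χ h)
    simp [hψ, hp, hq, h1, h2]
  have hψK : ∀ a, tsupport (ψ a) ⊆ K := fun a => by
    refine closure_minimal (fun y hy => ?_) hK.isClosed
    by_contra h
    exact hy (hψ0 a y h)
  have hψc : ∀ a, HasCompactSupport (ψ a) := fun a =>
    hK.of_isClosed_subset (isClosed_tsupport _) (hψK a)
  -- bound for the linear term
  obtain ⟨R, hR0, hR⟩ : ∃ R, 0 < R ∧ ∀ y ∈ K, ‖y‖ ≤ R := by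
    obtain ⟨R, hR⟩ := hK.isBounded.exists_norm_le
    exact ⟨max R 1, by positivity, fun y hy => (hR y hy).trans (le_max_left _ _)⟩
  have hlin : ∀ a y : ℂ, |a.re * p y + a.im * q y| ≤ ‖a‖ * R := fun a y => by
    by_cases hy : y ∈ K
    · have e : a.re * p y + a.im * q y = χ y * (a.re * y.re + a.im * y.im) := by
        simp only [hp, hq]; ring
      have e2 : |a.re * y.re + a.im * y.im| ≤ ‖a‖ * ‖y‖ := by
        have h1 : a.re * y.re + a.im * y.im = (a * (starRingEnd ℂ) y).re := by
          simp [Complex.mul_re]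
        rw [h1]
        refine (Complex.abs_re_le_norm _).trans ?_
        rw [norm_mul, Complex.norm_conj]
      rw [e, abs_mul, abs_of_nonneg (hχb y).1]
      calc χ y * |a.re * y.re + a.im * y.im| ≤ 1 * (‖a‖ * ‖y‖) :=
            mul_le_mul (hχb y).2 e2 (abs_nonneg _) zero_le_one
        _ ≤ ‖a‖ * R := by
            rw [one_mul]; exact mul_le_mul_of_nonneg_left (hR y hy) (norm_nonneg _)
    · have h2 : χ y = 0 := by
        by_contra h; exact hy (hKdef ▸ subset_tsupport χ h)
      simp only [hp, hq, h2]
      simp only [zero_mul, mul_zero, add_zero, abs_zero]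
      positivity
  -- the gradient map
  set g : ℂ → ℂ := fun y => (fderiv ℝ φ y 1 : ℝ) + (fderiv ℝ φ y Complex.I : ℝ) * Complex.I with hgdef
  have hgC : ContDiff ℝ 1 g := by
    have h1 : ContDiff ℝ 1 (fderiv ℝ φ) := hφ.fderiv_right (by norm_num)
    have h2 : ∀ v, ContDiff ℝ 1 fun y => ((fderiv ℝ φ y v : ℝ) : ℂ) := fun v =>
      Complex.ofRealCLM.contDiff.comp (h1.clm_apply contDiff_const)
    exact (h2 1).add ((h2 Complex.I).mul contDiff_const)
  have hcount : ∀ a : ℂ, {y | g y = a}.Countable → ∀ t₀ : ℝ, (‖a‖ * R) ^ 2 ≤ t₀ →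
      {t | t₀ < t ∧ ∃ y, ψ a y ^ 2 = t ∧ fderiv ℝ (fun y => ψ a y ^ 2) y = 0}.Countable := by
    intro a ha t₀ hat
    refine (ha.image (fun y => ψ a y ^ 2)).mono ?_
    rintro t ⟨htt, y, hy, hfd⟩
    refine ⟨y, ?_, hy⟩
    have hlt : (‖a‖ * R) ^ 2 < ψ a y ^ 2 := by rw [hy]; exact lt_of_le_of_lt hat htt
    have hψne : ψ a y ≠ 0 := by
      intro h; rw [h] at hlt
      have := sq_nonneg (‖a‖ * R); norm_num at hlt; linarith
    have hφne : φ y ≠ 0 := by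
      intro h
      have h1 : ψ a y ^ 2 ≤ (‖a‖ * R) ^ 2 := by
        rw [← sq_abs (ψ a y)]
        refine pow_le_pow_left₀ (abs_nonneg _) ?_ 2
        simp only [hψ, h, zero_sub, abs_neg]
        exact hlin a y
      linarith
    have hev : ψ a =ᶠ[nhds y] fun z => φ z - (a.re * z.re + a.im * z.im) := by
      have : {z | φ z ≠ 0} ∈ nhds y := (hφ.continuous.isOpen_preimage _ isOpen_compl_singleton).mem_nhds hφne
      filter_upwards [this] with z hz
      have := hχ1 z (subset_tsupport φ hz)
      simp [hψ, hp, hq, this]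
    have hl : HasFDerivAt (fun z => φ z - (a.re * z.re + a.im * z.im))
        (fderiv ℝ φ y - (a.re • Complex.reCLM + a.im • Complex.imCLM)) y :=
      ((hφ.differentiable (by norm_num) y).hasFDerivAt).sub
        ((Complex.reCLM.hasFDerivAt.const_mul a.re).add (Complex.imCLM.hasFDerivAt.const_mul a.im))
    have hsq : fderiv ℝ (fun y => ψ a y ^ 2) y = (2 * ψ a y) • fderiv ℝ (ψ a) y := by
      have := (((hψC a).differentiable (by norm_num) y).hasFDerivAt).pow 2
      have h1 : HasFDerivAt (fun y => ψ a y ^ 2) ((2 * ψ a y) • fderiv ℝ (ψ a) y) y := by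
        simpa using! this
      exact h1.fderiv
    rw [hsq, smul_eq_zero] at hfd
    have hz : fderiv ℝ (ψ a) y = 0 := hfd.resolve_left (by simpa using hψne)
    rw [hev.fderiv_eq, hl.fderiv, sub_eq_zero] at hz
    show g y = a
    simp only [hgdef, hz]
    simp [Complex.re_add_im]
  -- the sequence of perturbations
  have hseq : ∀ n : ℕ, ∃ a : ℂ, ‖a‖ < 1 / ((n : ℝ) + 1) ∧ {y | g y = a}.Countable := fun n => by
    obtain ⟨a, ha, hb⟩ := (dense_countable_fibre hgC).exists_mem_open (Metric.isOpen_ball)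
      (show (Metric.ball (0 : ℂ) (1 / ((n : ℝ) + 1))).Nonempty from ⟨0, by simp; positivity⟩)
    exact ⟨a, by simpa using hb, ha⟩
  choose a ha hac using hseq
  have ht0 : Filter.Tendsto (fun n : ℕ => 1 / ((n : ℝ) + 1)) Filter.atTop (nhds 0) :=
    tendsto_one_div_add_atTop_nhds_zero_nat
  have ha0 : Filter.Tendsto a Filter.atTop (nhds 0) :=
    squeeze_zero_norm (fun n => (ha n).le) ht0
  have har : Filter.Tendsto (fun n => (a n).re) Filter.atTop (nhds 0) := by
    simpa using! (Complex.continuous_re.tendsto 0).comp ha0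
  have hai : Filter.Tendsto (fun n => (a n).im) Filter.atTop (nhds 0) := by
    simpa using! (Complex.continuous_im.tendsto 0).comp ha0
  have ha1 : ∀ n, ‖a n‖ ≤ 1 := fun n => (ha n).le.trans (by
    rw [div_le_one (by positivity)]; linarith [(Nat.cast_nonneg n : (0 : ℝ) ≤ n)])
  set τ : ℕ → ℝ := fun n => (1 / ((n : ℝ) + 1) * R) ^ 2 with hτ
  have hτ0 : Filter.Tendsto τ Filter.atTop (nhds 0) := by
    have := (ht0.mul_const R).pow 2
    rw [zero_mul, zero_pow two_ne_zero] at this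
    exact this
  have hineq : ∀ n, (1 + δ / 16) * ∫ y in K, max (ψ (a n) y ^ 2 - τ n) 0 * exp (w y) ≤
      (∫ y, ‖fderiv ℝ (ψ (a n)) y‖ ^ 2) + τ n * ricG δ (∫ y in K, exp (w y)) := fun n => by
    have h1 := energy_ineq hΩ hsc hU hΩU hw hδ hδ1 hsup hwint hmass (hψC (a n)) (hψc (a n))
      ((hψK (a n)).trans hKΩ) hM
      (setIntegral_mono_set hwK (Filter.Eventually.of_forall fun y => (exp_pos _).le)
        (Filter.Eventually.of_forall fun y hy => hψK (a n) hy)) (t₀ := τ n) (by simp only [hτ]; positivity)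
      (hcount (a n) (hac n) _ (by
        simp only [hτ]
        have := (ha n).le
        gcongr))
    have h2 : ∫ y in tsupport (ψ (a n)), max (ψ (a n) y ^ 2 - τ n) 0 * exp (w y) =
        ∫ y in K, max (ψ (a n) y ^ 2 - τ n) 0 * exp (w y) := by
      rw [setIntegral_eq_of_subset_of_forall_sdiff_eq_zero hK.measurableSet (hψK (a n))]
      intro y hy
      have h3 : ψ (a n) y = 0 := by
        by_contra h; exact hy.2 (subset_tsupport _ h)
      have h4 : 0 ≤ τ n := by simp only [hτ]; positivity
      rw [h3, max_eq_right (by simpa using h4), zero_mul]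
    rwa [h2] at h1
  have hψlim : ∀ y, Filter.Tendsto (fun n => ψ (a n) y) Filter.atTop (nhds (φ y)) := fun y => by
    have := (tendsto_const_nhds (x := φ y)).sub ((har.mul_const (p y)).add (hai.mul_const (q y)))
    simpa using! this
  have hwcK : ContinuousOn w K := hw.continuousOn.mono (hKΩ.trans hΩU)
  have L1 : Filter.Tendsto (fun n => ∫ y in K, max (ψ (a n) y ^ 2 - τ n) 0 * exp (w y)) Filter.atTop
      (nhds (∫ y in K, max (φ y ^ 2 - 0) 0 * exp (w y))) := by
    obtain ⟨C, hC⟩ := hc.exists_bound_of_continuous hφ.continuous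
    refine tendsto_integral_of_dominated_convergence (fun y => (C + R) ^ 2 * exp (w y)) ?_
      (hwK.const_mul _) ?_ ?_
    · intro n
      refine ContinuousOn.aestronglyMeasurable ?_ hK.measurableSet
      exact ((((hψC (a n)).continuous.pow 2).sub continuous_const).max continuous_const).continuousOn.mul
        (Real.continuous_exp.comp_continuousOn hwcK)
    · intro n
      refine Filter.Eventually.of_forall fun y => ?_
      rw [Real.norm_of_nonneg (mul_nonneg (le_max_right _ _) (exp_pos _).le)]
      refine mul_le_mul_of_nonneg_right ?_ (exp_pos _).le
      refine max_le ?_ (sq_nonneg _)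
      have h4 : 0 ≤ τ n := by simp only [hτ]; positivity
      have h5 : |ψ (a n) y| ≤ C + R := by
        refine (abs_sub _ _).trans (add_le_add (hC y) ((hlin (a n) y).trans ?_))
        exact mul_le_of_le_one_left hR0.le (ha1 n)
      have h6 : ψ (a n) y ^ 2 ≤ (C + R) ^ 2 := by
        rw [← sq_abs (ψ (a n) y)]
        exact pow_le_pow_left₀ (abs_nonneg _) h5 2
      linarith
    · refine Filter.Eventually.of_forall fun y => ?_
      exact ((((hψlim y).pow 2).sub hτ0).max tendsto_const_nhds).mul_const _
  have hfdψ : ∀ b y, fderiv ℝ (ψ b) y = fderiv ℝ φ y - (b.re • fderiv ℝ p y + b.im • fderiv ℝ q y) := by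
    intro b y
    have h1 := (hφ.differentiable (by norm_num) y).hasFDerivAt
    have h2 := (hpC.differentiable (by norm_num) y).hasFDerivAt
    have h3 := (hqC.differentiable (by norm_num) y).hasFDerivAt
    exact (h1.sub ((h2.const_mul b.re).add (h3.const_mul b.im))).fderiv
  have L2 : Filter.Tendsto (fun n => ∫ y, ‖fderiv ℝ (ψ (a n)) y‖ ^ 2) Filter.atTop
      (nhds (∫ y, ‖fderiv ℝ φ y‖ ^ 2)) := by
    refine tendsto_integral_of_dominated_convergence
      (fun y => 3 * (‖fderiv ℝ φ y‖ ^ 2 + ‖fderiv ℝ p y‖ ^ 2 + ‖fderiv ℝ q y‖ ^ 2)) ?_ ?_ ?_ ?_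
    · intro n
      exact (((hψC (a n)).continuous_fderiv (by norm_num)).norm.pow 2).aestronglyMeasurable
    · exact (((grad_sq_integrable (hφ.of_le (by norm_num)) hc).add
        (grad_sq_integrable (hpC.of_le (by norm_num)) hpc)).add
        (grad_sq_integrable (hqC.of_le (by norm_num)) hqc)).const_mul 3
    · intro n
      refine Filter.Eventually.of_forall fun y => ?_
      rw [Real.norm_of_nonneg (sq_nonneg _), hfdψ]
      have h1 : ‖fderiv ℝ φ y - ((a n).re • fderiv ℝ p y + (a n).im • fderiv ℝ q y)‖ ≤
          ‖fderiv ℝ φ y‖ + (‖fderiv ℝ p y‖ + ‖fderiv ℝ q y‖) := by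
        refine (norm_sub_le _ _).trans (add_le_add le_rfl ((norm_add_le _ _).trans (add_le_add ?_ ?_)))
        · rw [norm_smul, Real.norm_eq_abs]
          exact mul_le_of_le_one_left (norm_nonneg _) ((Complex.abs_re_le_norm _).trans (ha1 n))
        · rw [norm_smul, Real.norm_eq_abs]
          exact mul_le_of_le_one_left (norm_nonneg _) ((Complex.abs_im_le_norm _).trans (ha1 n))
      have h2 := pow_le_pow_left₀ (norm_nonneg _) h1 2
      nlinarith [sq_nonneg (‖fderiv ℝ φ y‖ - ‖fderiv ℝ p y‖), sq_nonneg (‖fderiv ℝ φ y‖ - ‖fderiv ℝ q y‖),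
        sq_nonneg (‖fderiv ℝ p y‖ - ‖fderiv ℝ q y‖)]
    · refine Filter.Eventually.of_forall fun y => ?_
      have h1 := (tendsto_const_nhds (x := fderiv ℝ φ y)).sub
        ((har.smul_const (fderiv ℝ p y)).add (hai.smul_const (fderiv ℝ q y)))
      simp only [zero_smul, add_zero, sub_zero] at h1
      simp_rw [hfdψ]
      exact h1.norm.pow 2
  have L3 := L2.add (hτ0.mul_const (ricG δ (∫ y in K, exp (w y))))
  have hfin := le_of_tendsto_of_tendsto' (L1.const_mul (1 + δ / 16)) L3 hineq
  rw [zero_mul, add_zero] at hfin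
  have e : ∫ y in V, φ y ^ 2 * exp (w y) = ∫ y in K, max (φ y ^ 2 - 0) 0 * exp (w y) := by
    rw [setIntegral_eq_of_subset_of_forall_sdiff_eq_zero hV.measurableSet hKV]
    · refine setIntegral_congr_fun hK.measurableSet fun y _ => ?_
      show φ y ^ 2 * exp (w y) = max (φ y ^ 2 - 0) 0 * exp (w y)
      rw [sub_zero, max_eq_left (sq_nonneg _)]
    · intro y hy
      have : φ y = 0 := by
        by_contra h; exact hy.2 (hφK (subset_tsupport φ h))
      rw [this]; simp
  rw [e]
  exact hfin

open Laplacian in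
/-- The main theorem in the complex plane. -/
theorem main_complex {Ω U V : Set ℂ} (hΩ : IsOpen Ω) (hsc : IsSimplyConnected Ω)
    (hbd : Bornology.IsBounded Ω) (hU : IsOpen U) (hΩU : closure Ω ⊆ U) {w : ℂ → ℝ}
    (hw : ContDiffOn ℝ 2 w U)
    (hsup : ∀ y ∈ closure Ω, 0 < Δ w y + exp (w y))
    (hmass : ∫ y in Ω, exp (w y) ≤ 8 * π)
    (hV : IsOpen V) (hne : V.Nonempty) (hVΩ : V ⊆ Ω)
    (heig : ∀ ε > (0 : ℝ), ∃ φ : ℂ → ℝ,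
      ContDiff ℝ 3 φ ∧ HasCompactSupport φ ∧ tsupport φ ⊆ V ∧
      (∫ y, (φ y) ^ 2) = 1 ∧
      (∫ y, ‖fderiv ℝ φ y‖ ^ 2) - (∫ y, (φ y) ^ 2 * exp (w y)) ≤ ε) :
    4 * π < ∫ y in V, exp (w y) := by
  by_contra hcon
  push Not at hcon
  have hK : IsCompact (closure Ω) := hbd.isCompact_closure
  have hKne : (closure Ω).Nonempty := (hne.mono hVΩ).mono subset_closure
  have hwc : ContinuousOn (fun y => exp (w y)) (closure Ω) :=
    (Real.continuous_exp.comp_continuousOn hw.continuousOn).mono hΩU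
  have hlapc : ContinuousOn (fun y => Δ w y) (closure Ω) := by
    refine ContinuousOn.mono ?_ hΩU
    have h1 : ContDiffOn ℝ 1 (fun y => fderiv ℝ w y) U := hw.fderiv_of_isOpen hU (by norm_num)
    have h2 : ∀ v : ℂ, ContinuousOn (fun z => fderiv ℝ (fun y => fderiv ℝ w y v) z v) U := by
      intro v
      have h3 : ContDiffOn ℝ 1 (fun y => fderiv ℝ w y v) U := h1.clm_apply contDiffOn_const
      have h4 : ContDiffOn ℝ 0 (fun y => fderiv ℝ (fun y => fderiv ℝ w y v) y) U :=
        h3.fderiv_of_isOpen hU (by norm_num)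
      exact h4.continuousOn.clm_apply continuousOn_const
    exact ((h2 1).add (h2 Complex.I)).congr fun z hz => laplacian_eq' hU hw hz
  obtain ⟨y0, hy0, hmin⟩ := hK.exists_isMinOn hKne (hlapc.add hwc)
  obtain ⟨y1, hy1, hmax⟩ := hK.exists_isMaxOn hKne hwc
  obtain ⟨y2, hy2, hmin2⟩ := hK.exists_isMinOn hKne hwc
  have hμ := hsup y0 hy0
  set μ := Δ w y0 + exp (w y0) with hμd
  set B := exp (w y1) with hB
  set b := exp (w y2) with hb
  have hBp : 0 < B := exp_pos _
  have hbp : 0 < b := exp_pos _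
  obtain ⟨δ, hδ, hδ1, hδB⟩ : ∃ δ : ℝ, 0 < δ ∧ δ < 1 ∧ δ * B ≤ μ := by
    refine ⟨min (1 / 2) (μ / B), lt_min (by norm_num) (by positivity),
      (min_le_left _ _).trans_lt (by norm_num), ?_⟩
    calc _ ≤ μ / B * B := by gcongr; exact min_le_right _ _
      _ = μ := by field_simp
  have hsup2 : ∀ y ∈ Ω, 0 ≤ Δ w y + (1 - δ) * exp (w y) := by
    intro y hy
    have e1 : μ ≤ Δ w y + exp (w y) := hmin (subset_closure hy)
    have e2 : exp (w y) ≤ B := hmax (subset_closure hy)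
    nlinarith
  have hwint : IntegrableOn (fun y => exp (w y)) Ω :=
    (hwc.integrableOn_compact hK).mono_set subset_closure
  obtain ⟨φ, hφ, hc, hs, h1, h2⟩ := heig (δ * b / 32) (by positivity)
  have hE := energy_final hΩ hsc hbd hU (subset_closure.trans hΩU) hw hδ hδ1 hsup2 hwint hmass
    hV hne hVΩ hcon hφ hc hs
  have hz : ∀ y, y ∉ V → φ y = 0 := fun y hy => image_eq_zero_of_notMem_tsupport fun h => hy (hs h)
  have e1 : ∫ y in V, φ y ^ 2 * exp (w y) = ∫ y, φ y ^ 2 * exp (w y) :=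
    setIntegral_eq_integral_of_forall_compl_eq_zero fun y hy => by simp [hz y hy]
  have e2 : ∫ y in V, φ y ^ 2 = ∫ y, φ y ^ 2 :=
    setIntegral_eq_integral_of_forall_compl_eq_zero fun y hy => by simp [hz y hy]
  have i1 : IntegrableOn (fun y => φ y ^ 2) V := by
    refine IntegrableOn.mono_set ?_ (hVΩ.trans subset_closure)
    exact (hφ.continuous.pow 2).continuousOn.integrableOn_compact hK
  have i2 : IntegrableOn (fun y => φ y ^ 2 * exp (w y)) V := by
    refine IntegrableOn.mono_set ?_ (hVΩ.trans subset_closure)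
    exact ((hφ.continuous.pow 2).continuousOn.mul hwc).integrableOn_compact hK
  have e3 : b * ∫ y in V, φ y ^ 2 ≤ ∫ y in V, φ y ^ 2 * exp (w y) := by
    rw [← integral_const_mul]
    refine setIntegral_mono_on (i1.const_mul b) i2 hV.measurableSet fun y hy => ?_
    have : b ≤ exp (w y) := hmin2 (subset_closure (hVΩ hy))
    nlinarith [sq_nonneg (φ y)]
  rw [e2, h1, e1] at e3
  rw [e1] at hE
  have : 0 < δ * b := by positivity
  nlinarith

open Laplacian in
theorem laplacian_comp_equiv (w : ℝ × ℝ → ℝ) (z : ℂ) :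
    Δ (w ∘ Complex.equivRealProdCLM) z =
      iteratedFDeriv ℝ 2 w (Complex.equivRealProdCLM z) ![(1, 0), (1, 0)] +
      iteratedFDeriv ℝ 2 w (Complex.equivRealProdCLM z) ![(0, 1), (0, 1)] := by
  have h := ContinuousLinearEquiv.iteratedFDerivWithin_comp_right Complex.equivRealProdCLM w
    uniqueDiffOn_univ (x := z) (Set.mem_univ _) 2
  simp only [Set.preimage_univ, iteratedFDerivWithin_univ] at h
  rw [InnerProductSpace.laplacian_eq_iteratedFDeriv_complexPlane]
  beta_reduce
  rw [h]
  simp only [ContinuousMultilinearMap.compContinuousLinearMap_apply]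
  congr 2 <;> (ext i <;> fin_cases i <;> simp)

/-- Transfer to `ℝ × ℝ`. -/
theorem main_real
    (Ω : Set (ℝ × ℝ)) (hbdd : Bornology.IsBounded Ω)
    (hopen : IsOpen Ω) (hsc : SimplyConnectedSpace Ω)
    (w : ℝ × ℝ → ℝ)
    (U : Set (ℝ × ℝ)) (hU : IsOpen U) (hclU : closure Ω ⊆ U)
    (hw : ContDiffOn ℝ 2 w U)
    (hsuper : ∀ y ∈ closure Ω, 0 < (iteratedFDeriv ℝ 2 w y ![(1, 0), (1, 0)] +
      iteratedFDeriv ℝ 2 w y ![(0, 1), (0, 1)]) + Real.exp (w y))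
    (hmass : (∫ y in Ω, Real.exp (w y)) ≤ 8 * Real.pi)
    (V : Set (ℝ × ℝ)) (hVΩ : V ⊆ Ω) (hVne : V.Nonempty) (hVopen : IsOpen V)
    (heig : ∀ ε > (0 : ℝ), ∃ φ : ℝ × ℝ → ℝ,
      ContDiff ℝ (⊤ : ℕ∞) φ ∧ HasCompactSupport φ ∧ tsupport φ ⊆ V ∧
      (∫ y : ℝ × ℝ, (φ y) ^ 2) = 1 ∧
      (∫ y : ℝ × ℝ, ((fderiv ℝ φ y (1, 0)) ^ 2 + (fderiv ℝ φ y (0, 1)) ^ 2)) -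
        (∫ y : ℝ × ℝ, (φ y) ^ 2 * Real.exp (w y)) ≤ ε) :
    4 * Real.pi < ∫ y in V, Real.exp (w y) := by
  set e := Complex.equivRealProdCLM with he
  have hmp : MeasurePreserving e volume volume := Complex.volume_preserving_equiv_real_prod
  have hemb : MeasurableEmbedding e := e.toHomeomorph.measurableEmbedding
  have h_intg : ∀ f : ℝ × ℝ → ℝ, ∫ z, f (e z) = ∫ y, f y := fun f => hmp.integral_comp hemb f
  have hset : ∀ (f : ℝ × ℝ → ℝ) (S : Set (ℝ × ℝ)), ∫ z in e ⁻¹' S, f (e z) = ∫ y in S, f y :=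
    fun f S => hmp.setIntegral_preimage_emb hemb f S
  have hcl : closure (e ⁻¹' Ω) = e ⁻¹' closure Ω := (e.toHomeomorph.preimage_closure Ω).symm
  rw [← hset (fun y => Real.exp (w y)) V]
  refine main_complex (Ω := e ⁻¹' Ω) (U := e ⁻¹' U) (V := e ⁻¹' V) (w := w ∘ e)
    (hopen.preimage e.continuous) ?_ ?_ (hU.preimage e.continuous) ?_ ?_ ?_ ?_
    (hVopen.preimage e.continuous) ?_ (Set.preimage_mono hVΩ) ?_
  · exact (e.toHomeomorph.isSimplyConnected_preimage (s := Ω)).2 hsc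
  · have := (e.symm : ℝ × ℝ →L[ℝ] ℂ).lipschitz.isBounded_image hbdd
    refine this.subset fun z hz => ⟨e z, hz, by simp⟩
  · rw [hcl]; exact Set.preimage_mono hclU
  · exact hw.comp e.contDiff.contDiffOn fun z hz => hz
  · intro z hz
    rw [hcl] at hz
    rw [laplacian_comp_equiv]
    exact hsuper _ hz
  · exact (hset (fun y => Real.exp (w y)) Ω).trans_le hmass
  · obtain ⟨y, hy⟩ := hVne
    exact ⟨e.symm y, by simpa using hy⟩
  · intro ε hε
    obtain ⟨φ, hφ, hc, hs, h1, h2⟩ := heig ε hε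
    refine ⟨φ ∘ e, (contDiff_infty.1 hφ 3).comp e.contDiff,
      hc.comp_homeomorph e.toHomeomorph, ?_, ?_, ?_⟩
    · have : tsupport (φ ∘ e) = e ⁻¹' tsupport φ := by
        rw [tsupport, tsupport, Function.support_comp_eq_preimage]
        exact (e.toHomeomorph.preimage_closure _).symm
      rw [this]; exact Set.preimage_mono hs
    · exact (h_intg fun y => φ y ^ 2).trans h1
    · have k1 : ∫ z, ‖fderiv ℝ (φ ∘ e) z‖ ^ 2 =
          ∫ y : ℝ × ℝ, ((fderiv ℝ φ y (1, 0)) ^ 2 + (fderiv ℝ φ y (0, 1)) ^ 2) := by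
        rw [← h_intg]
        congr 1; funext z
        rw [clm_norm_sq, e.comp_right_fderiv]
        simp [he]
      have k2 := h_intg fun y => φ y ^ 2 * Real.exp (w y)
      rw [k1]
      simp only [Function.comp_apply]
      rw [k2]; exact h2

end PlanarProof

/-- limiting case of the Sphere Covering Inequality: if `Δw + e^w > 0` on the
closure of a bounded open simply connected `Ω ⊂ ℝ²`, `∫_Ω e^w ≤ 8π`, and `ω ⊂ Ω` is a
nonempty open set on which the first Dirichlet eigenvalue of `-Δ - e^w` is nonpositive,
then `∫_ω e^w > 4π`. -/
theorem first_eigenvalue_mass_bound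
    (Ω : Set (ℝ × ℝ)) (hbdd : Bornology.IsBounded Ω)
    (hopen : IsOpen Ω) (hsc : SimplyConnectedSpace Ω)
    (w : ℝ × ℝ → ℝ)
    (U : Set (ℝ × ℝ)) (hU : IsOpen U) (hclU : closure Ω ⊆ U)
    (hw : ContDiffOn ℝ 2 w U)
    (hsuper : ∀ y ∈ closure Ω, 0 < lap w y + Real.exp (w y))
    (hmass : (∫ y in Ω, Real.exp (w y)) ≤ 8 * Real.pi)
    (ω : Set (ℝ × ℝ)) (hω : ω ⊆ Ω) (hωne : ω.Nonempty) (hωopen : IsOpen ω)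
    (heig : ∀ ε > (0 : ℝ), ∃ φ : ℝ × ℝ → ℝ,
      ContDiff ℝ (⊤ : ℕ∞) φ ∧ HasCompactSupport φ ∧ tsupport φ ⊆ ω ∧
      (∫ y : ℝ × ℝ, (φ y) ^ 2) = 1 ∧
      (∫ y : ℝ × ℝ, ((fderiv ℝ φ y (1, 0)) ^ 2 + (fderiv ℝ φ y (0, 1)) ^ 2)) -
        (∫ y : ℝ × ℝ, (φ y) ^ 2 * Real.exp (w y)) ≤ ε) :
    4 * Real.pi < ∫ y in ω, Real.exp (w y) := by
  exact main_real Ω hbdd hopen hsc w U hU hclU hw hsuper hmass ω hω hωne hωopen heig
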